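/- Let F be an algebraically closed field of characteristic 0. If Q is a maximal finite abelian subgroup of Aut(𝔢₈) containing an element of order 6, then Q is isomorphic to ℤ₆³ = ℤ₆ × ℤ₆ × ℤ₆. -/

import Mathlib

open LieAlgebra

/-- The group of automorphisms of a Lie algebra, realized as the subgroup of the group
of linear automorphisms consisting of those preserving the bracket. -/
def lieAut (R L : Type*) [CommRing R] [LieRing L] [LieAlgebra R L] :
    Subgroup (L ≃ₗ[R] L) where
  carrier := {e | ∀ x y : L, e ⁅x, y⁆ = ⁅e x, e y⁆}
  one_mem' := fun _ _ => rfl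
  mul_mem' := by
    intro f g hf hg x y
    show f (g ⁅x, y⁆) = _
    rw [hg]
    exact hf _ _
  inv_mem' := by
    intro f hf x y
    apply f.injective
    show f (f.symm ⁅x, y⁆) = f ⁅f.symm x, f.symm y⁆
    rw [hf (f.symm x) (f.symm y), f.apply_symm_apply, f.apply_symm_apply, f.apply_symm_apply]

/-- The subalgebra of fixed points of an automorphism of a Lie algebra. -/
def fixedSubalgebra {R L : Type*} [CommRing R] [LieRing L] [LieAlgebra R L]
    (θ : lieAut R L) : LieSubalgebra R L where
  carrier := {x | (θ : L ≃ₗ[R] L) x = x}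
  add_mem' := by
    intro a b ha hb
    simp only [Set.mem_setOf_eq] at *
    rw [map_add, ha, hb]
  zero_mem' := map_zero _
  smul_mem' := by
    intro c a ha
    simp only [Set.mem_setOf_eq] at *
    rw [map_smul, ha]
  lie_mem' := by
    intro a b ha hb
    simp only [Set.mem_setOf_eq] at *
    rw [θ.2 a b, ha, hb]

/-- A maximal finite abelian subgroup: a finite abelian subgroup which is maximal among
all abelian subgroups. -/
def IsMaximalFiniteAbelian {G : Type*} [Group G] (Q : Subgroup G) : Prop :=
  Finite Q ∧ (∀ a b, a ∈ Q → b ∈ Q → a * b = b * a) ∧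
    ∀ Q' : Subgroup G, (∀ a b, a ∈ Q' → b ∈ Q' → a * b = b * a) → Q ≤ Q' → Q' = Q

/-- Two subgroups are conjugate. -/
def SubgroupIsConj {G : Type*} [Group G] (Q₁ Q₂ : Subgroup G) : Prop :=
  ∃ g : G, Q₂ = Q₁.map (MulAut.conj g).toMonoidHom


/-! ## The E8 lattice -/
namespace E8Proof

/-- The root lattice, in simple root coordinates. -/
abbrev Lam := Fin 8 → ℤ

/-- The inner product of the root lattice. -/
def ip (u v : Lam) : ℤ :=
  2 * (u 0 * v 0 + u 1 * v 1 + u 2 * v 2 + u 3 * v 3 + u 4 * v 4 + u 5 * v 5 + u 6 * v 6 + u 7 * v 7)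
  - (u 0 * v 2 + u 2 * v 0 + u 1 * v 3 + u 3 * v 1 + u 2 * v 3 + u 3 * v 2 + u 3 * v 4 + u 4 * v 3
    + u 4 * v 5 + u 5 * v 4 + u 5 * v 6 + u 6 * v 5 + u 6 * v 7 + u 7 * v 6)

/-- Simple roots. -/
def sr (i : Fin 8) : Lam := Pi.single i 1

lemma ip_comm (u v : Lam) : ip u v = ip v u := by simp only [ip]; ring
lemma ip_add_left (u v w : Lam) : ip (u + v) w = ip u w + ip v w := by
  simp only [ip, Pi.add_apply]; ring
lemma ip_add_right (u v w : Lam) : ip w (u + v) = ip w u + ip w v := by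
  simp only [ip, Pi.add_apply]; ring
lemma ip_sub_left (u v w : Lam) : ip (u - v) w = ip u w - ip v w := by
  simp only [ip, Pi.sub_apply]; ring
lemma ip_sub_right (u v w : Lam) : ip w (u - v) = ip w u - ip w v := by
  simp only [ip, Pi.sub_apply]; ring
lemma ip_neg_left (u w : Lam) : ip (-u) w = - ip u w := by
  simp only [ip, Pi.neg_apply]; ring
lemma ip_neg_right (u w : Lam) : ip w (-u) = - ip w u := by
  simp only [ip, Pi.neg_apply]; ring
lemma ip_smul_left (c : ℤ) (u w : Lam) : ip (c • u) w = c * ip u w := by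
  simp only [ip, Pi.smul_apply, smul_eq_mul]; ring
lemma ip_smul_right (c : ℤ) (u w : Lam) : ip w (c • u) = c * ip w u := by
  simp only [ip, Pi.smul_apply, smul_eq_mul]; ring
lemma ip_zero_left (w : Lam) : ip 0 w = 0 := by simp [ip]
lemma ip_zero_right (w : Lam) : ip w 0 = 0 := by simp [ip]

/-- The inner product as a linear map in the second variable. -/
def ipL (u : Lam) : Lam →ₗ[ℤ] ℤ where
  toFun := ip u
  map_add' := fun _ _ => ip_add_right _ _ _
  map_smul' := fun _ _ => ip_smul_right _ _ _

lemma ip_sum_right {ι : Type*} (s : Finset ι) (f : ι → Lam) (u : Lam) :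
    ip u (∑ i ∈ s, f i) = ∑ i ∈ s, ip u (f i) := map_sum (ipL u) f s

lemma sixty_ip (u : Lam) : 60 * ip u u = 30 * (2 * u 0 - u 2) ^ 2 + 10 * (3 * u 2 - 2 * u 3) ^ 2
    + 30 * (2 * u 1 - u 3) ^ 2 + 30 * (2 * u 7 - u 6) ^ 2 + 10 * (3 * u 6 - 2 * u 5) ^ 2
    + 5 * (4 * u 5 - 3 * u 4) ^ 2 + 3 * (5 * u 4 - 4 * u 3) ^ 2 + 2 * (u 3) ^ 2 := by
  simp only [ip]; ring

lemma ip_nonneg (u : Lam) : 0 ≤ ip u u := by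
  have := sixty_ip u
  have : 0 ≤ 60 * ip u u := by rw [this]; positivity
  omega

lemma eq_zero_of_ip (u : Lam) (h : ip u u = 0) : u = 0 := by
  have h1 := sixty_ip u
  rw [h] at h1
  have key : ∀ a b c d e f g k : ℤ, 60 * 0 = 30 * a ^ 2 + 10 * b ^ 2 + 30 * c ^ 2 + 30 * d ^ 2
      + 10 * e ^ 2 + 5 * f ^ 2 + 3 * g ^ 2 + 2 * k ^ 2 →
      a = 0 ∧ b = 0 ∧ c = 0 ∧ d = 0 ∧ e = 0 ∧ f = 0 ∧ g = 0 ∧ k = 0 := by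
    intro a b c d e f g k h
    have := sq_nonneg a; have := sq_nonneg b; have := sq_nonneg c; have := sq_nonneg d
    have := sq_nonneg e; have := sq_nonneg f; have := sq_nonneg g; have := sq_nonneg k
    refine ⟨?_, ?_, ?_, ?_, ?_, ?_, ?_, ?_⟩ <;>
      exact pow_eq_zero_iff (two_ne_zero) |>.1 (by linarith)
  obtain ⟨h1, h2, h3, h4, h5, h6, h7, h8⟩ := key _ _ _ _ _ _ _ _ h1
  funext i
  fin_cases i <;> simp <;> omega

lemma ip_pos {u : Lam} (h : u ≠ 0) : 0 < ip u u :=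
  lt_of_le_of_ne (ip_nonneg u) fun h' => h (eq_zero_of_ip u h'.symm)

lemma ip_even (u : Lam) : Even (ip u u) := by
  refine ⟨u 0 * u 0 + u 1 * u 1 + u 2 * u 2 + u 3 * u 3 + u 4 * u 4 + u 5 * u 5 + u 6 * u 6
    + u 7 * u 7 - (u 0 * u 2 + u 1 * u 3 + u 2 * u 3 + u 3 * u 4 + u 4 * u 5 + u 5 * u 6
    + u 6 * u 7), ?_⟩
  simp only [ip]; ring

lemma ip_two_le {u : Lam} (h : u ≠ 0) : 2 ≤ ip u u := by
  have h1 := ip_pos h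
  obtain ⟨k, hk⟩ := ip_even u
  omega

/-- The pairing of `u` with a simple root. -/
def pr (i : Fin 8) (u : Lam) : ℤ := ip (sr i) u

lemma pr_0 (u : Lam) : pr 0 u = 2 * u 0 - u 2 := by simp [pr, ip, sr, Pi.single_apply]
lemma pr_1 (u : Lam) : pr 1 u = 2 * u 1 - u 3 := by simp [pr, ip, sr, Pi.single_apply]
lemma pr_2 (u : Lam) : pr 2 u = 2 * u 2 - u 0 - u 3 := by
  simp [pr, ip, sr, Pi.single_apply]; ring
lemma pr_3 (u : Lam) : pr 3 u = 2 * u 3 - u 1 - u 2 - u 4 := by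
  simp [pr, ip, sr, Pi.single_apply]; ring
lemma pr_4 (u : Lam) : pr 4 u = 2 * u 4 - u 3 - u 5 := by
  simp [pr, ip, sr, Pi.single_apply]; ring
lemma pr_5 (u : Lam) : pr 5 u = 2 * u 5 - u 4 - u 6 := by
  simp [pr, ip, sr, Pi.single_apply]; ring
lemma pr_6 (u : Lam) : pr 6 u = 2 * u 6 - u 5 - u 7 := by
  simp [pr, ip, sr, Pi.single_apply]; ring
lemma pr_7 (u : Lam) : pr 7 u = 2 * u 7 - u 6 := by
  simp [pr, ip, sr, Pi.single_apply]

lemma ip_eq_sum (u v : Lam) : ip u v = ∑ i, u i * pr i v := by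
  simp only [Fin.sum_univ_eight, pr_0, pr_1, pr_2, pr_3, pr_4, pr_5, pr_6, pr_7]
  simp only [ip]; ring

lemma pr_eq_sum (i : Fin 8) (v : Lam) : pr i v = ∑ j, CartanMatrix.E₈ i j * v j := by
  rw [Fin.sum_univ_eight]
  fin_cases i <;> simp [pr_0, pr_1, pr_2, pr_3, pr_4, pr_5, pr_6, pr_7, CartanMatrix.E₈] <;> ring

lemma pr_sr (i j : Fin 8) : pr i (sr j) = CartanMatrix.E₈ i j := by
  rw [pr_eq_sum]; simp [sr, Pi.single_apply]

lemma pr_add (i : Fin 8) (u v : Lam) : pr i (u + v) = pr i u + pr i v := ip_add_right _ _ _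
lemma pr_sub (i : Fin 8) (u v : Lam) : pr i (u - v) = pr i u - pr i v := ip_sub_right _ _ _
lemma pr_neg (i : Fin 8) (u : Lam) : pr i (-u) = - pr i u := ip_neg_right _ _
lemma pr_smul (i : Fin 8) (c : ℤ) (u : Lam) : pr i (c • u) = c * pr i u := ip_smul_right _ _ _
lemma pr_zero (i : Fin 8) : pr i 0 = 0 := ip_zero_right _

/-- Inverse of the Cartan matrix: a vector with prescribed pairings. -/
def ofPr (k : Fin 8 → ℤ) : Lam :=
  ![4 * k 0 + 5 * k 1 + 7 * k 2 + 10 * k 3 + 8 * k 4 + 6 * k 5 + 4 * k 6 + 2 * k 7,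
    5 * k 0 + 8 * k 1 + 10 * k 2 + 15 * k 3 + 12 * k 4 + 9 * k 5 + 6 * k 6 + 3 * k 7,
    7 * k 0 + 10 * k 1 + 14 * k 2 + 20 * k 3 + 16 * k 4 + 12 * k 5 + 8 * k 6 + 4 * k 7,
    10 * k 0 + 15 * k 1 + 20 * k 2 + 30 * k 3 + 24 * k 4 + 18 * k 5 + 12 * k 6 + 6 * k 7,
    8 * k 0 + 12 * k 1 + 16 * k 2 + 24 * k 3 + 20 * k 4 + 15 * k 5 + 10 * k 6 + 5 * k 7,
    6 * k 0 + 9 * k 1 + 12 * k 2 + 18 * k 3 + 15 * k 4 + 12 * k 5 + 8 * k 6 + 4 * k 7,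
    4 * k 0 + 6 * k 1 + 8 * k 2 + 12 * k 3 + 10 * k 4 + 8 * k 5 + 6 * k 6 + 3 * k 7,
    2 * k 0 + 3 * k 1 + 4 * k 2 + 6 * k 3 + 5 * k 4 + 4 * k 5 + 3 * k 6 + 2 * k 7]

lemma pr_ofPr (k : Fin 8 → ℤ) (i : Fin 8) : pr i (ofPr k) = k i := by
  fin_cases i <;> simp [pr_0, pr_1, pr_2, pr_3, pr_4, pr_5, pr_6, pr_7, ofPr] <;> ring

lemma pr_injective {u v : Lam} (h : ∀ i, pr i u = pr i v) : u = v := by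
  rw [← sub_eq_zero]
  apply eq_zero_of_ip
  rw [ip_eq_sum]
  apply Finset.sum_eq_zero
  intro i _
  rw [pr_sub, h i, sub_self, mul_zero]

lemma ofPr_pr (u : Lam) : ofPr (fun i => pr i u) = u := pr_injective fun i => pr_ofPr _ i

/-- Table of positive roots. -/
def tbl : List (List ℕ) :=
  [[1,0,0,0,0,0,0,0], [0,1,0,0,0,0,0,0], [0,0,1,0,0,0,0,0], [0,0,0,1,0,0,0,0],
   [0,0,0,0,1,0,0,0], [0,0,0,0,0,1,0,0], [0,0,0,0,0,0,1,0], [0,0,0,0,0,0,0,1],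
   [1,0,1,0,0,0,0,0], [0,1,0,1,0,0,0,0], [0,0,1,1,0,0,0,0], [0,0,0,1,1,0,0,0],
   [0,0,0,0,1,1,0,0], [0,0,0,0,0,1,1,0], [0,0,0,0,0,0,1,1], [1,0,1,1,0,0,0,0],
   [0,1,1,1,0,0,0,0], [0,1,0,1,1,0,0,0], [0,0,1,1,1,0,0,0], [0,0,0,1,1,1,0,0],
   [0,0,0,0,1,1,1,0], [0,0,0,0,0,1,1,1], [1,1,1,1,0,0,0,0], [1,0,1,1,1,0,0,0],
   [0,1,1,1,1,0,0,0], [0,1,0,1,1,1,0,0], [0,0,1,1,1,1,0,0], [0,0,0,1,1,1,1,0],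
   [0,0,0,0,1,1,1,1], [1,1,1,1,1,0,0,0], [1,0,1,1,1,1,0,0], [0,1,1,2,1,0,0,0],
   [0,1,1,1,1,1,0,0], [0,1,0,1,1,1,1,0], [0,0,1,1,1,1,1,0], [0,0,0,1,1,1,1,1],
   [1,1,1,2,1,0,0,0], [1,1,1,1,1,1,0,0], [1,0,1,1,1,1,1,0], [0,1,1,2,1,1,0,0],
   [0,1,1,1,1,1,1,0], [0,1,0,1,1,1,1,1], [0,0,1,1,1,1,1,1], [1,1,2,2,1,0,0,0],
   [1,1,1,2,1,1,0,0], [1,1,1,1,1,1,1,0], [1,0,1,1,1,1,1,1], [0,1,1,2,2,1,0,0],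
   [0,1,1,2,1,1,1,0], [0,1,1,1,1,1,1,1], [1,1,2,2,1,1,0,0], [1,1,1,2,2,1,0,0],
   [1,1,1,2,1,1,1,0], [1,1,1,1,1,1,1,1], [0,1,1,2,2,1,1,0], [0,1,1,2,1,1,1,1],
   [1,1,2,2,2,1,0,0], [1,1,2,2,1,1,1,0], [1,1,1,2,2,1,1,0], [1,1,1,2,1,1,1,1],
   [0,1,1,2,2,2,1,0], [0,1,1,2,2,1,1,1], [1,1,2,3,2,1,0,0], [1,1,2,2,2,1,1,0],
   [1,1,2,2,1,1,1,1], [1,1,1,2,2,2,1,0], [1,1,1,2,2,1,1,1], [0,1,1,2,2,2,1,1],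
   [1,2,2,3,2,1,0,0], [1,1,2,3,2,1,1,0], [1,1,2,2,2,2,1,0], [1,1,2,2,2,1,1,1],
   [1,1,1,2,2,2,1,1], [0,1,1,2,2,2,2,1], [1,2,2,3,2,1,1,0], [1,1,2,3,2,2,1,0],
   [1,1,2,3,2,1,1,1], [1,1,2,2,2,2,1,1], [1,1,1,2,2,2,2,1], [1,2,2,3,2,2,1,0],
   [1,2,2,3,2,1,1,1], [1,1,2,3,3,2,1,0], [1,1,2,3,2,2,1,1], [1,1,2,2,2,2,2,1],
   [1,2,2,3,3,2,1,0], [1,2,2,3,2,2,1,1], [1,1,2,3,3,2,1,1], [1,1,2,3,2,2,2,1],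
   [1,2,2,4,3,2,1,0], [1,2,2,3,3,2,1,1], [1,2,2,3,2,2,2,1], [1,1,2,3,3,2,2,1],
   [1,2,3,4,3,2,1,0], [1,2,2,4,3,2,1,1], [1,2,2,3,3,2,2,1], [1,1,2,3,3,3,2,1],
   [2,2,3,4,3,2,1,0], [1,2,3,4,3,2,1,1], [1,2,2,4,3,2,2,1], [1,2,2,3,3,3,2,1],
   [2,2,3,4,3,2,1,1], [1,2,3,4,3,2,2,1], [1,2,2,4,3,3,2,1], [2,2,3,4,3,2,2,1],
   [1,2,3,4,3,3,2,1], [1,2,2,4,4,3,2,1], [2,2,3,4,3,3,2,1], [1,2,3,4,4,3,2,1],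
   [2,2,3,4,4,3,2,1], [1,2,3,5,4,3,2,1], [2,2,3,5,4,3,2,1], [1,3,3,5,4,3,2,1],
   [2,3,3,5,4,3,2,1], [2,2,4,5,4,3,2,1], [2,3,4,5,4,3,2,1], [2,3,4,6,4,3,2,1],
   [2,3,4,6,5,3,2,1], [2,3,4,6,5,4,2,1], [2,3,4,6,5,4,3,1], [2,3,4,6,5,4,3,2]]

/-- Convert a row into a lattice vector. -/
def toLam (l : List ℕ) : Lam := fun i => ((l.getD i.val 0 : ℕ) : ℤ)

/-- The roots. -/
def Phi : Finset Lam := (tbl.map toLam).toFinset ∪ (tbl.map fun l => - toLam l).toFinset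

/-- Increase an entry of a list. -/
def bump (l : List ℕ) (i : ℕ) : List ℕ := l.modify i (· + 1)

lemma tbl_len : ∀ l ∈ tbl, l.length = 8 := by decide +kernel

lemma tbl_norm : ∀ l ∈ tbl, ip (toLam l) (toLam l) = 2 := by decide +kernel

lemma tbl_closed : ∀ l ∈ tbl, ∀ i : Fin 8, pr i (toLam l) = -1 → bump l i.val ∈ tbl := by
  decide +kernel

lemma tbl_simple : ∀ i : Fin 8, bump [0,0,0,0,0,0,0,0] i.val ∈ tbl := by decide +kernel

lemma toLam_bump (l : List ℕ) (hl : l.length = 8) (i : Fin 8) :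
    toLam (bump l i.val) = toLam l + sr i := by
  funext j
  simp only [toLam, bump, Pi.add_apply, sr, Pi.single_apply]
  rw [List.getD_eq_getElem _ _ (by simp [hl]), List.getD_eq_getElem _ _ (by simp [hl])]
  rw [List.getElem_modify]
  by_cases h : j = i
  · subst h; simp
  · have : ¬ (i.val = j.val) := fun h' => h (Fin.ext h'.symm)
    simp [h, this]

lemma exists_pr_pos {u : Lam} (hu : 0 < ip u u) (h0 : ∀ i, 0 ≤ u i) :
    ∃ i, 0 < u i ∧ 0 < pr i u := by
  by_contra hcon
  push Not at hcon
  rw [ip_eq_sum] at hu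
  have : ∑ i, u i * pr i u ≤ 0 := by
    apply Finset.sum_nonpos
    intro i _
    rcases (h0 i).eq_or_lt with h | h
    · rw [← h]; simp
    · exact mul_nonpos_of_nonneg_of_nonpos h.le (hcon i h)
  omega

lemma ip_sr (i : Fin 8) : ip (sr i) (sr i) = 2 := by
  have := pr_sr i i
  rw [pr] at this
  rw [this]; simp

lemma sr_ne_zero (i : Fin 8) : sr i ≠ 0 := by
  intro h; have := ip_sr i; rw [h, ip_zero_left] at this; omega

lemma pr_self (i : Fin 8) : pr i (sr i) = 2 := ip_sr i

/-- a pairing between two roots -/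
lemma ip_le_one {u v : Lam} (hu : ip u u = 2) (hv : ip v v = 2) (h : u ≠ v) : ip u v ≤ 1 := by
  have h1 := ip_pos (sub_ne_zero.2 h)
  rw [ip_sub_left, ip_sub_right, ip_sub_right, ip_comm v u] at h1
  omega

/-- Induction principle for positive roots. -/
lemma pos_root_cases {u : Lam} (hu : ip u u = 2) (h0 : ∀ i, 0 ≤ u i) :
    (∃ i, u = sr i) ∨ ∃ i, pr i u = 1 ∧ (∀ j, 0 ≤ (u - sr i) j) ∧ ip (u - sr i) (u - sr i) = 2 := by
  obtain ⟨i, hi, hp⟩ := exists_pr_pos (by omega) h0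
  by_cases h : u = sr i
  · exact Or.inl ⟨i, h⟩
  · right
    have h1 : pr i u ≤ 1 := ip_le_one (ip_sr i) hu (Ne.symm h)
    have h2 : pr i u = 1 := by omega
    refine ⟨i, h2, ?_, ?_⟩
    · intro j
      simp only [Pi.sub_apply, sr, Pi.single_apply]
      split_ifs with hj
      · subst hj; omega
      · have := h0 j; omega
    · rw [ip_sub_left, ip_sub_right, ip_sub_right, ip_comm u (sr i), ip_sr, hu]
      unfold pr at h2; omega

/-- Height. -/
def ht (u : Lam) : ℤ := ∑ i, u i

lemma ht_add (u v : Lam) : ht (u + v) = ht u + ht v := by simp [ht, Finset.sum_add_distrib]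
lemma ht_sub (u v : Lam) : ht (u - v) = ht u - ht v := by simp [ht, Finset.sum_sub_distrib]
lemma ht_sr (i : Fin 8) : ht (sr i) = 1 := by simp [ht, sr]
lemma ht_smul (c : ℤ) (u : Lam) : ht (c • u) = c * ht u := by simp [ht, Finset.mul_sum]
lemma ht_nonneg {u : Lam} (h0 : ∀ i, 0 ≤ u i) : 0 ≤ ht u := Finset.sum_nonneg fun i _ => h0 i

lemma toLam_zero : toLam [0,0,0,0,0,0,0,0] = 0 := by decide +kernel

lemma pos_mem_tbl : ∀ (N : ℕ) (u : Lam), ht u ≤ N → ip u u = 2 → (∀ i, 0 ≤ u i) →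
    ∃ l ∈ tbl, u = toLam l := by
  intro N
  induction N with
  | zero =>
    intro u h hu h0
    exfalso
    have h2 : u = 0 := by
      funext i
      have h3 : ∑ i, u i = 0 := le_antisymm (by exact_mod_cast h) (ht_nonneg h0)
      exact (Finset.sum_eq_zero_iff_of_nonneg fun i _ => h0 i).1 h3 i (Finset.mem_univ i)
    rw [h2, ip_zero_left] at hu; omega
  | succ N ih =>
    intro u h hu h0
    rcases pos_root_cases hu h0 with ⟨i, rfl⟩ | ⟨i, h1, h2, h3⟩
    · refine ⟨_, tbl_simple i, ?_⟩
      rw [toLam_bump _ rfl, toLam_zero, zero_add]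
    · obtain ⟨l, hl, hl'⟩ := ih (u - sr i) (by rw [ht_sub, ht_sr]; push_cast at h; omega) h3 h2
      refine ⟨bump l i.val, tbl_closed l hl i ?_, ?_⟩
      · rw [← hl', pr_sub, pr_self, h1]; norm_num
      · rw [toLam_bump l (tbl_len l hl), ← hl']; abel

lemma root_sign {u : Lam} (hu : ip u u = 2) : (∀ i, 0 ≤ u i) ∨ (∀ i, 0 ≤ (-u) i) := by
  set p : Lam := fun i => max (u i) 0 with hp
  set m : Lam := fun i => max (- u i) 0 with hm
  have hum : u = p - m := by
    funext i; simp only [hp, hm, Pi.sub_apply]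
    rcases le_total 0 (u i) with h | h
    · rw [max_eq_left h, max_eq_right (by omega)]; omega
    · rw [max_eq_right h, max_eq_left (by omega)]; omega
  have hp0 : ∀ i, 0 ≤ p i := fun i => le_max_right _ _
  have hm0 : ∀ i, 0 ≤ m i := fun i => le_max_right _ _
  have hpm : ∀ i, p i * m i = 0 := by
    intro i; simp only [hp, hm]
    rcases le_total 0 (u i) with h | h
    · rw [max_eq_right (a := - u i) (by omega)]; simp
    · rw [max_eq_right h]; simp
  have hneg : ip p m ≤ 0 := by
    have := fun i j => mul_nonneg (hp0 i) (hm0 j)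
    simp only [ip, hpm]
    have h1 := this 0 2; have h2 := this 2 0; have h3 := this 1 3; have h4 := this 3 1
    have h5 := this 2 3; have h6 := this 3 2; have h7 := this 3 4; have h8 := this 4 3
    have h9 := this 4 5; have h10 := this 5 4; have h11 := this 5 6; have h12 := this 6 5
    have h13 := this 6 7; have h14 := this 7 6
    omega
  by_cases hpz : p = 0
  · right
    intro i
    have := hm0 i
    rw [hum, hpz]; simpa using this
  by_cases hmz : m = 0
  · left
    intro i
    have := hp0 i
    rw [hum, hmz]; simpa using this
  exfalso
  have h1 := ip_two_le hpz
  have h2 := ip_two_le hmz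
  rw [hum, ip_sub_left, ip_sub_right, ip_sub_right, ip_comm m p] at hu
  omega

lemma mem_Phi {u : Lam} : u ∈ Phi ↔ ip u u = 2 := by
  constructor
  · intro h
    simp only [Phi, Finset.mem_union, List.mem_toFinset, List.mem_map] at h
    rcases h with ⟨l, hl, rfl⟩ | ⟨l, hl, rfl⟩
    · exact tbl_norm l hl
    · rw [ip_neg_left, ip_neg_right, neg_neg]; exact tbl_norm l hl
  · intro h
    simp only [Phi, Finset.mem_union, List.mem_toFinset, List.mem_map]
    rcases root_sign h with h0 | h0
    · obtain ⟨l, hl, rfl⟩ := pos_mem_tbl (ht u).toNat u (by have := ht_nonneg h0; omega) h h0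
      exact Or.inl ⟨l, hl, rfl⟩
    · have h' : ip (-u) (-u) = 2 := by rw [ip_neg_left, ip_neg_right, neg_neg]; exact h
      obtain ⟨l, hl, h2⟩ := pos_mem_tbl (ht (-u)).toNat (-u) (by have := ht_nonneg h0; omega) h' h0
      exact Or.inr ⟨l, hl, by rw [← h2, neg_neg]⟩

lemma sr_mem_Phi (i : Fin 8) : sr i ∈ Phi := mem_Phi.2 (ip_sr i)

lemma neg_mem_Phi {u : Lam} (h : u ∈ Phi) : -u ∈ Phi := by
  rw [mem_Phi] at *; rw [ip_neg_left, ip_neg_right, neg_neg]; exact h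

lemma zero_not_mem_Phi : (0 : Lam) ∉ Phi := by
  rw [mem_Phi, ip_zero_left]; omega

end E8Proof

namespace E8Proof

lemma tbl_nodup : (tbl.map toLam).Nodup := by decide +kernel

lemma tbl_nonneg (l : List ℕ) (i : Fin 8) : 0 ≤ toLam l i := by simp [toLam]

lemma sum_Phi {M : Type*} [AddCommMonoid M] (f : Lam → M) :
    ∑ α ∈ Phi, f α = (tbl.map (fun l => f (toLam l) + f (-toLam l))).sum := by
  unfold Phi
  rw [Finset.sum_union]
  · have h2 : (tbl.map fun l => - toLam l).Nodup := by
      have : (tbl.map fun l => - toLam l) = (tbl.map toLam).map (fun u => -u) := by simp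
      rw [this]
      exact tbl_nodup.map neg_injective
    rw [List.sum_toFinset _ tbl_nodup, List.sum_toFinset _ h2, List.sum_map_add]
    simp [Function.comp_def]
  · rw [Finset.disjoint_left]
    intro a ha hb
    simp only [List.mem_toFinset, List.mem_map] at ha hb
    obtain ⟨l, hl, rfl⟩ := ha
    obtain ⟨l', hl', h⟩ := hb
    have h0 : toLam l = 0 := by
      funext i
      have := congrFun h i
      have h1 := tbl_nonneg l i
      have h2 := tbl_nonneg l' i
      simp only [Pi.neg_apply] at this
      simp only [Pi.zero_apply]; omega
    have := tbl_norm l hl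
    rw [h0] at this
    simp [ip] at this

lemma sum_list_apply (L : List Lam) (i : Fin 8) : L.sum i = (L.map (fun u => u i)).sum := by
  induction L with
  | nil => rfl
  | cons a L ih => simp [ih]

def IsI (g : Lam ≃ₗ[ℤ] Lam) : Prop := ∀ u v, ip (g u) (g v) = ip u v

lemma IsI.symm {g : Lam ≃ₗ[ℤ] Lam} (h : IsI g) : IsI g.symm := fun u v => by
  rw [← h]; simp
lemma IsI.trans {g h : Lam ≃ₗ[ℤ] Lam} (hg : IsI g) (hh : IsI h) : IsI (g.trans h) := fun u v => by
  simp [hh _ _, hg _ _]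
lemma IsI.mem {g : Lam ≃ₗ[ℤ] Lam} (h : IsI g) {a : Lam} (ha : a ∈ Phi) : g a ∈ Phi := by
  rw [mem_Phi] at *; rw [h, ha]
lemma IsI.refl : IsI (LinearEquiv.refl ℤ Lam) := fun _ _ => rfl

/-- reflection in a root -/
def rfl0 (a : Lam) : Lam →ₗ[ℤ] Lam := LinearMap.id - (ipL a).smulRight a

lemma rfl0_apply (a u : Lam) : rfl0 a u = u - ip a u • a := by
  simp [rfl0, ipL]

lemma rfl0_invol {a : Lam} (ha : ip a a = 2) : Function.Involutive (rfl0 a) := fun u => by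
  rw [rfl0_apply, rfl0_apply, ip_sub_right, ip_smul_right, ha]
  rw [show ip a u - ip a u * 2 = - ip a u by ring]; simp

def rflE (a : Lam) (ha : ip a a = 2) : Lam ≃ₗ[ℤ] Lam :=
  LinearEquiv.ofInvolutive (rfl0 a) (rfl0_invol ha)

lemma rflE_apply (a : Lam) (ha : ip a a = 2) (u : Lam) : rflE a ha u = u - ip a u • a :=
  rfl0_apply a u

lemma rflE_isI (a : Lam) (ha : ip a a = 2) : IsI (rflE a ha) := fun u v => by
  simp only [rflE_apply, ip_sub_left, ip_sub_right, ip_smul_left, ip_smul_right, ha, ip_comm u a]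
  ring

def rho : Lam := ofPr (fun _ => 1)

lemma pr_rho (i : Fin 8) : pr i rho = 1 := pr_ofPr _ _

lemma exists_dominant (v : Lam) : ∃ g, IsI g ∧ ∀ i, 0 ≤ pr i (g v) := by
  obtain ⟨m, ⟨g, hg, rfl⟩, hmax⟩ := Int.exists_greatest_of_bdd
    (P := fun m => ∃ g, IsI g ∧ ip (g v) rho = m)
    ⟨ip v v + ip rho rho, by
      rintro z ⟨g, hg, rfl⟩
      have h1 := ip_nonneg (g v - rho)
      have h3 := ip_nonneg (v)
      have h4 := ip_nonneg (rho)
      simp only [ip_sub_left, ip_sub_right, hg _ _, ip_comm rho (g v)] at h1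
      linarith⟩ ⟨_, _, IsI.refl, rfl⟩
  refine ⟨g, hg, fun i => ?_⟩
  by_contra hlt
  push Not at hlt
  have := hmax _ ⟨g.trans (rflE (sr i) (ip_sr i)), hg.trans (rflE_isI _ _), rfl⟩
  rw [LinearEquiv.trans_apply, rflE_apply, ip_sub_left, ip_smul_left] at this
  have h1 : ip (sr i) rho = 1 := pr_rho i
  have h2 : ip (sr i) (g v) = pr i (g v) := rfl
  rw [h1, h2] at this
  linarith

/-- highest root -/
def mth : Lam := ![2,3,4,6,5,4,3,2]

lemma mth_mem : mth ∈ Phi := by rw [mem_Phi]; decide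

lemma ip_eq_sum' (u v : Lam) : ip u v = ∑ i, pr i u * v i := by
  rw [ip_comm, ip_eq_sum]; exact Finset.sum_congr rfl fun i _ => mul_comm _ _

lemma norm_le_of_dom (n : ℤ) (z : Lam) (h0 : ∀ i, 0 ≤ pr i z) (hm : ip z mth ≤ n) : ip z z ≤ n^2 := by
  have hn : ∑ i, pr i z * mth i ≤ n := by rwa [← ip_eq_sum']
  have key : ∀ i, z i ≤ mth i * n := by
    intro i
    have hz : z = ofPr (fun i => pr i z) := (ofPr_pr z).symm
    rw [hz]
    generalize pr = p at h0 hn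
    have h00 := h0 0
    have h01 := h0 1
    have h02 := h0 2
    have h03 := h0 3
    have h04 := h0 4
    have h05 := h0 5
    have h06 := h0 6
    have h07 := h0 7
    simp [Fin.sum_univ_eight, mth] at hn
    fin_cases i <;> simp [ofPr, mth] <;> linarith
  rw [ip_eq_sum']
  have hm0 : ∀ i, 0 ≤ mth i := by decide
  have hnn : 0 ≤ n := le_trans (Finset.sum_nonneg fun i _ => mul_nonneg (h0 i) (hm0 i)) hn
  calc ∑ i, pr i z * z i ≤ ∑ i, pr i z * (mth i * n) :=
        Finset.sum_le_sum fun i _ => mul_le_mul_of_nonneg_left (key i) (h0 i)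
    _ = (∑ i, pr i z * mth i) * n := by rw [Finset.sum_mul]; exact Finset.sum_congr rfl fun i _ => by ring
    _ ≤ n * n := mul_le_mul_of_nonneg_right hn hnn
    _ = n^2 := by ring

lemma norm_le (n : ℤ) (z : Lam) (h : ∀ a ∈ Phi, ip z a ≤ n) : ip z z ≤ n^2 := by
  obtain ⟨g, hg, hd⟩ := exists_dominant z
  rw [← hg]
  apply norm_le_of_dom n _ hd
  have := h _ (hg.symm.mem mth_mem)
  rw [← hg] at this
  simpa using this

def subL (b : Fin 8 → Bool) : List (List ℕ) :=
  tbl.filter fun l => ((List.range 8).all fun i =>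
    ! (if h : i < 8 then b ⟨i, h⟩ else false) || (l.getD i 0 == [2,3,4,6,5,4,3,2].getD i 0))

def bv (b0 b1 b2 b3 b4 b5 b6 b7 : Bool) : Fin 8 → Bool := ![b0,b1,b2,b3,b4,b5,b6,b7]

def sumc (L : List (List ℕ)) (i : Fin 8) : ℕ := (L.map fun l => l.getD i.val 0).sum

def chkI (b : Fin 8 → Bool) : Bool :=
  let L := subL b
  if (L.length + 1) % 6 = 0 then
    let s : Lam := fun i => ((sumc L i : ℕ) : ℤ)
    if ∀ i, (0 < pr i s ↔ b i = true) then
      (L.length == 5) && decide (∀ i, s i = (![10,15,20,30,24,18,12,6] : Lam) i)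
    else true
  else true

lemma chkI_all : ∀ b0 b1 b2 b3 b4 b5 b6 b7 : Bool,
    ((b0 || b1 || b2 || b3 || b4 || b5 || b6 || b7) = true → chkI (bv b0 b1 b2 b3 b4 b5 b6 b7) = true) := by
  decide +kernel

end E8Proof

namespace E8Proof

def om4 : Lam := ![10,15,20,30,24,18,12,6]

lemma tbl_le_mth : ∀ l ∈ tbl, ∀ i : Fin 8, toLam l i ≤ mth i := by decide +kernel

lemma mem_Phi_tbl {a : Lam} (h : a ∈ Phi) : ∃ l ∈ tbl, a = toLam l ∨ a = - toLam l := by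
  simp only [Phi, Finset.mem_union, List.mem_toFinset, List.mem_map] at h
  rcases h with ⟨l, hl, rfl⟩ | ⟨l, hl, rfl⟩
  · exact ⟨l, hl, Or.inl rfl⟩
  · exact ⟨l, hl, Or.inr rfl⟩

lemma toLam_mem {l : List ℕ} (h : l ∈ tbl) : toLam l ∈ Phi := mem_Phi.2 (tbl_norm l h)

lemma chkI_fun (b : Fin 8 → Bool) (hb : ∃ i, b i = true) : chkI b = true := by
  have : b = bv (b 0) (b 1) (b 2) (b 3) (b 4) (b 5) (b 6) (b 7) := by
    funext i; fin_cases i <;> rfl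
  rw [this]
  apply chkI_all
  obtain ⟨i, hi⟩ := hb
  fin_cases i <;> simp at hi <;> simp [hi]

/-- sums over the maximal roots for a dominant vector -/
lemma phi1_sum {M : Type*} [AddCommMonoid M] (n : ℤ) (hn : 0 < n) (y : Lam) (h0 : ∀ i, 0 ≤ pr i y)
    (hy : ∀ a ∈ Phi, ip y a ≤ n) (hne : ∃ a ∈ Phi, ip y a = n) (f : Lam → M) :
    ∑ a ∈ Phi with ip y a = n, f a
      = ((subL (fun i => decide (0 < pr i y))).map (fun l => f (toLam l))).sum := by
  have hneg : ∀ l ∈ tbl, ip y (toLam l) ≥ 0 := fun l _ => by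
    rw [ip_eq_sum']; exact Finset.sum_nonneg fun i _ => mul_nonneg (h0 i) (tbl_nonneg l i)
  have hle : ∀ l ∈ tbl, ip y (toLam l) ≤ ip y mth := fun l hl => by
    rw [ip_eq_sum', ip_eq_sum']
    exact Finset.sum_le_sum fun i _ => mul_le_mul_of_nonneg_left (tbl_le_mth l hl i) (h0 i)
  have hmn : ip y mth = n := by
    apply le_antisymm (hy _ mth_mem)
    obtain ⟨a, ha, hn'⟩ := hne
    obtain ⟨l, hl, rfl | rfl⟩ := mem_Phi_tbl ha
    · rw [← hn']; exact hle l hl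
    · have := hneg l hl
      rw [ip_neg_right] at hn'; omega
  rw [Finset.sum_filter, sum_Phi]
  have h1 : (tbl.map (fun l => (if ip y (toLam l) = n then f (toLam l) else 0) +
      if ip y (-toLam l) = n then f (-toLam l) else 0)) =
      tbl.map (fun l => if (∀ i, 0 < pr i y → toLam l i = mth i) then f (toLam l) else 0) := by
    apply List.map_congr_left
    intro l hl
    have : ¬ (ip y (-toLam l) = n) := by
      have := hneg l hl
      rw [ip_neg_right]; omega
    rw [if_neg this, add_zero]
    have e : ip y (toLam l) = n ↔ (∀ i, 0 < pr i y → toLam l i = mth i) := by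
      rw [← hmn, ip_eq_sum', ip_eq_sum', Finset.sum_eq_sum_iff_of_le
        (fun i _ => mul_le_mul_of_nonneg_left (tbl_le_mth l hl i) (h0 i))]
      constructor
      · intro h i hi
        exact mul_left_cancel₀ hi.ne' (h i (Finset.mem_univ _))
      · intro h i _
        rcases (h0 i).lt_or_eq with h' | h'
        · rw [h i h']
        · rw [← h']; simp
    simp only [e]
  rw [h1]
  unfold subL
  have h2 : ∀ l, ((List.range 8).all fun i =>
      ! (if h : i < 8 then decide (0 < pr ⟨i, h⟩ y) else false) ||
        (l.getD i 0 == [2,3,4,6,5,4,3,2].getD i 0)) = true ↔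
      (∀ i, 0 < pr i y → toLam l i = mth i) := by
    intro l
    rw [List.all_eq_true]
    constructor
    · intro h i hi
      have := h i.val (by simp)
      simp only [Fin.is_lt, dif_pos, Fin.eta, hi, decide_true, Bool.not_true, Bool.false_or,
        beq_iff_eq] at this
      simp only [toLam]
      rw [this]
      fin_cases i <;> rfl
    · intro h i hi
      have hi8 : i < 8 := by simpa using hi
      rw [dif_pos hi8]
      by_cases hp : 0 < pr ⟨i, hi8⟩ y
      · have := h ⟨i, hi8⟩ hp
        have hm : mth ⟨i, hi8⟩ = (([2,3,4,6,5,4,3,2].getD i 0 : ℕ) : ℤ) := by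
          interval_cases i <;> rfl
        rw [hm] at this
        simp only [toLam] at this
        simp only [hp, decide_true, Bool.not_true, Bool.false_or, beq_iff_eq]
        exact_mod_cast this
      · simp [hp]
  generalize tbl = T
  induction T with
  | nil => simp
  | cons l T ih =>
    rw [List.map_cons, List.sum_cons, ih, List.filter_cons]
    by_cases hl : (∀ i, 0 < pr i y → toLam l i = mth i)
    · rw [if_pos hl, if_pos ((h2 l).2 hl)]; simp
    · rw [if_neg hl, if_neg (by rw [h2 l]; exact hl)]; simp

lemma lattice_dom (n : ℤ) (hn : 0 < n) (h6 : 6 ∣ n) (y : Lam) (h0 : ∀ i, 0 ≤ pr i y)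
    (hy : ∀ a ∈ Phi, ip y a ≤ n) (A : Set (Lam ≃ₗ[ℤ] Lam)) (hA : ∀ a ∈ A, IsI a)
    (hfix : ∀ u, (∀ a ∈ A, a u = u) → u = 0)
    (hAy : ∀ a ∈ A, ∃ w, a y = y + n • w)
    (hord : ∀ k : ℤ, (∃ w, k • y = n • w) → n ∣ k) : n = 6 ∧ y = om4 := by
  have hn6 : 6 ≤ n := Int.le_of_dvd hn h6
  set P1 := {a ∈ Phi | ip y a = n} with hP1
  have memP1 : ∀ {a}, a ∈ P1 ↔ a ∈ Phi ∧ ip y a = n := by simp [hP1]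
  set R : Finset Lam := insert y (P1.image fun a => y - n • a) with hR
  have memR : ∀ z, z ∈ R ↔ (∃ w, z = y + n • w) ∧ ∀ a ∈ Phi, ip z a ≤ n := by
    intro z
    rw [hR, Finset.mem_insert, Finset.mem_image]
    constructor
    · rintro (rfl | ⟨a, ha, rfl⟩)
      · exact ⟨⟨0, by simp⟩, hy⟩
      · rw [memP1] at ha
        refine ⟨⟨-a, by simp [sub_eq_add_neg]⟩, fun b hb => ?_⟩
        have ha2 := mem_Phi.1 ha.1
        have hI := rflE_isI a ha2
        have e : y - n • a = rflE a ha2 y := by rw [rflE_apply, ip_comm, ha.2]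
        rw [e, ← hI.symm]
        simpa using hy _ (hI.symm.mem hb)
    · rintro ⟨⟨w, rfl⟩, hz⟩
      have hz2 := norm_le n _ hz
      have hy2 := norm_le n _ hy
      have hp := ip_nonneg (y + (y + n • w))
      have hw : ip w w ≤ 4 ∧ (ip w w = 4 → y + (y + n • w) = 0) := by
        have e : n^2 * ip w w + ip (y + (y + n • w)) (y + (y + n • w)) =
            2 * ip y y + 2 * ip (y + n • w) (y + n • w) := by
          simp only [ip_add_left, ip_add_right, ip_smul_left, ip_smul_right, ip_comm w y]; ring
        constructor
        · by_contra h
          push Not at h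
          have : n^2 * 5 ≤ n^2 * ip w w := mul_le_mul_of_nonneg_left h (sq_nonneg n)
          nlinarith
        · intro h
          rw [h] at e
          apply eq_zero_of_ip
          nlinarith
      by_cases hw0 : w = 0
      · left; simp [hw0]
      have h2 := ip_two_le hw0
      obtain ⟨r, hr⟩ := ip_even w
      have hw4 : ip w w ≠ 4 := by
        intro h4
        have := hw.2 h4
        have := hord 2 ⟨-w, by
          rw [smul_neg, ← sub_eq_zero, sub_neg_eq_add, two_smul, ← this, add_assoc]⟩
        have := Int.le_of_dvd (by norm_num) this
        omega
      have hw2 : ip w w = 2 := by omega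
      right
      have hwP := mem_Phi.2 hw2
      refine ⟨-w, memP1.2 ⟨neg_mem_Phi hwP, le_antisymm (hy _ (neg_mem_Phi hwP)) ?_⟩, by simp⟩
      have := hz w hwP
      rw [ip_add_left, ip_smul_left, hw2] at this
      rw [ip_neg_right]; linarith
  have hsum : ∑ z ∈ R, z = 0 := by
    apply hfix
    intro a ha
    have himg : R.image a = R := by
      apply Finset.eq_of_subset_of_card_le
      · intro z hz
        rw [Finset.mem_image] at hz
        obtain ⟨z, hz, rfl⟩ := hz
        rw [memR] at hz ⊢
        obtain ⟨⟨w, rfl⟩, hz⟩ := hz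
        obtain ⟨w', hw'⟩ := hAy a ha
        refine ⟨⟨w' + a w, by rw [map_add, hw', map_smul, smul_add, add_assoc]⟩, fun b hb => ?_⟩
        rw [← (hA a ha).symm]
        simpa using hz _ ((hA a ha).symm.mem hb)
      · rw [Finset.card_image_of_injective _ a.injective]
    conv_rhs => rw [← himg]
    rw [Finset.sum_image (fun _ _ _ _ h => a.injective h), map_sum]
  have hinj : Function.Injective fun a : Lam => y - n • a := fun a b h => by
    simp only [sub_right_inj] at h
    exact smul_right_injective _ hn.ne' h
  have hnot : y ∉ P1.image fun a => y - n • a := by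
    rw [Finset.mem_image]
    rintro ⟨a, ha, h⟩
    have : n • a = 0 := by simpa using h
    have ha0 : a = 0 := by
      rcases smul_eq_zero.1 this with h | h
      · omega
      · exact h
    rw [memP1, ha0] at ha
    exact zero_not_mem_Phi ha.1
  rw [hR, Finset.sum_insert hnot, Finset.sum_image (fun _ _ _ _ h => hinj h),
    Finset.sum_sub_distrib, Finset.sum_const, ← Finset.smul_sum] at hsum
  have hsum' : ((P1.card : ℤ) + 1) • y = n • ∑ a ∈ P1, a := by
    rw [add_smul, one_smul, natCast_zsmul, ← sub_eq_zero, ← hsum]; abel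
  have hdvd := hord _ ⟨_, hsum'⟩
  have hne : ∃ a ∈ Phi, ip y a = n := by
    by_contra hcon
    push Not at hcon
    have : P1 = ∅ := by
      rw [hP1, Finset.filter_eq_empty_iff]; exact fun a ha => hcon a ha
    rw [this] at hdvd
    have := Int.le_of_dvd (by norm_num) hdvd
    simp at this; omega
  obtain ⟨k, hk⟩ := hdvd
  have hk0 : 0 < k := by
    by_contra h
    have : n * k ≤ 0 := mul_nonpos_of_nonneg_of_nonpos hn.le (by omega)
    omega
  have hky : k • y = ∑ a ∈ P1, a := by
    rw [hk, mul_smul] at hsum'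
    exact smul_right_injective _ hn.ne' hsum'
  set b : Fin 8 → Bool := fun i => decide (0 < pr i y) with hb
  have hcard : P1.card = (subL b).length := by
    rw [Finset.card_eq_sum_ones, phi1_sum n hn y h0 hy hne]; simp [hb]
  have hs : ∑ a ∈ P1, a = fun i => ((sumc (subL b) i : ℕ) : ℤ) := by
    rw [phi1_sum n hn y h0 hy hne (fun a => a)]
    funext i
    rw [sum_list_apply, sumc]
    simp only [List.map_map, ← hb]
    generalize subL b = T
    induction T with
    | nil => simp
    | cons l T ih => simp [ih, toLam]
  have hbe : ∃ i, b i = true := by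
    by_contra hcon
    push Not at hcon
    obtain ⟨a, _, ha⟩ := hne
    have hz : ∀ i, pr i y = 0 := fun i => by
      have := hcon i
      simp only [hb, decide_eq_true_eq, ne_eq] at this
      have := h0 i; omega
    rw [ip_eq_sum'] at ha
    simp [hz] at ha; omega
  have hc := chkI_fun b hbe
  unfold chkI at hc
  simp only at hc
  rw [if_pos (by
    have h66 : (6:ℤ) ∣ (P1.card : ℤ) + 1 := hk ▸ h6.mul_right k
    rw [← hcard]; omega), if_pos (by
    intro i
    rw [← hs, ← hky, pr_smul]
    simp only [hb, decide_eq_true_eq]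
    exact ⟨fun h => pos_of_mul_pos_right h hk0.le, fun h => mul_pos hk0 h⟩)] at hc
  simp only [Bool.and_eq_true, beq_iff_eq, decide_eq_true_eq] at hc
  rw [← hcard] at hc
  rw [hc.1] at hk
  have hnk : n * k = 6 := by rw [← hk]; norm_num
  have hk1 : k = 1 := by nlinarith
  subst hk1
  refine ⟨by omega, ?_⟩
  rw [one_smul] at hky
  funext i
  rw [hky, hs]
  exact hc.2 i

lemma lattice_main (n : ℤ) (hn : 0 < n) (h6 : 6 ∣ n) (v : Lam)
    (A : Set (Lam ≃ₗ[ℤ] Lam)) (hA : ∀ a ∈ A, IsI a)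
    (hfix : ∀ u, (∀ a ∈ A, a u = u) → u = 0)
    (hAv : ∀ a ∈ A, ∃ w, a v = v + n • w)
    (hord : ∀ k : ℤ, (∃ w, k • v = n • w) → n ∣ k) :
    n = 6 ∧ ∃ g, IsI g ∧ ∃ w, g v = om4 + (6:ℤ) • w := by
  -- minimal norm representative
  obtain ⟨m, ⟨w0, hw0⟩, hmin⟩ := Int.exists_least_of_bdd
    (P := fun m => ∃ w, ip (v + n • w) (v + n • w) = m)
    ⟨0, by rintro z ⟨w, rfl⟩; exact ip_nonneg _⟩ ⟨_, 0, rfl⟩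
  set v0 := v + n • w0 with hv0
  have hv0n : ∀ a ∈ Phi, ip v0 a ≤ n := by
    intro a ha
    have := hmin _ ⟨w0 - a, rfl⟩
    have e : v + n • (w0 - a) = v0 - n • a := by rw [hv0, smul_sub]; abel
    rw [e, ← hw0] at this
    simp only [ip_sub_left, ip_sub_right, ip_smul_left, ip_smul_right, mem_Phi.1 ha, ip_comm a v0] at this
    have h' : 0 ≤ n * (2 * n - 2 * ip v0 a) := by linarith
    have := nonneg_of_mul_nonneg_right h' hn
    linarith
  obtain ⟨g, hg, hd⟩ := exists_dominant v0
  obtain ⟨h1, h2⟩ := lattice_dom n hn h6 (g v0) hd (fun a ha => by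
      rw [← hg.symm]; simpa using hv0n _ (hg.symm.mem ha))
    ((fun a : Lam ≃ₗ[ℤ] Lam => (g.symm.trans a).trans g) '' A)
    (by rintro _ ⟨a, ha, rfl⟩; exact (hg.symm.trans (hA a ha)).trans hg)
    (by
      intro u hu
      have := hfix (g.symm u) (fun a ha => by
        have := hu _ ⟨a, ha, rfl⟩
        simp only [LinearEquiv.trans_apply] at this
        rw [← g.symm_apply_apply (a (g.symm u)), this])
      simpa using this)
    (by
      rintro _ ⟨a, ha, rfl⟩
      obtain ⟨w, hw⟩ := hAv a ha
      refine ⟨g (w + a w0 - w0), ?_⟩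
      simp only [LinearEquiv.trans_apply, LinearEquiv.symm_apply_apply]
      rw [← map_smul, ← map_add, hv0, map_add, hw, map_smul]
      congr 1
      rw [smul_sub, smul_add]; abel)
    (by
      rintro k ⟨w, hw⟩
      apply hord k
      refine ⟨g.symm w - k • w0, ?_⟩
      have : k • v0 = n • g.symm w := by
        apply g.injective
        rw [map_smul, map_smul, g.apply_symm_apply]; exact hw
      rw [smul_sub, ← this, hv0, smul_add, smul_comm n k]; abel)
  subst h1
  refine ⟨rfl, g, hg, g (-w0), ?_⟩
  rw [← h2, ← map_smul, ← map_add, hv0]; simp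

lemma sum_pr_pr : ∀ i j : Fin 8,
    (tbl.map (fun l => pr i (toLam l) * pr j (toLam l) + pr i (-toLam l) * pr j (-toLam l))).sum
      = 60 * CartanMatrix.E₈ i j := by decide +kernel

lemma sum_Phi_pr (i j : Fin 8) : ∑ a ∈ Phi, pr i a * pr j a = 60 * CartanMatrix.E₈ i j := by
  rw [sum_Phi]; exact sum_pr_pr i j

lemma count_list : ∀ k : Fin 6, (tbl.map (fun l => (if toLam l 3 % 6 = (k.val : ℤ) then 1 else 0) +
     (if (-toLam l) 3 % 6 = (k.val : ℤ) then 1 else 0))).sum = (![38,36,45,40,45,36] : Fin 6 → ℕ) k := by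
  decide +kernel

lemma count_Phi (k : Fin 6) : ({a ∈ Phi | a 3 % 6 = (k.val : ℤ)}).card
    = (![38,36,45,40,45,36] : Fin 6 → ℕ) k := by
  rw [Finset.card_eq_sum_ones, Finset.sum_filter, sum_Phi]; exact count_list k

lemma ip_om4 (u : Lam) : ip om4 u = u 3 := by
  rw [ip_eq_sum', Fin.sum_univ_eight]
  simp [pr_0, pr_1, pr_2, pr_3, pr_4, pr_5, pr_6, pr_7, om4]


def eM (i j : Fin 8) : ℤ := CartanMatrix.E₈ i j

lemma eM_ne : ∀ i j : Fin 8, i ≠ j → 2 = eM i j → False := by decide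

set_option synthInstance.maxSize 2000 in
set_option synthInstance.maxHeartbeats 400000 in
lemma perm_id : ∀ p0 p1 : Fin 8, eM p0 p1 = 0 → p0 ≠ p1 → ∀ p2 : Fin 8,
    eM p0 p2 = -1 → eM p1 p2 = 0 → p1 ≠ p2 → ∀ p3, 
    eM p2 p3 = -1 → eM p1 p3 = -1 → eM p0 p3 = 0 → p0 ≠ p3 →
    ∀ p4, eM p3 p4 = -1 → p4 ≠ p2 → p4 ≠ p1 → 
    ∀ p5, eM p4 p5 = -1 → p5 ≠ p3 → ∀ p6, eM p5 p6 = -1 → p6 ≠ p4 →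
    ∀ p7, eM p6 p7 = -1 → p7 ≠ p5 → 
    p0 = 0 ∧ p1 = 1 ∧ p2 = 2 ∧ p3 = 3 ∧ p4 = 4 ∧ p5 = 5 ∧ p6 = 6 ∧ p7 = 7 := by decide +kernel

lemma chamber_dom (w : Lam ≃ₗ[ℤ] Lam) (hw : IsI w) (x : Lam) (hd : ∀ i, 0 < pr i x)
    (hx : w x = x) : ∀ u, w u = u := by
  have pos : ∀ (w : Lam ≃ₗ[ℤ] Lam), IsI w → w x = x → ∀ i, ∃ l ∈ tbl, w (sr i) = toLam l := by
    intro w hw hx i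
    obtain ⟨l, hl, h | h⟩ := mem_Phi_tbl (hw.mem (sr_mem_Phi i))
    · exact ⟨l, hl, h⟩
    · exfalso
      have h1 : ip (w (sr i)) (w x) = pr i x := hw _ _
      rw [h, hx, ip_neg_left, ip_comm, ip_eq_sum'] at h1
      have : 0 ≤ ∑ i, pr i x * toLam l i :=
        Finset.sum_nonneg fun i _ => mul_nonneg (hd i).le (tbl_nonneg l i)
      have := hd i
      omega
  have p1 := pos w hw hx
  have p2 := pos w.symm hw.symm (by rw [LinearEquiv.symm_apply_eq, hx])
  have dec : ∀ (w : Lam ≃ₗ[ℤ] Lam) (u : Lam), w u = ∑ i, u i • w (sr i) := by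
    intro w u
    conv_lhs => rw [show u = ∑ i, u i • sr i by
      funext j; simp [sr, Finset.sum_apply, Pi.single_apply]]
    rw [map_sum]
    exact Finset.sum_congr rfl fun i _ => map_smul _ _ _
  have hsum : ∀ (f : Fin 8 → Lam) (u : Lam), ht (∑ i, u i • f i) = ∑ i, u i * ht (f i) := by
    intro f u
    simp only [Fin.sum_univ_eight, ht_add, ht_smul]
  have hge : ∀ (w : Lam ≃ₗ[ℤ] Lam), (∀ i, ∃ l ∈ tbl, w (sr i) = toLam l) →
      ∀ u : Lam, (∀ i, 0 ≤ u i) → ht u ≤ ht (w u) := by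
    intro w hw u hu
    rw [dec w u, hsum]
    apply Finset.sum_le_sum
    intro i _
    have : 1 ≤ ht (w (sr i)) := by
      obtain ⟨l, hl, h⟩ := hw i
      have h0 : 0 ≤ ht (w (sr i)) := ht_nonneg (by rw [h]; exact tbl_nonneg l)
      by_contra hlt
      have h1 : ht (w (sr i)) = 0 := by omega
      have : w (sr i) = 0 := by
        funext j
        unfold ht at h1
        exact (Finset.sum_eq_zero_iff_of_nonneg (fun i _ => by rw [h]; exact tbl_nonneg l i)).1 h1 j
          (Finset.mem_univ j)
      exact sr_ne_zero i (w.injective (by simpa using this))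
    nlinarith [hu i]
  have hone : ∀ i, ∃ j, w (sr i) = sr j := by
    intro i
    obtain ⟨l, hl, h⟩ := p1 i
    have h1 := hge w.symm p2 (w (sr i)) (by rw [h]; exact tbl_nonneg l)
    rw [LinearEquiv.symm_apply_apply, ht_sr] at h1
    rcases pos_root_cases (u := w (sr i)) (by rw [hw, ip_sr]) (by rw [h]; exact tbl_nonneg l) with h2 | h2
    · exact h2
    · exfalso
      obtain ⟨k, _, h3, h4⟩ := h2
      have h5 : ht (w (sr i) - sr k) = 0 := by
        have := ht_nonneg h3
        rw [ht_sub, ht_sr] at *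
        omega
      have h6 : w (sr i) - sr k = 0 := by
        funext j
        exact (Finset.sum_eq_zero_iff_of_nonneg (fun i _ => h3 i)).1 h5 j (Finset.mem_univ j)
      rw [h6, ip_zero_left] at h4
      omega
  choose p hp using hone
  have hE : ∀ i j, CartanMatrix.E₈ (p i) (p j) = CartanMatrix.E₈ i j := by
    intro i j
    rw [← pr_sr, ← pr_sr]; unfold pr; rw [← hp, ← hp, hw]
  have hinj : ∀ i j, i ≠ j → p i ≠ p j := by
    intro i j hij h
    have := hE i j
    rw [h] at this
    have h2 : CartanMatrix.E₈ (p j) (p j) = 2 := by rw [hE, ← pr_sr, pr_self]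
    rw [h2] at this
    exact eM_ne i j hij this
  obtain ⟨h0, h1, h2, h3, h4, h5, h6, h7⟩ := perm_id (p 0) (p 1) ((hE _ _).trans (by decide)) (hinj _ _ (by decide))
    (p 2) ((hE _ _).trans (by decide)) ((hE _ _).trans (by decide)) (hinj _ _ (by decide))
    (p 3) ((hE _ _).trans (by decide)) ((hE _ _).trans (by decide)) ((hE _ _).trans (by decide)) (hinj _ _ (by decide))
    (p 4) ((hE _ _).trans (by decide)) (hinj _ _ (by decide)) (hinj _ _ (by decide))
    (p 5) ((hE _ _).trans (by decide)) (hinj _ _ (by decide))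
    (p 6) ((hE _ _).trans (by decide)) (hinj _ _ (by decide))
    (p 7) ((hE _ _).trans (by decide)) (hinj _ _ (by decide))
  have hpi : ∀ i, p i = i := by intro i; fin_cases i <;> assumption
  intro u
  rw [dec w u]
  simp only [hp, hpi]
  have := dec (LinearEquiv.refl ℤ Lam) u
  simpa using this.symm

lemma chamber (w : Lam ≃ₗ[ℤ] Lam) (hw : IsI w) (x : Lam) (hr : ∀ a ∈ Phi, ip x a ≠ 0)
    (hx : w x = x) : ∀ u, w u = u := by
  obtain ⟨g, hg, hd⟩ := exists_dominant x
  have := chamber_dom ((g.symm.trans w).trans g) ((hg.symm.trans hw).trans hg) (g x)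
    (fun i => lt_of_le_of_ne (hd i) (fun h => hr (g.symm (sr i)) (hg.symm.mem (sr_mem_Phi i)) (by
      rw [← hg, g.apply_symm_apply, ip_comm]; exact h.symm))) (by simp [hx])
  intro u
  have := this (g u)
  simpa using this

end E8Proof

namespace E8Proof
set_option linter.unusedSectionVars false

/-- Chevalley-Serre generators of type E₈. -/
structure SData (F L : Type*) [Field F] [LieRing L] [LieAlgebra F L] where
  h : Fin 8 → L
  e : Fin 8 → L
  f : Fin 8 → L
  hh : ∀ i j, ⁅h i, h j⁆ = 0
  ef : ∀ i j, ⁅e i, f j⁆ = if i = j then h i else 0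
  he : ∀ i j, ⁅h i, e j⁆ = ((pr i (sr j) : ℤ) : F) • e j
  hf : ∀ i j, ⁅h i, f j⁆ = -(((pr i (sr j) : ℤ) : F) • f j)
  se : ∀ i j, ⁅e i, ⁅e i, e j⁆⁆ = 0
  sf : ∀ i j, ⁅f i, ⁅f i, f j⁆⁆ = 0
  gen : ∀ S : LieSubalgebra F L, (∀ i, e i ∈ S) → (∀ i, f i ∈ S) → ∀ x, x ∈ S

section Quot
variable (F : Type*) [Field F]

/-- the quotient map from the free Lie algebra -/
noncomputable def qmk : FreeLieAlgebra F (CartanMatrix.Generators (Fin 8)) →ₗ⁅F⁆ LieAlgebra.e₈ F where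
  toFun x := (LieSubmodule.Quotient.mk x : _ ⧸ CartanMatrix.Relations.toIdeal F CartanMatrix.E₈)
  map_add' x y := rfl
  map_smul' c x := rfl
  map_lie' := by
    intro x y
    exact LieSubmodule.Quotient.mk_bracket (I := CartanMatrix.Relations.toIdeal F CartanMatrix.E₈) x y

lemma qmk_surj : Function.Surjective (qmk F) :=
  LieSubmodule.Quotient.surjective_mk' (CartanMatrix.Relations.toIdeal F CartanMatrix.E₈)

lemma qmk_zero {x} (h : x ∈ CartanMatrix.Relations.toSet F CartanMatrix.E₈) : qmk F x = 0 :=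
  (LieSubmodule.Quotient.mk_eq_zero' (N := CartanMatrix.Relations.toIdeal F CartanMatrix.E₈)).2
    (LieSubmodule.subset_lieSpan h)

open CartanMatrix CartanMatrix.Relations in
/-- the standard generators of e₈ -/
noncomputable def stdData : SData F (LieAlgebra.e₈ F) where
  h i := qmk F (FreeLieAlgebra.of F (Generators.H i))
  e i := qmk F (FreeLieAlgebra.of F (Generators.E i))
  f i := qmk F (FreeLieAlgebra.of F (Generators.F i))
  hh i j := by
    rw [← LieHom.map_lie]
    apply qmk_zero
    exact Or.inl (Or.inl (Or.inl (Or.inl (Or.inl ⟨(i, j), rfl⟩))))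
  ef i j := by
    rw [← LieHom.map_lie]
    have : qmk F (EF F (i, j)) = 0 := by
      apply qmk_zero
      exact Or.inl (Or.inl (Or.inl (Or.inl (Or.inr ⟨(i, j), rfl⟩))))
    simp only [EF, Function.uncurry, Function.comp_apply] at this
    split_ifs at this ⊢ with hij
    · subst hij
      rw [map_sub, sub_eq_zero] at this
      exact this
    · exact this
  he i j := by
    rw [← LieHom.map_lie]
    have : qmk F (HE F CartanMatrix.E₈ (i, j)) = 0 := by
      apply qmk_zero
      exact Or.inl (Or.inl (Or.inl (Or.inr ⟨(i, j), rfl⟩)))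
    simp only [HE, Function.uncurry, Function.comp_apply] at this
    rw [map_sub, sub_eq_zero] at this
    rw [this, pr_sr, Int.cast_smul_eq_zsmul, map_zsmul]
  hf i j := by
    rw [← LieHom.map_lie]
    have : qmk F (HF F CartanMatrix.E₈ (i, j)) = 0 := by
      apply qmk_zero
      exact Or.inl (Or.inl (Or.inr ⟨(i, j), rfl⟩))
    simp only [HF, Function.uncurry, Function.comp_apply] at this
    rw [map_add] at this
    rw [eq_neg_of_add_eq_zero_left this, pr_sr, Int.cast_smul_eq_zsmul, map_zsmul]
  se i j := by
    have : qmk F (adE F CartanMatrix.E₈ (i, j)) = 0 := by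
      apply qmk_zero
      exact Or.inl (Or.inr ⟨(i, j), rfl⟩)
    simp only [adE, Function.uncurry, Function.comp_apply] at this
    rw [← LieHom.map_lie, ← LieHom.map_lie]
    have h01 : ∀ i j : Fin 8, (-CartanMatrix.E₈ i j).toNat = 0 ∨ (-CartanMatrix.E₈ i j).toNat = 1 :=
      by decide
    rcases h01 i j with h | h <;> rw [h] at this
    · rw [pow_zero, Module.End.one_apply] at this
      rw [LieHom.map_lie, this, lie_zero]
    · rw [pow_one] at this; exact this
  sf i j := by
    have : qmk F (adF F CartanMatrix.E₈ (i, j)) = 0 := by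
      apply qmk_zero
      exact Or.inr ⟨(i, j), rfl⟩
    simp only [adF, Function.uncurry, Function.comp_apply] at this
    rw [← LieHom.map_lie, ← LieHom.map_lie]
    have h01 : ∀ i j : Fin 8, (-CartanMatrix.E₈ i j).toNat = 0 ∨ (-CartanMatrix.E₈ i j).toNat = 1 :=
      by decide
    rcases h01 i j with h | h <;> rw [h] at this
    · rw [pow_zero, Module.End.one_apply] at this
      rw [LieHom.map_lie, this, lie_zero]
    · rw [pow_one] at this; exact this
  gen S he hf x := by
    obtain ⟨y, rfl⟩ := qmk_surj F x
    let g : CartanMatrix.Generators (Fin 8) → S := fun t => match t with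
      | .H i => ⁅(⟨_, he i⟩ : S), (⟨_, hf i⟩ : S)⁆
      | .E i => ⟨_, he i⟩
      | .F i => ⟨_, hf i⟩
    have key : S.incl.comp (FreeLieAlgebra.lift F g) = qmk F := by
      apply FreeLieAlgebra.hom_ext
      intro t
      rw [LieHom.comp_apply, FreeLieAlgebra.lift_of_apply]
      cases t with
      | H i =>
        have : qmk F (EF F (i, i)) = 0 := by
          apply qmk_zero
          exact Or.inl (Or.inl (Or.inl (Or.inl (Or.inr ⟨(i, i), rfl⟩))))
        simp only [EF, Function.uncurry, Function.comp_apply, if_true] at this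
        rw [map_sub, sub_eq_zero, LieHom.map_lie] at this
        exact this
      | E i => rfl
      | F i => rfl
    rw [← key]
    exact (FreeLieAlgebra.lift F g y).2

end Quot

variable {F L : Type*} [Field F] [CharZero F] [LieRing L] [LieAlgebra F L]

namespace SData

def swap (S : SData F L) : SData F L where
  h i := - S.h i
  e := S.f
  f := S.e
  hh i j := by simp [S.hh]
  ef i j := by
    rw [← lie_skew, S.ef]
    by_cases h : i = j
    · subst h; simp
    · simp [h, Ne.symm h]
  he i j := by rw [neg_lie, S.hf, neg_neg]
  hf i j := by rw [neg_lie, S.he]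
  se := S.sf
  sf := S.se
  gen T h1 h2 := S.gen T h2 h1

variable (S : SData F L)

/-- weight spaces -/
def W (u : Lam) : Submodule F L where
  carrier := {x | ∀ i, ⁅S.h i, x⁆ = ((pr i u : ℤ) : F) • x}
  add_mem' ha hb i := by rw [lie_add, ha i, hb i, smul_add]
  zero_mem' i := by simp
  smul_mem' c x hx i := by rw [lie_smul, hx i, smul_comm]

variable {S}
lemma mem_W {u : Lam} {x : L} : x ∈ S.W u ↔ ∀ i, ⁅S.h i, x⁆ = ((pr i u : ℤ) : F) • x := Iff.rfl

lemma swap_W (u : Lam) : S.swap.W u = S.W (-u) := by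
  ext x
  simp only [mem_W, swap, neg_lie, pr_neg, Int.cast_neg, neg_smul, neg_eq_iff_eq_neg]

lemma lie_mem_W {u v : Lam} {x y : L} (hx : x ∈ S.W u) (hy : y ∈ S.W v) : ⁅x, y⁆ ∈ S.W (u + v) := by
  intro i
  rw [leibniz_lie, hx i, hy i, smul_lie, lie_smul, ← add_smul, pr_add, Int.cast_add]

lemma e_mem (i : Fin 8) : S.e i ∈ S.W (sr i) := fun j => S.he j i
lemma f_mem (i : Fin 8) : S.f i ∈ S.W (-sr i) := fun j => by
  rw [S.hf, pr_neg, Int.cast_neg, neg_smul]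
lemma h_mem (i : Fin 8) : S.h i ∈ S.W 0 := fun j => by rw [S.hh, pr_zero]; simp

lemma W_indep : iSupIndep S.W := by
  have hc := Module.End.independent_iInf_maxGenEigenspace_of_forall_mapsTo
    (f := fun i : Fin 8 => LieAlgebra.ad F L (S.h i)) (by
      intro i j φ
      apply Module.End.mapsTo_maxGenEigenspace_of_comm
      ext x
      simp only [Module.End.mul_apply, LieAlgebra.ad_apply]
      rw [leibniz_lie, S.hh, zero_lie, zero_add])
  have hinj : Function.Injective (fun u : Lam => fun i : Fin 8 => ((pr i u : ℤ) : F)) := by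
    intro u v huv
    exact pr_injective fun i => Int.cast_injective (α := F) (congrFun huv i)
  refine (hc.comp hinj).mono fun u x hx => ?_
  simp only [Function.comp_apply, Submodule.mem_iInf]
  intro i
  apply Module.End.mem_maxGenEigenspace _ _ _ |>.2
  refine ⟨1, ?_⟩
  rw [pow_one, LinearMap.sub_apply, LieAlgebra.ad_apply, hx i]
  simp

lemma top_of_stable (T : Submodule F L) (he : ∀ i, S.e i ∈ T) (hf : ∀ i, S.f i ∈ T)
    (se : ∀ i, ∀ x ∈ T, ⁅S.e i, x⁆ ∈ T) (sf : ∀ i, ∀ x ∈ T, ⁅S.f i, x⁆ ∈ T) : T = ⊤ := by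
  let N : LieSubalgebra F L :=
    { carrier := {x | ∀ y ∈ T, ⁅x, y⁆ ∈ T}
      add_mem' := fun ha hb y hy => by rw [add_lie]; exact T.add_mem (ha y hy) (hb y hy)
      zero_mem' := fun y _ => by rw [zero_lie]; exact T.zero_mem
      smul_mem' := fun c x hx y hy => by rw [smul_lie]; exact T.smul_mem _ (hx y hy)
      lie_mem' := fun {a b} ha hb y hy => by
        rw [lie_lie]; exact T.sub_mem (ha _ (hb _ hy)) (hb _ (ha _ hy)) }
  have hN : ∀ x, x ∈ N := S.gen N se sf
  let T' : LieSubalgebra F L := { T with lie_mem' := fun {a b} _ hb => hN a b hb }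
  have := S.gen T' he hf
  exact eq_top_iff.2 fun x _ => this x

variable (S) in
inductive Mono : Lam → L → Prop
  | base (i : Fin 8) : Mono (sr i) (S.e i)
  | step (i : Fin 8) (u : Lam) (x : L) : Mono u x → Mono (sr i + u) ⁅S.e i, x⁆

lemma Mono.mem {u : Lam} {x : L} (h : S.Mono u x) : x ∈ S.W u := by
  induction h with
  | base i => exact e_mem i
  | step i u x _ ih => exact lie_mem_W (e_mem i) ih

lemma Mono.nonneg {u : Lam} {x : L} (h : S.Mono u x) : (∀ i, 0 ≤ u i) ∧ 1 ≤ ht u := by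
  have hs : ∀ i j, 0 ≤ sr i j := fun i j => by
    simp only [sr, Pi.single_apply]; split_ifs <;> simp
  induction h with
  | base i => exact ⟨hs i, by rw [ht_sr]⟩
  | step i u x _ ih =>
    refine ⟨fun j => add_nonneg (hs i j) (ih.1 j), ?_⟩
    rw [ht_add, ht_sr]; omega

variable (S) in
/-- spanning elements of given weight -/
def Sp (u : Lam) : Set L := {x | (u = 0 ∧ ∃ i, x = S.h i) ∨ S.Mono u x ∨ S.swap.Mono (-u) x}

lemma Sp_le (u : Lam) : Submodule.span F (S.Sp u) ≤ S.W u := by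
  rw [Submodule.span_le]
  rintro x (⟨rfl, i, rfl⟩ | h | h)
  · exact h_mem i
  · exact h.mem
  · have := h.mem
    rwa [swap_W, neg_neg] at this

variable (S) in
def Pspan : Submodule F L := Submodule.span F {x | ∃ u, S.Mono u x}
variable (S) in
def Hspan : Submodule F L := Submodule.span F (Set.range S.h)

lemma P_e (i : Fin 8) (x : L) (hx : x ∈ S.Pspan) : ⁅S.e i, x⁆ ∈ S.Pspan := by
  unfold Pspan at hx ⊢
  induction hx using Submodule.span_induction with
  | mem x h => obtain ⟨u, hu⟩ := h; exact Submodule.subset_span ⟨_, hu.step i⟩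
  | zero => simp
  | add x y _ _ h1 h2 => rw [lie_add]; exact Submodule.add_mem _ h1 h2
  | smul c x _ h => rw [lie_smul]; exact Submodule.smul_mem _ _ h

lemma P_f (i : Fin 8) (x : L) (hx : x ∈ S.Pspan) : ⁅S.f i, x⁆ ∈ S.Pspan ⊔ S.Hspan := by
  have base : ∀ i u x, S.Mono u x → ⁅S.f i, x⁆ ∈ S.Pspan ⊔ S.Hspan := by
    intro i u x hx
    induction hx with
    | base j =>
      rw [← lie_skew, S.ef]
      apply Submodule.neg_mem
      split_ifs with h
      · exact Submodule.mem_sup_right (Submodule.subset_span ⟨_, rfl⟩)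
      · exact Submodule.zero_mem _
    | step j u x hx ih =>
      rw [leibniz_lie]
      apply Submodule.add_mem
      · apply Submodule.mem_sup_left
        rw [← lie_skew (S.f i) (S.e j), S.ef, neg_lie]
        apply Submodule.neg_mem
        split_ifs with h
        · rw [hx.mem j]
          exact Submodule.smul_mem _ _ (Submodule.subset_span ⟨_, hx⟩)
        · simp
      · obtain ⟨p, hp, q, hq, hpq⟩ := Submodule.mem_sup.1 ih
        rw [← hpq, lie_add]
        apply Submodule.mem_sup_left
        apply Submodule.add_mem _ (P_e j p hp)
        unfold Hspan at hq
        clear hpq ih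
        induction hq using Submodule.span_induction with
        | mem y h =>
          obtain ⟨k, rfl⟩ := h
          rw [← lie_skew, S.he]
          exact Submodule.neg_mem _ (Submodule.smul_mem _ _ (Submodule.subset_span ⟨_, Mono.base j⟩))
        | zero => simp
        | add x y _ _ h1 h2 => rw [lie_add]; exact Submodule.add_mem _ h1 h2
        | smul c x _ h => rw [lie_smul]; exact Submodule.smul_mem _ _ h
  unfold Pspan at hx
  induction hx using Submodule.span_induction with
  | mem x h => obtain ⟨u, hu⟩ := h; exact base i u x hu
  | zero => simp
  | add x y _ _ h1 h2 => rw [lie_add]; exact Submodule.add_mem _ h1 h2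
  | smul c x _ h => rw [lie_smul]; exact Submodule.smul_mem _ _ h

lemma H_swap : S.swap.Hspan = S.Hspan := by
  unfold Hspan
  apply le_antisymm <;> rw [Submodule.span_le] <;> rintro _ ⟨i, rfl⟩
  · exact Submodule.neg_mem _ (Submodule.subset_span ⟨i, rfl⟩)
  · have : S.h i = -S.swap.h i := by simp [swap]
    rw [this]
    exact Submodule.neg_mem _ (Submodule.subset_span ⟨i, rfl⟩)

lemma H_e (i : Fin 8) (x : L) (hx : x ∈ S.Hspan) : ⁅S.e i, x⁆ ∈ S.Pspan := by
  unfold Hspan at hx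
  induction hx using Submodule.span_induction with
  | mem y h =>
    obtain ⟨k, rfl⟩ := h
    rw [← lie_skew, S.he]
    exact Submodule.neg_mem _ (Submodule.smul_mem _ _ (Submodule.subset_span ⟨_, Mono.base i⟩))
  | zero => simp
  | add x y _ _ h1 h2 => rw [lie_add]; exact Submodule.add_mem _ h1 h2
  | smul c x _ h => rw [lie_smul]; exact Submodule.smul_mem _ _ h

lemma PHN_top : S.Pspan ⊔ S.Hspan ⊔ S.swap.Pspan = ⊤ := by
  have key : ∀ S : SData F L, ∀ i, ∀ x ∈ S.Pspan ⊔ S.Hspan ⊔ S.swap.Pspan,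
      ⁅S.e i, x⁆ ∈ S.Pspan ⊔ S.Hspan ⊔ S.swap.Pspan := by
    intro S i x hx
    obtain ⟨y, hy, r, hr, rfl⟩ := Submodule.mem_sup.1 hx
    obtain ⟨p, hp, q, hq, rfl⟩ := Submodule.mem_sup.1 hy
    rw [lie_add, lie_add]
    refine Submodule.add_mem _ (Submodule.add_mem _ ?_ ?_) ?_
    · exact Submodule.mem_sup_left (Submodule.mem_sup_left (P_e i p hp))
    · exact Submodule.mem_sup_left (Submodule.mem_sup_left (H_e i q hq))
    · have := P_f (S := S.swap) i r hr
      rw [H_swap] at this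
      have h2 : S.swap.Pspan ⊔ S.Hspan ≤ S.Pspan ⊔ S.Hspan ⊔ S.swap.Pspan :=
        sup_le le_sup_right (le_sup_of_le_left le_sup_right)
      exact h2 this
  have e : ∀ S : SData F L, S.swap.Pspan ⊔ S.swap.Hspan ⊔ S.swap.swap.Pspan =
      S.Pspan ⊔ S.Hspan ⊔ S.swap.Pspan := by
    intro S
    rw [H_swap]
    have : S.swap.swap = S := by
      cases S; simp [swap]
    rw [this, sup_assoc, sup_comm, sup_comm S.Hspan]
  apply top_of_stable (S := S)
  · intro i
    exact Submodule.mem_sup_left (Submodule.mem_sup_left (Submodule.subset_span ⟨_, Mono.base i⟩))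
  · intro i
    exact Submodule.mem_sup_right (Submodule.subset_span ⟨_, Mono.base (S := S.swap) i⟩)
  · exact key S
  · rw [← e]; exact key S.swap

lemma Sp_top : ⨆ u, Submodule.span F (S.Sp u) = ⊤ := by
  rw [eq_top_iff, ← PHN_top (S := S)]
  refine sup_le (sup_le ?_ ?_) ?_ <;> refine Submodule.span_le.2 ?_
  · rintro x ⟨u, h⟩
    exact Submodule.mem_iSup_of_mem u (Submodule.subset_span (Or.inr (Or.inl h)))
  · rintro x ⟨i, rfl⟩
    exact Submodule.mem_iSup_of_mem 0 (Submodule.subset_span (Or.inl ⟨rfl, i, rfl⟩))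
  · rintro x ⟨u, h⟩
    exact Submodule.mem_iSup_of_mem (-u) (Submodule.subset_span (Or.inr (Or.inr (by rwa [neg_neg]))))

lemma W_eq (u : Lam) : S.W u = Submodule.span F (S.Sp u) := by
  apply le_antisymm _ (Sp_le u)
  intro x hx
  have hx' : x ∈ ⨆ u, Submodule.span F (S.Sp u) := by rw [Sp_top]; trivial
  have e : ⨆ u, Submodule.span F (S.Sp u) =
      Submodule.span F (S.Sp u) ⊔ ⨆ (v) (_ : v ≠ u), Submodule.span F (S.Sp v) := by
    exact iSup_split_single _ _
  rw [e] at hx'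
  obtain ⟨y, hy, z, hz, rfl⟩ := Submodule.mem_sup.1 hx'
  have hz1 : z ∈ S.W u := by
    have := Submodule.sub_mem _ hx (Sp_le u hy)
    simpa using this
  have hz2 : z ∈ ⨆ (v) (_ : v ≠ u), S.W v :=
    (iSup₂_mono fun v _ => Sp_le v) hz
  have := (Submodule.disjoint_def.1 (W_indep (S := S) u)) z hz1 hz2
  rw [this, add_zero]; exact hy

lemma W_top : ⨆ u, S.W u = ⊤ := by
  rw [← Sp_top (S := S)]; exact iSup_congr fun u => W_eq u

end SData
end E8Proof

namespace E8Proof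
set_option linter.unusedSectionVars false
variable {F L : Type*} [Field F] [CharZero F] [LieRing L] [LieAlgebra F L]

namespace SData
variable {S : SData F L}

lemma W_zero : S.W 0 = S.Hspan := by
  rw [W_eq]
  apply le_antisymm
  · rw [Submodule.span_le]
    rintro x (⟨-, i, rfl⟩ | h | h)
    · exact Submodule.subset_span ⟨i, rfl⟩
    · have := h.nonneg.2; simp [ht] at this
    · have := h.nonneg.2; simp [ht] at this
  · rw [Hspan, Submodule.span_le]
    rintro _ ⟨i, rfl⟩
    exact Submodule.subset_span (Or.inl ⟨rfl, i, rfl⟩)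

lemma Mono.multiple {u : Lam} {x : L} (h : S.Mono u x) (i : Fin 8) (hu : ∀ j, j ≠ i → u j = 0) :
    (∃ c : F, x = c • S.e i) ∧ (2 ≤ u i → x = 0) := by
  induction h with
  | base k =>
    have hk : k = i := by
      by_contra hk
      have := hu k hk
      simp [sr] at this
    subst hk
    exact ⟨⟨1, by simp⟩, fun h => by simp [sr] at h⟩
  | step k u x hx ih =>
    have hn := hx.nonneg.1
    have hk : k = i := by
      by_contra hk
      have := hu k hk
      have h2 := hn k
      simp [sr] at this; omega
    subst hk
    obtain ⟨⟨c, rfl⟩, -⟩ := ih (fun j hj => by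
      have := hu j hj
      simpa [sr, hj] using this)
    rw [lie_smul, lie_self, smul_zero]
    exact ⟨⟨0, by simp⟩, fun _ => rfl⟩

lemma W_simple (i : Fin 8) : S.W (sr i) = Submodule.span F {S.e i} := by
  apply le_antisymm
  · rw [W_eq, Submodule.span_le]
    rintro x (⟨h, -⟩ | h | h)
    · exact (sr_ne_zero i h).elim
    · obtain ⟨⟨c, rfl⟩, -⟩ := h.multiple i (fun j hj => by simp [sr, hj])
      exact Submodule.smul_mem _ _ (Submodule.mem_span_singleton_self _)
    · have := h.nonneg.1 i
      simp [sr] at this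
  · rw [Submodule.span_singleton_le_iff_mem]
    exact e_mem i

lemma W_multiple (u : Lam) (i : Fin 8) (hu : ∀ j, j ≠ i → u j = 0) (h2 : 2 ≤ u i) : S.W u = ⊥ := by
  rw [eq_bot_iff, W_eq, Submodule.span_le]
  rintro x (⟨h, -⟩ | h | h)
  · subst h; simp at h2
  · exact (h.multiple i hu).2 h2
  · have := h.nonneg.1 i
    simp only [Pi.neg_apply] at this
    omega

lemma W_mixed (u : Lam) (h1 : ¬ ∀ i, 0 ≤ u i) (h2 : ¬ ∀ i, 0 ≤ (-u) i) : S.W u = ⊥ := by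
  rw [eq_bot_iff, W_eq, Submodule.span_le]
  rintro x (⟨h, -⟩ | h | h)
  · subst h; simp at h1
  · exact (h1 h.nonneg.1).elim
  · exact (h2 h.nonneg.1).elim

lemma transfer {V W : Submodule F L} (hW : Module.Finite F W) (g : V →ₗ[F] W)
    (hg : Function.Injective g) (g' : W →ₗ[F] V) (hg' : Function.Injective g') :
    Module.Finite F V ∧ Module.finrank F V = Module.finrank F W := by
  have hV : Module.Finite F V := Module.Finite.of_injective g hg
  exact ⟨hV, le_antisymm (LinearMap.finrank_le_finrank_of_injective hg)
    (LinearMap.finrank_le_finrank_of_injective hg')⟩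

lemma e_nilp (i : Fin 8) (x : L) : ∃ n, ((LieAlgebra.ad F L (S.e i)) ^ n) x = 0 := by
  have := S.gen (LieSubalgebra.engel F (S.e i)) (fun j => by
      rw [LieSubalgebra.mem_engel_iff]
      exact ⟨2, by rw [pow_two]; exact S.se i j⟩) (fun j => by
      rw [LieSubalgebra.mem_engel_iff]
      refine ⟨3, ?_⟩
      rw [pow_succ, pow_two, Module.End.mul_apply, Module.End.mul_apply]
      simp only [LieAlgebra.ad_apply]
      rw [S.ef]
      split_ifs with h
      · rw [← lie_skew (S.e i) (S.h i), S.he, lie_neg, lie_smul, lie_self]; simp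
      · simp) x
  rwa [LieSubalgebra.mem_engel_iff] at this

lemma sl2_comm (i : Fin 8) (u : Lam) (v : L) (hv : v ∈ S.W u) (j : ℕ) :
    ⁅S.e i, ((LieAlgebra.ad F L (S.f i)) ^ (j + 1)) v⁆ =
      ((LieAlgebra.ad F L (S.f i)) ^ (j + 1)) ⁅S.e i, v⁆ +
      (((j + 1) * (pr i u - j) : ℤ) : F) • ((LieAlgebra.ad F L (S.f i)) ^ j) v := by
  have hw : ∀ j : ℕ, ((LieAlgebra.ad F L (S.f i)) ^ j) v ∈ S.W (u - (j : ℤ) • sr i) := by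
    intro j
    induction j with
    | zero => simpa using hv
    | succ j ih =>
      rw [pow_succ', Module.End.mul_apply, LieAlgebra.ad_apply]
      have := lie_mem_W (f_mem i) ih
      convert this using 1
      push_cast
      rw [add_smul, one_smul]; abel_nf
  have hp : ∀ j : ℕ, ⁅S.h i, ((LieAlgebra.ad F L (S.f i)) ^ j) v⁆ =
      ((pr i u - 2 * j : ℤ) : F) • ((LieAlgebra.ad F L (S.f i)) ^ j) v := by
    intro j
    rw [hw j i, pr_sub, pr_smul, pr_self, mul_comm]
  induction j with
  | zero =>
    simp only [zero_add, pow_one, LieAlgebra.ad_apply, pow_zero, Module.End.one_apply]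
    rw [leibniz_lie, S.ef, if_pos rfl, hv i, add_comm]
    simp
  | succ j ih =>
    have e1 : ∀ (k : ℕ) (y : L), ((LieAlgebra.ad F L (S.f i)) ^ (k+1)) y =
        ⁅S.f i, ((LieAlgebra.ad F L (S.f i)) ^ k) y⁆ := by
      intro k y; rw [pow_succ', Module.End.mul_apply, LieAlgebra.ad_apply]
    rw [e1 (j+1) v, leibniz_lie, S.ef, if_pos rfl, ih, hp, lie_add, lie_smul, ← e1 (j+1), ← e1 j v,
      add_left_comm, ← add_smul]
    congr 2
    push_cast
    ring

lemma sl2_zero (i : Fin 8) (k : ℕ) : ∀ (u : Lam) (m : ℕ) (v : L), v ∈ S.W u → pr i u = m →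
    ((LieAlgebra.ad F L (S.e i)) ^ k) v = 0 → ((LieAlgebra.ad F L (S.f i)) ^ m) v = 0 → v = 0 := by
  induction k with
  | zero => intro u m v _ _ h _; simpa using h
  | succ k ih =>
    intro u m v hv hm hk hf
    have hw : ⁅S.e i, v⁆ = 0 := by
      apply ih (sr i + u) (m + 2) _ (lie_mem_W (e_mem i) hv) (by rw [pr_add, pr_self, hm]; push_cast; ring)
      · rw [pow_succ, Module.End.mul_apply] at hk; exact hk
      · have := sl2_comm i u v hv (m + 1)
        have h0 : ((LieAlgebra.ad F L (S.f i)) ^ (m+1)) v = 0 := by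
          rw [pow_succ', Module.End.mul_apply, hf, map_zero]
        have h1 : ((LieAlgebra.ad F L (S.f i)) ^ (m+1+1)) v = 0 := by
          rw [pow_succ', Module.End.mul_apply, h0, map_zero]
        rw [h0, h1, lie_zero, smul_zero, add_zero] at this
        exact this.symm
    have desc : ∀ j : ℕ, j ≤ m → ((LieAlgebra.ad F L (S.f i)) ^ (m - j)) v = 0 := by
      intro j
      induction j with
      | zero => intro _; simpa using hf
      | succ j ihj =>
        intro hj
        have h1 := ihj (by omega)
        obtain ⟨r, hr⟩ : ∃ r, m - j = r + 1 := ⟨m - j - 1, by omega⟩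
        have h2 := sl2_comm i u v hv r
        rw [hr] at h1
        rw [h1, hw, lie_zero, map_zero, zero_add, eq_comm, smul_eq_zero] at h2
        rcases h2 with h2 | h2
        · exfalso
          have h3 : ((r:ℤ) + 1) * (pr i u - r) = 0 := by exact_mod_cast h2
          rw [hm] at h3
          rcases mul_eq_zero.1 h3 with h3 | h3 <;> omega
        · rwa [show m - (j + 1) = r by omega]
    simpa using desc m le_rfl

/-- reflection maps -/
lemma refl_map (i : Fin 8) (u : Lam) (m : ℕ) (hm : pr i u = m) :
    ∃ g : S.W u →ₗ[F] S.W (u - (m : ℤ) • sr i), Function.Injective g ∧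
      ∀ x, (g x : L) = ((LieAlgebra.ad F L (S.f i)) ^ m) x := by
  have hw : ∀ j : ℕ, ∀ v ∈ S.W u, ((LieAlgebra.ad F L (S.f i)) ^ j) v ∈ S.W (u - (j : ℤ) • sr i) := by
    intro j v hv
    induction j with
    | zero => simpa using hv
    | succ j ih =>
      rw [pow_succ', Module.End.mul_apply, LieAlgebra.ad_apply]
      have := lie_mem_W (f_mem i) ih
      convert this using 1
      push_cast
      rw [add_smul, one_smul]; abel_nf
  refine ⟨((LieAlgebra.ad F L (S.f i)) ^ m).restrict (hw m), ?_, fun x => rfl⟩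
  rw [← LinearMap.ker_eq_bot, LinearMap.ker_eq_bot']
  rintro ⟨v, hv⟩ h
  obtain ⟨k, hk⟩ := e_nilp (S := S) i v
  have := sl2_zero (S := S) i k u m v hv hm hk (congrArg Subtype.val h)
  exact Subtype.ext this

lemma swap_swap : S.swap.swap = S := by cases S; simp [swap]

lemma refl_map' (i : Fin 8) (u : Lam) (m : ℕ) (hm : pr i u = -m) :
    ∃ g : S.W u →ₗ[F] S.W (u + (m : ℤ) • sr i), Function.Injective g ∧
      ∀ x, (g x : L) = ((LieAlgebra.ad F L (S.e i)) ^ m) x := by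
  have h := refl_map (S := S.swap) i (-u) m (by rw [pr_neg, hm, neg_neg])
  rw [swap_W, swap_W, neg_neg, neg_sub, sub_neg_eq_add, add_comm] at h
  exact h

lemma e_ne_zero [Nontrivial L] (i : Fin 8) : S.e i ≠ 0 := by
  intro h0
  have step : ∀ i j : Fin 8, eM i j ≠ 0 → S.e i = 0 → S.e j = 0 := by
    intro i j hij h
    have h1 : S.h i = 0 := by
      have := S.ef i i
      rw [h, zero_lie, if_pos rfl] at this
      exact this.symm
    have h2 := S.he i j
    rw [h1, zero_lie, eq_comm, smul_eq_zero] at h2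
    rcases h2 with h2 | h2
    · exfalso
      apply hij
      have h3 : pr i (sr j) = 0 := by exact_mod_cast h2
      rwa [pr_sr] at h3
    · exact h2
  have l02 := step 0 2 (by decide)
  have l20 := step 2 0 (by decide)
  have l13 := step 1 3 (by decide)
  have l31 := step 3 1 (by decide)
  have l23 := step 2 3 (by decide)
  have l32 := step 3 2 (by decide)
  have l34 := step 3 4 (by decide)
  have l43 := step 4 3 (by decide)
  have l45 := step 4 5 (by decide)
  have l54 := step 5 4 (by decide)
  have l56 := step 5 6 (by decide)
  have l65 := step 6 5 (by decide)
  have l67 := step 6 7 (by decide)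
  have l76 := step 7 6 (by decide)
  have h3 : S.e 3 = 0 := by
    fin_cases i
    · exact l23 (l02 h0)
    · exact l13 h0
    · exact l23 h0
    · exact h0
    · exact l43 h0
    · exact l43 (l54 h0)
    · exact l43 (l54 (l65 h0))
    · exact l43 (l54 (l65 (l76 h0)))
  have all : ∀ j, S.e j = 0 := by
    intro j
    fin_cases j
    · exact l20 (l32 h3)
    · exact l31 h3
    · exact l32 h3
    · exact h3
    · exact l34 h3
    · exact l45 (l34 h3)
    · exact l56 (l45 (l34 h3))
    · exact l67 (l56 (l45 (l34 h3)))
  have allf : ∀ j, S.f j = 0 := by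
    intro j
    have h1 : S.h j = 0 := by
      have := S.ef j j
      rw [all, zero_lie, if_pos rfl] at this
      exact this.symm
    have h2 := S.hf j j
    rw [h1, zero_lie, pr_self, eq_comm, neg_eq_zero, smul_eq_zero] at h2
    simpa using h2
  obtain ⟨x, hx⟩ := exists_ne (0 : L)
  have := S.gen ⊥ (fun i => by simp [all]) (fun i => by simp [allf]) x
  exact hx (by simpa using this)

/-- dimension of weight spaces for nonneg weights -/
lemma dim_pos [Nontrivial L] (N : ℕ) : ∀ u : Lam, ht u ≤ N → (∀ i, 0 ≤ u i) → u ≠ 0 →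
    Module.Finite F (S.W u) ∧ Module.finrank F (S.W u) = if ip u u = 2 then 1 else 0 := by
  have bot : ∀ u, S.W u = ⊥ → ip u u ≠ 2 →
      Module.Finite F (S.W u) ∧ Module.finrank F (S.W u) = if ip u u = 2 then 1 else 0 := by
    intro u h h2
    rw [h, if_neg h2]
    exact ⟨inferInstance, finrank_bot F L⟩
  induction N with
  | zero =>
    intro u hu h0 hne
    exfalso
    apply hne
    funext j
    exact (Finset.sum_eq_zero_iff_of_nonneg (fun i _ => h0 i)).1 (le_antisymm hu (ht_nonneg h0)) j
      (Finset.mem_univ j)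
  | succ N ih =>
    intro u hu h0 hne
    obtain ⟨i, hi, hp⟩ := exists_pr_pos (ip_pos hne) h0
    obtain ⟨m, hm⟩ := Int.eq_ofNat_of_zero_le hp.le
    set u' := u - (m : ℤ) • sr i with hu'
    have hpu' : pr i u' = -m := by rw [hu', pr_sub, pr_smul, pr_self, hm]; ring
    have hip : ip u' u' = ip u u := by
      have hm' : ip (sr i) u = m := hm
      rw [hu']
      simp only [ip_sub_left, ip_sub_right, ip_smul_left, ip_smul_right, ip_sr, ip_comm u (sr i), hm']
      ring
    have hu'j : ∀ j, j ≠ i → u' j = u j := by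
      intro j hj; simp [hu', sr, hj]
    by_cases hnn : ∀ j, 0 ≤ u' j
    · have hne' : u' ≠ 0 := by
        intro h
        rw [h, ip_zero_left] at hip
        exact hne (eq_zero_of_ip u hip.symm)
      obtain ⟨hf, hd⟩ := ih u' (by
        rw [hu', ht_sub, ht_smul, ht_sr]; push_cast at hu; omega) hnn hne'
      obtain ⟨g, hg, -⟩ := refl_map (S := S) i u m hm
      have r := refl_map' (S := S) i u' m hpu'
      rw [show u' + (m : ℤ) • sr i = u by simp [hu']] at r
      obtain ⟨g', hg', -⟩ := r
      rw [← hip, ← hd]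
      exact transfer hf g hg g' hg'
    · by_cases hsingle : ∀ j, j ≠ i → u j = 0
      · have hui : 1 ≤ u i := hi
        rcases hui.lt_or_eq with h2 | h1
        · apply bot u (W_multiple u i hsingle h2)
          have : u = (u i) • sr i := by
            funext j
            by_cases hj : j = i
            · subst hj; simp [sr]
            · simp [sr, hj, hsingle j hj]
          rw [this, ip_smul_left, ip_smul_right, ip_sr]
          nlinarith
        · have : u = sr i := by
            funext j
            by_cases hj : j = i
            · subst hj; simp [sr, ← h1]
            · simp [sr, hj, hsingle j hj]
          rw [this, W_simple, ip_sr, if_pos rfl]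
          exact ⟨inferInstance, finrank_span_singleton (e_ne_zero i)⟩
      · push Not at hsingle hnn
        obtain ⟨j, hj, hj0⟩ := hsingle
        obtain ⟨k, hk⟩ := hnn
        have n1 : ¬ ∀ i, 0 ≤ u' i := fun h => absurd (h k) (by omega)
        have n2 : ¬ ∀ i, 0 ≤ (-u') i := fun h => by
          have h3 := h j
          simp only [Pi.neg_apply] at h3
          rw [hu'j j hj] at h3
          have := h0 j
          omega
        apply bot u
        · have hb := W_mixed (S := S) u' n1 n2
          obtain ⟨g, hg, -⟩ := refl_map (S := S) i u m hm
          rw [eq_bot_iff]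
          intro x hx
          have h1 : ((g ⟨x, hx⟩ : S.W (u - (m : ℤ) • sr i)) : L) ∈ S.W u' := (g ⟨x, hx⟩).2
          replace h1 := hb.le h1
          rw [Submodule.mem_bot] at h1
          have h2 : g ⟨x, hx⟩ = g 0 := by rw [map_zero]; exact Subtype.ext h1
          have h3 := congrArg Subtype.val (hg h2)
          simpa using h3
        · rw [← hip]
          intro h2
          rcases root_sign h2 with h | h
          · exact n1 h
          · exact n2 h

lemma dim_W [Nontrivial L] (u : Lam) (hu : u ≠ 0) :
    Module.Finite F (S.W u) ∧ Module.finrank F (S.W u) = if u ∈ Phi then 1 else 0 := by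
  simp only [mem_Phi]
  by_cases h1 : ∀ i, 0 ≤ u i
  · exact dim_pos (ht u).toNat u (by omega) h1 hu
  by_cases h2 : ∀ i, 0 ≤ (-u) i
  · have := dim_pos (S := S.swap) (ht (-u)).toNat (-u) (by omega) h2 (by simpa using hu)
    rw [swap_W, neg_neg, ip_neg_left, ip_neg_right, neg_neg] at this
    exact this
  · rw [W_mixed u h1 h2, if_neg (fun h => by
      rcases root_sign h with h | h
      · exact h1 h
      · exact h2 h)]
    exact ⟨inferInstance, finrank_bot F L⟩

lemma W_bot [Nontrivial L] (u : Lam) (hu : u ≠ 0) (h : u ∉ Phi) : S.W u = ⊥ := by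
  obtain ⟨h1, h2⟩ := dim_W (S := S) u hu
  rw [if_neg h] at h2
  exact Submodule.finrank_eq_zero.1 h2

lemma dim_root [Nontrivial L] (u : Lam) (h : u ∈ Phi) : Module.finrank F (S.W u) = 1 := by
  obtain ⟨h1, h2⟩ := dim_W (S := S) u (fun h0 => zero_not_mem_Phi (h0 ▸ h))
  rwa [if_pos h] at h2

variable (S) in
/-- coroot combination with coefficients in the field -/
noncomputable def tc : (Fin 8 → F) →ₗ[F] L := Fintype.linearCombination F S.h

variable (S) in
noncomputable def t (u : Lam) : L := S.tc (fun i => (u i : F))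

lemma tc_apply (c : Fin 8 → F) : S.tc c = ∑ i, c i • S.h i := by
  simp [tc, Fintype.linearCombination_apply]

lemma tc_lie {u : Lam} {x : L} (hx : x ∈ S.W u) (c : Fin 8 → F) :
    ⁅S.tc c, x⁆ = (∑ i, c i * ((pr i u : ℤ) : F)) • x := by
  rw [tc_apply, sum_lie, Finset.sum_smul]
  exact Finset.sum_congr rfl fun i _ => by rw [smul_lie, hx i, smul_smul]

lemma t_lie {u v : Lam} {x : L} (hx : x ∈ S.W u) : ⁅S.t v, x⁆ = ((ip v u : ℤ) : F) • x := by
  rw [t, tc_lie hx, ip_eq_sum]; push_cast; rfl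

lemma pr_cast_inj (c : Fin 8 → F) (h : ∀ j, ∑ i, c i * ((pr i (sr j) : ℤ) : F) = 0) : c = 0 := by
  have key : ∀ v : Lam, ∑ i, c i * ((pr i v : ℤ) : F) = 0 := by
    intro v
    have : ∀ i, pr i v = ∑ j, v j * pr i (sr j) := by
      intro i; rw [pr_eq_sum]; exact Finset.sum_congr rfl fun j _ => by rw [pr_sr, mul_comm]
    simp only [this]
    push_cast
    simp only [Finset.mul_sum]
    rw [Finset.sum_comm]
    apply Finset.sum_eq_zero
    intro j _
    have := congrArg (fun z => (v j : F) * z) (h j)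
    simp only [Finset.mul_sum, mul_zero] at this
    rw [← this]
    exact Finset.sum_congr rfl fun i _ => by ring
  funext k
  have := key (ofPr (Pi.single k 1))
  simpa [pr_ofPr, Pi.single_apply] using this

lemma tc_inj [Nontrivial L] : Function.Injective S.tc := by
  rw [← LinearMap.ker_eq_bot, LinearMap.ker_eq_bot']
  intro c hc
  apply pr_cast_inj
  intro j
  have := tc_lie (e_mem (S := S) j) c
  rw [hc, zero_lie, eq_comm, smul_eq_zero] at this
  exact this.resolve_right (e_ne_zero j)

lemma tc_range : LinearMap.range S.tc = S.W 0 := by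
  rw [W_zero, tc, Fintype.range_linearCombination, Hspan]

lemma dim_zero [Nontrivial L] : Module.finrank F (S.W 0) = 8 := by
  rw [← tc_range, LinearMap.finrank_range_of_inj tc_inj]; simp

lemma fin_W [Nontrivial L] (u : Lam) : Module.Finite F (S.W u) := by
  by_cases h : u = 0
  · subst h; exact Module.finite_of_finrank_pos (by rw [dim_zero]; norm_num)
  · exact (dim_W u h).1

/-- index set of nonzero weights -/
def Phi0 : Finset Lam := insert 0 Phi

lemma isInternal [Nontrivial L] :
    DirectSum.IsInternal (fun u : Phi0 => S.W u.1) := by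
  rw [DirectSum.isInternal_submodule_iff_iSupIndep_and_iSup_eq_top]
  refine ⟨W_indep.comp Subtype.val_injective, ?_⟩
  rw [eq_top_iff, ← W_top (S := S)]
  apply iSup_le
  intro u
  by_cases hu : u ∈ Phi0
  · exact le_iSup (fun u : Phi0 => S.W u.1) ⟨u, hu⟩
  · simp only [Phi0, Finset.mem_insert, not_or] at hu
    rw [W_bot u hu.1 hu.2]; exact bot_le

lemma fin_L (S : SData F L) [Nontrivial L] : Module.Finite F L := by
  have h := isInternal (S := S)
  have : ∀ u : Phi0, Module.Finite F (S.W u.1) := fun u => fin_W u.1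
  let b := h.collectedBasis (fun u => Module.finBasis F (S.W u.1))
  exact Module.Finite.of_basis b

lemma sum_ins (A : Finset Lam) (h0 : (0 : Lam) ∉ A) (g : Lam → F) :
    ∑ u : (insert 0 A : Finset Lam), g u.1 = g 0 + ∑ u ∈ A, g u := by
  rw [Finset.sum_coe_sort (insert 0 A) g, Finset.sum_insert h0]

lemma trace_eq [Nontrivial L] (T : L →ₗ[F] L) (c : Lam → F)
    (hT : ∀ u ∈ Phi0, ∀ x ∈ S.W u, T x = c u • x) :
    LinearMap.trace F L T = 8 * c 0 + ∑ u ∈ Phi, c u := by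
  have h := isInternal (S := S)
  have hf : ∀ u : Phi0, Module.Finite F (S.W u.1) := fun u => fin_W u.1
  have hm : ∀ u : Phi0, Set.MapsTo T (S.W u.1) (S.W u.1) := fun u x hx => by
    rw [SetLike.mem_coe, hT u.1 u.2 x hx]; exact Submodule.smul_mem _ _ hx
  rw [LinearMap.trace_eq_sum_trace_restrict h hm]
  have e : ∀ u : Phi0, LinearMap.trace F (S.W u.1) (T.restrict (hm u)) =
      c u.1 * (Module.finrank F (S.W u.1) : F) := by
    intro u
    have : T.restrict (hm u) = c u.1 • LinearMap.id := by
      apply LinearMap.ext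
      rintro ⟨x, hx⟩
      exact Subtype.ext (hT u.1 u.2 x hx)
    rw [this, map_smul, LinearMap.trace_id, smul_eq_mul]
  rw [Finset.sum_congr rfl (fun u _ => e u)]
  refine (sum_ins Phi zero_not_mem_Phi (fun u => c u * (Module.finrank F (S.W u) : F))).trans ?_
  have h1 : c 0 * (Module.finrank F (S.W 0) : F) = 8 * c 0 := by
    rw [dim_zero, mul_comm]; norm_num
  have h2 : ∑ u ∈ Phi, c u * (Module.finrank F (S.W u) : F) = ∑ u ∈ Phi, c u :=
    Finset.sum_congr rfl fun u hu => by rw [dim_root u hu, Nat.cast_one, mul_one]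
  rw [h1, h2]

lemma killing_t [Nontrivial L] (c : Fin 8 → F) (j : Fin 8) :
    killingForm F L (S.tc c) (S.h j) = 60 * ∑ i, c i * ((pr i (sr j) : ℤ) : F) := by
  rw [killingForm_apply_apply]
  have := trace_eq (S := S) (LieAlgebra.ad F L (S.tc c) ∘ₗ LieAlgebra.ad F L (S.h j))
    (fun u => ((pr j u : ℤ) : F) * ∑ i, c i * ((pr i u : ℤ) : F)) (by
      intro u _ x hx
      rw [LinearMap.comp_apply, LieAlgebra.ad_apply, LieAlgebra.ad_apply, hx j, lie_smul, tc_lie hx,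
        smul_smul])
  rw [this]
  simp only [pr_zero, Int.cast_zero, mul_zero, Finset.sum_const_zero, zero_add, Finset.mul_sum]
  rw [Finset.sum_comm]
  apply Finset.sum_congr rfl
  intro i _
  have h2 := congrArg (Int.cast : ℤ → F) (sum_Phi_pr i j)
  rw [← pr_sr] at h2
  push_cast at h2
  rw [show (60:F) * (c i * ((pr i (sr j) : ℤ) : F)) = c i * (60 * ((pr i (sr j) : ℤ) : F)) by ring, ← h2,
    Finset.mul_sum]
  exact Finset.sum_congr rfl fun i _ => by ring

end SData
end E8Proof

namespace E8Proof
set_option linter.unusedSectionVars false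
section lin
variable {F V : Type*} [Field F] [IsAlgClosed F] [CharZero F] [AddCommGroup V] [Module F V] [FiniteDimensional F V]

/-- A stable subspace under commuting semisimple operators is spanned by common eigenvectors. -/
lemma homog_span {J : Type*} (f : J → Module.End F V) (hc : ∀ i j, Commute (f i) (f j))
    (hs : ∀ i, (f i).IsSemisimple) (p : Submodule F V) (hp : ∀ i, ∀ x ∈ p, f i x ∈ p) :
    p ≤ Submodule.span F {x | x ∈ p ∧ ∃ c : J → F, ∀ i, f i x = c i • x} := by
  have h1 := Module.End.iSup_iInf_maxGenEigenspace_eq_top_of_iSup_maxGenEigenspace_eq_top_of_commute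
    (fun i => (f i).restrict (hp i)) (fun i j _ => by
      apply LinearMap.ext
      rintro ⟨x, hx⟩
      apply Subtype.ext
      exact LinearMap.congr_fun (hc i j) x) (fun i => Module.End.iSup_maxGenEigenspace_eq_top _)
  intro x hx
  have hx' : (⟨x, hx⟩ : p) ∈ ⨆ χ : J → F, ⨅ i, Module.End.maxGenEigenspace ((f i).restrict (hp i)) (χ i) := by
    rw [h1]; trivial
  have key : ⨆ χ : J → F, ⨅ i, Module.End.maxGenEigenspace ((f i).restrict (hp i)) (χ i) ≤
      (Submodule.span F {x | x ∈ p ∧ ∃ c : J → F, ∀ i, f i x = c i • x}).comap p.subtype := by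
    apply iSup_le
    rintro χ ⟨y, hy⟩ h
    apply Submodule.subset_span
    refine ⟨hy, χ, fun i => ?_⟩
    have h2 := (Submodule.mem_iInf _).1 h i
    have hss : Module.End.IsSemisimple ((f i).restrict (hp i)) :=
      (hs i).restrict (Module.End.mem_invtSubmodule_iff_mapsTo (f := f i) |>.2 (hp i))
    rw [hss.isFinitelySemisimple.maxGenEigenspace_eq_eigenspace, Module.End.mem_eigenspace_iff] at h2
    exact congrArg Subtype.val h2
  exact key hx'

lemma ss_of_diag (T : Module.End F V) (h : ⊤ ≤ Submodule.span F {x | ∃ c : F, T x = c • x}) :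
    T.IsSemisimple := by
  obtain ⟨n, hn, s, hs, hnil, hss, hT⟩ := T.exists_isNilpotent_isSemisimple
  have hTs : T = s := by
    apply LinearMap.ext
    intro x
    have hx := h (show x ∈ ⊤ from trivial)
    induction hx using Submodule.span_induction with
    | mem y hy =>
      obtain ⟨c, hc⟩ := hy
      rw [hc]
      refine (Module.End.apply_eq_of_mem_of_comm_of_isFinitelySemisimple_of_isNil (f := T) (k := 1)
        (μ := c) ?_ ?_ hss.isFinitelySemisimple ?_).symm
      · exact Module.End.mem_eigenspace_iff.2 hc
      · exact Algebra.commute_of_mem_adjoin_self hs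
      · rw [hT]; simpa using hnil
    | zero => simp
    | add a b _ _ ha hb => rw [map_add, map_add, ha, hb]
    | smul a b _ hb => rw [map_smul, map_smul, hb]
  rw [hTs]; exact hss
end lin

variable {F L : Type*} [Field F] [IsAlgClosed F] [CharZero F] [LieRing L] [LieAlgebra F L]

namespace SData
variable {S : SData F L}

lemma mem_some_W {x : L} (hx : x ≠ 0) (c : Fin 8 → F) (h : ∀ i, ⁅S.h i, x⁆ = c i • x) :
    ∃ u, x ∈ S.W u := by
  by_contra hcon
  push Not at hcon
  have hind := Module.End.independent_iInf_maxGenEigenspace_of_forall_mapsTo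
    (f := fun i : Fin 8 => LieAlgebra.ad F L (S.h i)) (by
      intro i j φ
      apply Module.End.mapsTo_maxGenEigenspace_of_comm
      ext x
      simp only [Module.End.mul_apply, LieAlgebra.ad_apply]
      rw [leibniz_lie, S.hh, zero_lie, zero_add])
  have hmem : ∀ (y : L) (χ : Fin 8 → F), (∀ i, ⁅S.h i, y⁆ = χ i • y) →
      y ∈ ⨅ i, (LieAlgebra.ad F L (S.h i)).maxGenEigenspace (χ i) := by
    intro y χ hy
    rw [Submodule.mem_iInf]
    intro i
    refine ((LieAlgebra.ad F L (S.h i)).genEigenspace (χ i)).mono (le_top : (1 : ℕ∞) ≤ ⊤) ?_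
    exact Module.End.mem_eigenspace_iff.2 (hy i)
  apply hx
  refine Submodule.disjoint_def.1 (hind c) x (hmem x c h) ?_
  have htop := W_top (S := S)
  have : x ∈ ⨆ u, S.W u := by rw [htop]; trivial
  refine (iSup_le ?_ : ⨆ u, S.W u ≤ _) this
  intro u
  have hne : (fun i => ((pr i u : ℤ) : F)) ≠ c := by
    rintro rfl
    exact hcon u h
  refine le_trans ?_ (le_iSup₂ (f := fun (χ : Fin 8 → F) (_ : χ ≠ c) =>
    ⨅ i, (LieAlgebra.ad F L (S.h i)).maxGenEigenspace (χ i)) _ hne)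
  intro y hy
  exact hmem y _ hy

lemma h_ss [Nontrivial L] [FiniteDimensional F L] (i : Fin 8) : (LieAlgebra.ad F L (S.h i)).IsSemisimple := by
  apply ss_of_diag
  rw [← W_top (S := S)]
  apply iSup_le
  intro u x hx
  exact Submodule.subset_span ⟨_, hx i⟩

lemma ideal_W [Nontrivial L] (I : LieIdeal F L) (h0 : ∀ x ∈ I, x ∈ S.W 0 → x = 0) (N : ℕ) :
    ∀ u : Lam, ht u ≤ N → ip u u = 2 → (∀ i, 0 ≤ u i) → ∀ x ∈ I, x ∈ S.W u → x = 0 := by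
  have base : ∀ (i : Fin 8), ∀ x ∈ I, x ∈ S.W (sr i) → x = 0 := by
    intro i x hx hxu
    rw [W_simple, Submodule.mem_span_singleton] at hxu
    obtain ⟨c, rfl⟩ := hxu
    by_contra hne
    have hc : c ≠ 0 := fun h => hne (by rw [h, zero_smul])
    have he : S.e i ∈ I := by
      have := I.smul_mem c⁻¹ hx
      rwa [inv_smul_smul₀ hc] at this
    have hh : S.h i ∈ I := by
      have h1 := lie_mem_left F L I (S.e i) (S.f i) he
      rwa [S.ef, if_pos rfl] at h1
    have h2 := h0 _ hh (h_mem i)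
    have h3 := S.he i i
    rw [h2, zero_lie] at h3
    have h4 := smul_eq_zero.1 h3.symm
    rcases h4 with h4 | h4
    · have := pr_self i
      rw [this] at h4
      norm_num at h4
    · exact e_ne_zero i h4
  induction N with
  | zero =>
    intro u hu h2 hnn
    exfalso
    have : u = 0 := by
      funext j
      exact (Finset.sum_eq_zero_iff_of_nonneg (fun i _ => hnn i)).1 (le_antisymm hu (ht_nonneg hnn)) j
        (Finset.mem_univ j)
    rw [this, ip_zero_left] at h2
    omega
  | succ N ih =>
    intro u hu h2 hnn x hx hxu
    rcases pos_root_cases h2 hnn with ⟨i, rfl⟩ | ⟨i, hi, hn, hr⟩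
    · exact base i x hx hxu
    · obtain ⟨g, hg, hg2⟩ := refl_map (S := S) i u 1 (by rw [hi]; rfl)
      have h3 := (g ⟨x, hxu⟩).2
      have h4 := hg2 ⟨x, hxu⟩
      rw [h4] at h3
      simp only [pow_one, Nat.cast_one, one_smul] at h3 h4
      rw [LieAlgebra.ad_apply] at h4 h3
      have h5 := ih (u - sr i) (by rw [ht_sub, ht_sr]; push_cast at hu; omega) hr hn _
        (lie_mem_right F L I (S.f i) x hx) h3
      rw [h5] at h4
      have h6 : g ⟨x, hxu⟩ = g 0 := by rw [map_zero]; exact Subtype.ext h4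
      exact congrArg Subtype.val (hg h6)

theorem isKilling (S : SData F L) [Nontrivial L] : LieAlgebra.IsKilling F L := by
  have := fin_L S
  constructor
  set I := LieIdeal.killingCompl F L ⊤ with hI
  have h0 : ∀ x ∈ I, x ∈ S.W 0 → x = 0 := by
    intro x hx hx0
    rw [← tc_range] at hx0
    obtain ⟨c, rfl⟩ := hx0
    rw [hI, LieIdeal.mem_killingCompl] at hx
    rw [pr_cast_inj c (fun j => ?_), map_zero]
    have h1 := killing_t (S := S) c j
    rw [← LieModule.traceForm_comm, hx _ (LieSubmodule.mem_top _)] at h1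
    have := mul_eq_zero.1 h1.symm
    exact this.resolve_left (by norm_num)
  have hroot : ∀ u, ∀ x ∈ I, x ∈ S.W u → x = 0 := by
    intro u x hx hxu
    by_cases hu0 : u = 0
    · subst hu0; exact h0 x hx hxu
    by_cases hu : u ∈ Phi
    · rw [mem_Phi] at hu
      rcases root_sign hu with h | h
      · exact ideal_W I h0 (ht u).toNat u (by omega) hu h x hx hxu
      · refine ideal_W (S := S.swap) I ?_ (ht (-u)).toNat (-u) (by omega) ?_ h x hx ?_
        · intro y hy hy0
          rw [swap_W, neg_zero] at hy0
          exact h0 y hy hy0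
        · rw [ip_neg_left, ip_neg_right, neg_neg]; exact hu
        · rw [swap_W, neg_neg]; exact hxu
    · rw [W_bot u hu0 hu] at hxu
      exact hxu
  have hsp := homog_span (fun i => LieAlgebra.ad F L (S.h i)) (by
      intro i j
      ext x
      simp only [Module.End.mul_apply, LieAlgebra.ad_apply]
      rw [leibniz_lie, S.hh, zero_lie, zero_add]) (fun i => h_ss i) I.toSubmodule
      (fun i x hx => lie_mem_right F L I (S.h i) x hx)
  rw [← LieSubmodule.toSubmodule_eq_bot, eq_bot_iff]
  refine hsp.trans ?_
  rw [Submodule.span_le]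
  rintro x ⟨hx, c, hc⟩
  by_cases hx0 : x = 0
  · rw [hx0]; exact Submodule.zero_mem _
  · obtain ⟨u, hu⟩ := mem_some_W (S := S) hx0 c hc
    exact absurd (hroot u x hx hu) hx0

end SData
end E8Proof

namespace E8Proof
set_option linter.unusedSectionVars false
variable {F L : Type*} [Field F] [IsAlgClosed F] [CharZero F] [LieRing L] [LieAlgebra F L]
  [FiniteDimensional F L]

lemma exp_exists (D : Module.End F L) (hder : ∀ a b, D ⁅a, b⁆ = ⁅D a, b⁆ + ⁅a, D b⁆) (K : ℕ) (hK : D ^ K = 0) :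
    ∃ τ : lieAut F L, ∀ y, τ.1 y = ∑ k ∈ Finset.range K, ((k.factorial : F))⁻¹ • (D ^ k) y := by
  let i1 : Module ℚ L := Module.compHom L (algebraMap ℚ F)
  have hsm : ∀ (r : ℚ) (x : L), r • x = (algebraMap ℚ F r) • x := fun r x => rfl
  let i2 : LieAlgebra ℚ L := { lie_smul := fun r x y => by rw [hsm, hsm, lie_smul] }
  let E : LieDerivation F L L :=
    { toLinearMap := D
      leibniz' := fun a b => by
        change D _ = ⁅a, D b⁆ - ⁅b, D a⁆
        rw [hder, ← lie_skew b (D a)]; abel }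
  have hnil : IsNilpotent E.toLinearMap := ⟨K, hK⟩
  refine ⟨⟨(LieDerivation.exp E hnil).toLinearEquiv, fun x y => LieEquiv.map_lie _ x y⟩, fun y => ?_⟩
  change LieDerivation.exp E hnil y = _
  rw [LieDerivation.exp_map_apply, IsNilpotent.exp_eq_sum (k := K) hK, LinearMap.sum_apply]
  refine Finset.sum_congr rfl fun k _ => ?_
  rw [LinearMap.smul_apply, hsm]
  congr 1
  simp

lemma ad_aut (q : lieAut F L) (x y : L) : q.1 ⁅x, q.1.symm y⁆ = ⁅q.1 x, y⁆ := by
  rw [q.2, LinearEquiv.apply_symm_apply]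

lemma killing_aut (q : lieAut F L) (x y : L) : killingForm F L (q.1 x) (q.1 y) = killingForm F L x y := by
  let e : L ≃ₗ⁅F⁆ L := { q.1 with map_lie' := fun {x y} => q.2 x y }
  exact LieAlgebra.killingForm_of_equiv_apply e x y

/-- Jordan decomposition in L. -/
lemma jordan [LieAlgebra.IsKilling F L] (x : L) : ∃ s n : L, x = n + s ∧ (LieAlgebra.ad F L s).IsSemisimple ∧
    IsNilpotent (LieAlgebra.ad F L n) ∧ Commute (LieAlgebra.ad F L n) (LieAlgebra.ad F L s) := by
  obtain ⟨N, hN, T, hT, hnil, hss, hD⟩ := (LieAlgebra.ad F L x).exists_isNilpotent_isSemisimple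
  set D := LieAlgebra.ad F L x with hDdef
  have hcomm : Commute N T :=
    Algebra.commute_of_mem_adjoin_singleton_of_commute hT (Algebra.commute_of_mem_adjoin_self hN).symm
  have hact : ∀ (c : F) (y : L), y ∈ D.maxGenEigenspace c → T y = c • y := by
    intro c y hy
    refine Module.End.apply_eq_of_mem_of_comm_of_isFinitelySemisimple_of_isNil hy ?_
      hss.isFinitelySemisimple ?_
    · exact Algebra.commute_of_mem_adjoin_self hT
    · rw [hD]; simpa using hnil
  have htop := Module.End.iSup_maxGenEigenspace_eq_top D
  have hder : ∀ a b, T ⁅a, b⁆ = ⁅T a, b⁆ + ⁅a, T b⁆ := by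
    intro a b
    have ha : a ∈ ⨆ c, D.maxGenEigenspace c := by rw [htop]; trivial
    have hb : b ∈ ⨆ c, D.maxGenEigenspace c := by rw [htop]; trivial
    induction ha using Submodule.iSup_induction' with
    | mem c y hy =>
      induction hb using Submodule.iSup_induction' with
      | mem d z hz =>
        have := LieModule.lie_mem_maxGenEigenspace_toEnd (R := F) (L := L) (M := L) (x := x) hy hz
        rw [hact _ _ this, hact _ _ hy, hact _ _ hz, smul_lie, lie_smul, add_smul]
      | zero => simp
      | add u v _ _ hu hv => rw [lie_add, map_add, hu, hv, map_add, lie_add, lie_add]; abel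
    | zero => simp
    | add u v _ _ hu hv => rw [add_lie, map_add, hu, hv, map_add, add_lie, add_lie]; abel
  let E : LieDerivation F L L :=
    { toLinearMap := T
      leibniz' := fun a b => by
        change T _ = ⁅a, T b⁆ - ⁅b, T a⁆
        rw [hder, ← lie_skew b (T a)]; abel }
  obtain ⟨s, hs⟩ := LieDerivation.IsKilling.exists_eq_ad E
  have hs' : LieAlgebra.ad F L s = T := by
    rw [← LieDerivation.coe_ad_apply_eq_ad_apply, hs]
  have hn' : LieAlgebra.ad F L (x - s) = N := by
    rw [map_sub, hs', ← hDdef, hD]; simp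
  refine ⟨s, x - s, by abel, ?_, ?_, ?_⟩
  · rw [hs']; exact hss
  · rw [hn']; exact hnil
  · rw [hn', hs']; exact hcomm

lemma ad_inj [LieAlgebra.IsKilling F L] {x y : L} (h : LieAlgebra.ad F L x = LieAlgebra.ad F L y) : x = y := by
  have h1 : LieDerivation.ad F L (x - y) = 0 := by
    ext z
    have := LinearMap.congr_fun h z
    simp only [LieAlgebra.ad_apply] at this
    simp [this]
  rw [LieDerivation.IsKilling.ad_apply_eq_zero_iff] at h1
  exact sub_eq_zero.1 h1

lemma ad_conj (q : lieAut F L) (x : L) :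
    LieAlgebra.ad F L (q.1 x) = q.1.conjRingEquiv (LieAlgebra.ad F L x) := by
  ext y
  simp [ad_aut]


lemma diag_span (T : Module.End F L) (h : T.IsSemisimple) :
    ⊤ ≤ Submodule.span F {x | ∃ c : F, T x = c • x} := by
  have := homog_span (fun _ : Unit => T) (fun _ _ => rfl) (fun _ => h) ⊤ (fun _ _ _ => trivial)
  refine this.trans (Submodule.span_mono ?_)
  rintro x ⟨-, c, hc⟩
  exact ⟨c (), hc ()⟩

lemma aut_ss (q : lieAut F L) {s : L} (h : (LieAlgebra.ad F L s).IsSemisimple) :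
    (LieAlgebra.ad F L (q.1 s)).IsSemisimple := by
  apply ss_of_diag
  intro y _
  have hy := diag_span _ h (show q.1.symm y ∈ ⊤ from trivial)
  have h2 : q.1 (q.1.symm y) ∈ (Submodule.span F {x | ∃ c : F, LieAlgebra.ad F L s x = c • x}).map q.1.toLinearMap :=
    Submodule.mem_map_of_mem hy
  rw [LinearEquiv.apply_symm_apply, Submodule.map_span] at h2
  refine Submodule.span_mono ?_ h2
  rintro _ ⟨z, ⟨c, hc⟩, rfl⟩
  refine ⟨c, ?_⟩
  rw [LieAlgebra.ad_apply] at hc ⊢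
  change ⁅q.1 s, q.1 z⁆ = c • q.1 z
  rw [← q.2, hc, map_smul]

lemma aut_nil (q : lieAut F L) {s : L} (h : IsNilpotent (LieAlgebra.ad F L s)) :
    IsNilpotent (LieAlgebra.ad F L (q.1 s)) := by
  rw [ad_conj]; exact h.map q.1.conjRingEquiv

lemma jordan_smul [LieAlgebra.IsKilling F L] {s n : L} (hs : (LieAlgebra.ad F L s).IsSemisimple)
    (hn : IsNilpotent (LieAlgebra.ad F L n)) (hc : Commute (LieAlgebra.ad F L n) (LieAlgebra.ad F L s))
    (q : lieAut F L) (c : F) (hq : q.1 (n + s) = c • (n + s)) : q.1 n = c • n ∧ q.1 s = c • s := by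
  have h := Module.End.isNilpotent_isSemisimple_unique (n₁ := LieAlgebra.ad F L (q.1 n))
    (s₁ := LieAlgebra.ad F L (q.1 s)) (n₂ := c • LieAlgebra.ad F L n) (s₂ := c • LieAlgebra.ad F L s)
    (aut_nil q hn) (aut_ss q hs) (hn.smul c) (Module.End.IsSemisimple_smul c hs)
    (by rw [ad_conj, ad_conj]; exact hc.map q.1.conjRingEquiv)
    ((hc.smul_left c).smul_right c)
    (by rw [← map_add, ← map_add, hq, map_smul, map_add, smul_add])
  exact ⟨ad_inj (by rw [h.1, map_smul]), ad_inj (by rw [h.2, map_smul])⟩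

section grp
variable {Q : Subgroup (lieAut F L)}

lemma mem_of_comm (hQ : IsMaximalFiniteAbelian Q) (τ : lieAut F L) (h : ∀ q ∈ Q, τ * q = q * τ) : τ ∈ Q := by
  have hc : ∀ x ∈ (Q : Set (lieAut F L)) ∪ {τ}, ∀ y ∈ (Q : Set (lieAut F L)) ∪ {τ}, x * y = y * x := by
    rintro x (hx | rfl) y (hy | rfl)
    · exact hQ.2.1 x y hx hy
    · exact (h x hx).symm
    · exact h y hy
    · rfl
  have h1 := Subgroup.isMulCommutative_closure hc
  have h2 := hQ.2.2 (Subgroup.closure ((Q : Set (lieAut F L)) ∪ {τ}))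
    (fun a b ha hb => by
      have := h1.is_comm.comm ⟨a, ha⟩ ⟨b, hb⟩
      exact congrArg Subtype.val this)
    (fun x hx => Subgroup.subset_closure (Or.inl hx))
  rw [← h2]
  exact Subgroup.subset_closure (Or.inr rfl)

lemma comm_of (τ q : lieAut F L) (h : ∀ y, τ.1 (q.1 y) = q.1 (τ.1 y)) : τ * q = q * τ := by
  apply Subtype.ext
  apply LinearEquiv.ext
  intro y
  exact h y

lemma pow_act (τ : lieAut F L) (m : ℕ) (y : L) : (τ ^ m).1 y = (fun z => τ.1 z)^[m] y := by
  induction m generalizing y with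
  | zero => rfl
  | succ m ih =>
    rw [Function.iterate_succ_apply, ← ih, pow_succ]; rfl

lemma exists_pow (hQ : IsMaximalFiniteAbelian Q) {τ : lieAut F L} (h : τ ∈ Q) :
    ∃ m : ℕ, 0 < m ∧ ∀ y, (fun z => τ.1 z)^[m] y = y := by
  have := hQ.1
  refine ⟨orderOf (⟨τ, h⟩ : Q), orderOf_pos _, fun y => ?_⟩
  rw [← pow_act]
  have := pow_orderOf_eq_one (⟨τ, h⟩ : Q)
  have h2 : τ ^ orderOf (⟨τ, h⟩ : Q) = 1 := congrArg Subtype.val this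
  rw [h2]; rfl

lemma nil_fixed [LieAlgebra.IsKilling F L] (hQ : IsMaximalFiniteAbelian Q) {n : L} (hn : IsNilpotent (LieAlgebra.ad F L n))
    (hfix : ∀ q ∈ Q, q.1 n = n) : n = 0 := by
  obtain ⟨K, hK⟩ := hn
  set D := LieAlgebra.ad F L n with hD
  obtain ⟨τ, hτ⟩ := exp_exists D (fun a b => by rw [hD]; exact leibniz_lie n a b) (K + 2)
    (by rw [pow_add, hK, zero_mul])
  have hmem : τ ∈ Q := by
    apply mem_of_comm hQ
    intro q hq
    apply comm_of
    intro y
    rw [hτ, hτ, map_sum]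
    refine Finset.sum_congr rfl fun k _ => ?_
    rw [map_smul]
    congr 1
    clear * - hfix hq hD
    induction k with
    | zero => simp
    | succ k ih =>
      rw [pow_succ', Module.End.mul_apply, ih, Module.End.mul_apply, hD, LieAlgebra.ad_apply, LieAlgebra.ad_apply,
        q.2, hfix q hq]
  obtain ⟨m, hm, hm2⟩ := exists_pow hQ hmem
  have key : ∀ y, D (D y) = 0 → D y = 0 := by
    intro y hy
    have h1 : ∀ z, D (D z) = 0 → τ.1 z = z + D z := by
      intro z hz
      rw [hτ, Finset.sum_range_succ', Finset.sum_range_succ']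
      rw [Finset.sum_eq_zero]
      · simp [add_comm]
      · intro k _
        rw [show k + 1 + 1 = k + 2 from rfl, pow_add, Module.End.mul_apply, pow_two, Module.End.mul_apply, hz, map_zero,
          smul_zero]
    have h2 : ∀ j : ℕ, (fun z => τ.1 z)^[j] y = y + (j : F) • D y := by
      intro j
      induction j with
      | zero => simp
      | succ j ih =>
        rw [Function.iterate_succ_apply', ih]
        change τ.1 _ = _
        rw [map_add, map_smul, h1 y hy, h1 (D y) (by rw [hy, map_zero]), hy, add_zero]
        push_cast
        rw [add_smul, one_smul]; abel
    have h3 := hm2 y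
    rw [h2, add_eq_left, smul_eq_zero] at h3
    exact h3.resolve_left (by exact_mod_cast hm.ne')
  have h4 : ∀ k : ℕ, ∀ y, (D ^ (k+1)) y = 0 → D y = 0 := by
    intro k
    induction k with
    | zero => intro y hy; simpa using hy
    | succ k ih =>
      intro y hy
      apply key
      apply ih
      rwa [pow_succ, Module.End.mul_apply] at hy
  apply ad_inj (F := F)
  rw [map_zero]
  ext y
  exact h4 K y (by rw [pow_succ', Module.End.mul_apply, hK]; simp)

lemma ss_fixed [LieAlgebra.IsKilling F L] (hQ : IsMaximalFiniteAbelian Q) {s : L}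
    (hs : (LieAlgebra.ad F L s).IsSemisimple) (hfix : ∀ q ∈ Q, q.1 s = s) : s = 0 := by
  classical
  set D := LieAlgebra.ad F L s with hD
  have hspan := diag_span D hs
  have hzero : ∀ c : F, D.HasEigenvalue c → c = 0 := by
    intro c hc
    by_contra hc0
    -- the finite set of eigenvalues
    have hfin : Set.Finite {d : F | D.HasEigenvalue d} := by
      have := Module.End.finite_hasEigenvalue D
      exact this
    set A : AddSubgroup F := AddSubgroup.closure {d : F | D.HasEigenvalue d} with hA
    have hAfg : Module.Finite ℤ A := by
      rw [Module.Finite.iff_addGroup_fg]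
      exact (AddGroup.fg_iff_addSubgroup_fg A).2 ⟨hfin.toFinset, by simp [hA]⟩
    have hfree : Module.Free ℤ A := inferInstance
    have hmemA : ∀ d, D.HasEigenvalue d → d ∈ A := fun d hd => AddSubgroup.subset_closure hd
    obtain ⟨φ, hφ⟩ : ∃ φ : A →ₗ[ℤ] ℤ, φ ⟨c, hmemA c hc⟩ ≠ 0 := by
      by_contra hcon
      push Not at hcon
      let b := Module.Free.chooseBasis ℤ A
      have : (⟨c, hmemA c hc⟩ : A) = 0 := by
        apply b.repr.injective
        ext i
        rw [map_zero]
        exact hcon (b.coord i)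
      exact hc0 (congrArg Subtype.val this)
    let g : ℤ → F → F := fun e d => if h : d ∈ A then (2 : F) ^ (e * φ ⟨d, h⟩) else 1
    have hg : ∀ e : ℤ, ∃ T : Module.End F L, (∀ d y, D y = d • y → D.HasEigenvalue d → T y = g e d • y) ∧
        ∀ q ∈ Q, ∀ y, T (q.1 y) = q.1 (T y) := by
      intro e
      let p := Lagrange.interpolate hfin.toFinset id (g e)
      refine ⟨Polynomial.aeval D p, ?_, ?_⟩
      · intro d y hy hd
        by_cases hy0 : y = 0
        · simp [hy0]
        rw [Module.End.aeval_apply_of_hasEigenvector ⟨Module.End.mem_eigenspace_iff.2 hy, hy0⟩]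
        congr 1
        exact Lagrange.eval_interpolate_at_node (v := id) (g e) (fun _ _ _ _ h => h) (i := d) (by simpa using hd)
      · intro q hq y
        have h1 : Commute D q.1.toLinearMap := by
          apply LinearMap.ext
          intro z
          change ⁅s, q.1 z⁆ = q.1 ⁅s, z⁆
          rw [q.2, hfix q hq]
        have h2 : Commute (q.1.toLinearMap : Module.End F L) (Polynomial.aeval D p) :=
          Algebra.commute_of_mem_adjoin_singleton_of_commute (Polynomial.aeval_mem_adjoin_singleton _ _) h1.symm
        exact (LinearMap.congr_fun h2 y).symm
    obtain ⟨T, hT, hTq⟩ := hg 1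
    obtain ⟨U, hU, -⟩ := hg (-1)
    have hev : ∀ d y, D y = d • y → y ≠ 0 → D.HasEigenvalue d := fun d y h h0 =>
      Module.End.hasEigenvalue_of_hasEigenvector ⟨Module.End.mem_eigenspace_iff.2 h, h0⟩
    have hTU : ∀ y, T (U y) = y ∧ U (T y) = y := by
      intro y
      have hy := hspan (show y ∈ ⊤ from trivial)
      induction hy using Submodule.span_induction with
      | mem y hy =>
        obtain ⟨d, hd⟩ := hy
        by_cases h0 : y = 0
        · simp [h0]
        have hd2 := hev d y hd h0
        rw [hT d y hd hd2, hU d y hd hd2, map_smul, map_smul, hT d y hd hd2, hU d y hd hd2, smul_smul, smul_smul]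
        have : g 1 d * g (-1) d = 1 := by
          simp only [g, dif_pos (hmemA d hd2)]
          rw [← zpow_add₀ (by norm_num)]
          simp
        rw [mul_comm (g (-1) d), this, one_smul]
        exact ⟨rfl, rfl⟩
      | zero => simp
      | add a b _ _ ha hb => simp only [map_add, ha, hb, and_self]
      | smul a b _ hb => simp only [map_smul, hb, and_self]
    have hTlie : ∀ y z, T ⁅y, z⁆ = ⁅T y, T z⁆ := by
      intro y z
      have hy := hspan (show y ∈ ⊤ from trivial)
      have hz := hspan (show z ∈ ⊤ from trivial)
      induction hy using Submodule.span_induction with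
      | mem y hy =>
        obtain ⟨d, hd⟩ := hy
        by_cases h0 : y = 0
        · simp [h0]
        induction hz using Submodule.span_induction with
        | mem z hz =>
          obtain ⟨d', hd'⟩ := hz
          by_cases h0' : z = 0
          · simp [h0']
          have e1 := hev d y hd h0
          have e2 := hev d' z hd' h0'
          rw [hT d y hd e1, hT d' z hd' e2, smul_lie, lie_smul, smul_smul]
          by_cases h1 : ⁅y, z⁆ = 0
          · simp [h1]
          have h2 : D ⁅y, z⁆ = (d + d') • ⁅y, z⁆ := by
            rw [hD, LieAlgebra.ad_apply] at hd hd' ⊢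
            rw [leibniz_lie, hd, hd', smul_lie, lie_smul, add_smul]
          have e3 := hev _ _ h2 h1
          rw [hT _ _ h2 e3]
          congr 1
          simp only [g, dif_pos (hmemA _ e1), dif_pos (hmemA _ e2), dif_pos (hmemA _ e3)]
          rw [← zpow_add₀ (by norm_num), ← mul_add, ← map_add]
          rfl
        | zero => simp
        | add a b _ _ ha hb => rw [lie_add, map_add, ha, hb, map_add, lie_add]
        | smul a b _ hb => rw [lie_smul, map_smul, hb, map_smul, lie_smul]
      | zero => simp
      | add a b _ _ ha hb => rw [add_lie, map_add, ha, hb, map_add, add_lie]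
      | smul a b _ hb => rw [smul_lie, map_smul, hb, map_smul, smul_lie]
    let τ : lieAut F L := ⟨LinearEquiv.ofLinear T U (LinearMap.ext fun y => (hTU y).1)
      (LinearMap.ext fun y => (hTU y).2), hTlie⟩
    have hτ : ∀ y, τ.1 y = T y := fun y => rfl
    have hmem : τ ∈ Q := mem_of_comm hQ τ fun q hq => comm_of _ _ fun y => by rw [hτ, hτ, hTq q hq]
    obtain ⟨m, hm, hm2⟩ := exists_pow hQ hmem
    obtain ⟨y, hy⟩ := hc.exists_hasEigenvector
    have hy1 : D y = c • y := Module.End.mem_eigenspace_iff.1 hy.1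
    have h5 : ∀ j : ℕ, (fun z => τ.1 z)^[j] y = (g 1 c) ^ j • y := by
      intro j
      induction j with
      | zero => simp
      | succ j ih =>
        rw [Function.iterate_succ_apply', ih]
        change τ.1 _ = _
        rw [map_smul, hτ, hT c y hy1 hc, smul_smul, pow_succ]
    have h6 := hm2 y
    rw [h5] at h6
    have h7 : (g 1 c) ^ m = 1 := by
      by_contra h
      apply hy.2
      have : ((g 1 c) ^ m - 1) • y = 0 := by rw [sub_smul, h6, one_smul, sub_self]
      exact (smul_eq_zero.1 this).resolve_left (sub_ne_zero.2 h)
    simp only [g, dif_pos (hmemA _ hc)] at h7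
    rw [← zpow_natCast, ← zpow_mul] at h7
    have h8 : ((2 : ℚ)) ^ (1 * φ ⟨c, hmemA c hc⟩ * (m : ℤ)) = 1 := by
      have : ((((2 : ℚ)) ^ (1 * φ ⟨c, hmemA c hc⟩ * (m : ℤ)) : ℚ) : F) = ((1 : ℚ) : F) := by
        push_cast; exact h7
      exact_mod_cast this
    rw [zpow_eq_one_iff_right₀ (by norm_num) (by norm_num)] at h8
    rcases mul_eq_zero.1 h8 with h9 | h9
    · exact hφ (by simpa using h9)
    · omega
  have h0 : D = 0 := (hs.eq_zero_iff_forall_eigenvalue).2 hzero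
  exact ad_inj (F := F) (by rw [map_zero]; exact h0)

theorem fixed_zero [LieAlgebra.IsKilling F L] (hQ : IsMaximalFiniteAbelian Q) {x : L}
    (hfix : ∀ q ∈ Q, q.1 x = x) : x = 0 := by
  obtain ⟨s, n, rfl, hs, hn, hc⟩ := jordan (F := F) x
  have h := fun q hq => jordan_smul hs hn hc q 1 (by rw [hfix q hq, one_smul])
  rw [nil_fixed hQ hn (fun q hq => by simpa using (h q hq).1),
    ss_fixed hQ hs (fun q hq => by simpa using (h q hq).2), add_zero]

/-- homogeneous elements -/
def Hg (Q : Subgroup (lieAut F L)) (x : L) : Prop := ∀ q ∈ Q, ∃ c : F, q.1 x = c • x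

lemma Hg.lie {x y : L} (hx : Hg Q x) (hy : Hg Q y) : Hg Q ⁅x, y⁆ := by
  intro q hq
  obtain ⟨c, hc⟩ := hx q hq
  obtain ⟨d, hd⟩ := hy q hq
  exact ⟨c * d, by rw [q.2, hc, hd, smul_lie, lie_smul, smul_smul]⟩

lemma Hg.ad_pow {x y : L} (hx : Hg Q x) (hy : Hg Q y) (m : ℕ) : Hg Q ((LieAlgebra.ad F L x ^ m) y) := by
  induction m with
  | zero => simpa using hy
  | succ m ih => rw [pow_succ', Module.End.mul_apply, LieAlgebra.ad_apply]; exact hx.lie ih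

lemma finite_ss (hQ : IsMaximalFiniteAbelian Q) {q : lieAut F L} (hq : q ∈ Q) :
    Module.End.IsSemisimple (q.1.toLinearMap : Module.End F L) := by
  obtain ⟨m, hm, hm2⟩ := exists_pow hQ hq
  apply Module.End.isSemisimple_of_squarefree_aeval_eq_zero (p := Polynomial.X ^ m - 1)
  · apply Polynomial.Separable.squarefree
    have := Polynomial.separable_X_pow_sub_C (F := F) (n := m) 1 (by exact_mod_cast hm.ne') one_ne_zero
    simpa using this
  · apply LinearMap.ext
    intro y
    have := hm2 y
    rw [← pow_act] at this
    have e : (q.1.toLinearMap ^ m : Module.End F L) y = (fun z => q.1 z)^[m] y := by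
      rw [Module.End.pow_apply]; rfl
    simp [e, hm2 y]

lemma Hg_span (hQ : IsMaximalFiniteAbelian Q) (p : Submodule F L) (hp : ∀ q ∈ Q, ∀ x ∈ p, q.1 x ∈ p) :
    p ≤ Submodule.span F {x | x ∈ p ∧ Hg Q x} := by
  have := homog_span (fun q : Q => (q.1.1.toLinearMap : Module.End F L)) (fun i j => by
    apply LinearMap.ext
    intro y
    have := hQ.2.1 i.1 j.1 i.2 j.2
    exact LinearEquiv.congr_fun (congrArg Subtype.val this) y) (fun i => finite_ss hQ i.2) p (fun i x hx => hp i.1 i.2 x hx)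
  refine this.trans (Submodule.span_mono ?_)
  rintro x ⟨hx, c, hc⟩
  exact ⟨hx, fun q hq => ⟨c ⟨q, hq⟩, hc ⟨q, hq⟩⟩⟩

lemma Hg.nil [LieAlgebra.IsKilling F L] (hQ : IsMaximalFiniteAbelian Q) {x : L} (hx : Hg Q x)
    (hn : IsNilpotent (LieAlgebra.ad F L x)) : x = 0 := by
  have hk : ∀ z, killingForm F L x z = 0 := by
    intro z
    have hz := Hg_span hQ ⊤ (fun _ _ _ _ => trivial) (show z ∈ ⊤ from trivial)
    induction hz using Submodule.span_induction with
    | mem z hz =>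
      by_cases hcon : ∀ q ∈ Q, q.1 ⁅x, z⁆ = ⁅x, z⁆
      · have h0 := fixed_zero hQ hcon
        rw [killingForm_apply_apply]
        have hcomm : Commute (LieAlgebra.ad F L x) (LieAlgebra.ad F L z) := by
          apply LinearMap.ext
          intro y
          simp only [Module.End.mul_apply, LieAlgebra.ad_apply]
          rw [leibniz_lie, h0, zero_lie, zero_add]
        have := hcomm.isNilpotent_mul_right hn
        exact (LinearMap.isNilpotent_trace_of_isNilpotent this).eq_zero
      · push Not at hcon
        obtain ⟨q, hq, hne⟩ := hcon
        obtain ⟨c, hc⟩ := hx q hq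
        obtain ⟨d, hd⟩ := hz.2 q hq
        have h1 := killing_aut q x z
        rw [hc, hd, map_smul, map_smul, LinearMap.smul_apply, smul_smul, smul_eq_mul] at h1
        have h2 : d * c ≠ 1 := by
          intro h
          apply hne
          rw [q.2, hc, hd, smul_lie, lie_smul, smul_smul, mul_comm, h, one_smul]
        have h3 : (d * c - 1) * killingForm F L x z = 0 := by rw [sub_mul, h1, one_mul, sub_self]
        exact (mul_eq_zero.1 h3).resolve_left (sub_ne_zero.2 h2)
    | zero => simp
    | add a b _ _ ha hb => rw [map_add, ha, hb, add_zero]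
    | smul a b _ hb => rw [map_smul, hb, smul_zero]
  have : x ∈ LieIdeal.killingCompl F L ⊤ := by
    rw [LieIdeal.mem_killingCompl]
    intro y _
    rw [LieModule.traceForm_comm]
    exact hk y
  rwa [LieAlgebra.IsKilling.killingCompl_top_eq_bot, LieSubmodule.mem_bot] at this

lemma Hg.ss [LieAlgebra.IsKilling F L] (hQ : IsMaximalFiniteAbelian Q) {x : L} (hx : Hg Q x) :
    (LieAlgebra.ad F L x).IsSemisimple := by
  obtain ⟨s, n, rfl, hs, hn, hc⟩ := jordan (F := F) x
  have h0 : n = 0 := by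
    refine Hg.nil hQ (fun q hq => ?_) hn
    obtain ⟨c, h⟩ := hx q hq
    exact ⟨c, (jordan_smul hs hn hc q c h).1⟩
  rw [h0, zero_add]; exact hs

end grp
end E8Proof

namespace E8Proof
set_option linter.unusedSectionVars false
open MvPolynomial
open scoped TensorProduct

universe u
lemma common_ext_aux {K K₁ K₂ : Type u} [Field K] [Field K₁] [Field K₂] [Algebra K K₁] [Algebra K K₂] :
    ∃ (Ω : Type u) (_ : Field Ω) (m₁ : K₁ →+* Ω) (m₂ : K₂ →+* Ω),
      ∀ x, m₁ (algebraMap K K₁ x) = m₂ (algebraMap K K₂ x) := by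
  obtain ⟨I, hI⟩ := Ideal.exists_maximal (TensorProduct K K₁ K₂)
  refine ⟨TensorProduct K K₁ K₂ ⧸ I, Ideal.Quotient.field I, (Ideal.Quotient.mk I).comp
      Algebra.TensorProduct.includeLeftRingHom, (Ideal.Quotient.mk I).comp
      (Algebra.TensorProduct.includeRight (R := K) (A := K₁) (B := K₂)).toRingHom, fun x => ?_⟩
  change Ideal.Quotient.mk I (algebraMap K K₁ x ⊗ₜ[K] 1) = Ideal.Quotient.mk I (1 ⊗ₜ[K] algebraMap K K₂ x)
  rw [Algebra.algebraMap_eq_smul_one, Algebra.algebraMap_eq_smul_one, TensorProduct.smul_tmul]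

lemma common_ext {K K₁ K₂ : Type u} [Field K] [Field K₁] [Field K₂] (l₁ : K →+* K₁) (l₂ : K →+* K₂) :
    ∃ (Ω : Type u) (_ : Field Ω) (m₁ : K₁ →+* Ω) (m₂ : K₂ →+* Ω), ∀ x, m₁ (l₁ x) = m₂ (l₂ x) := by
  let a₁ := l₁.toAlgebra
  let a₂ := l₂.toAlgebra
  exact common_ext_aux (K := K) (K₁ := K₁) (K₂ := K₂)

section meet
variable {F : Type*} [Field F] [CharZero F] {ι : Type*} [Fintype ι] [DecidableEq ι]

lemma pderiv_aeval (P : ι → MvPolynomial ι F) (G : MvPolynomial ι F) (k : ι) :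
    pderiv k (aeval P G) = ∑ j, aeval P (pderiv j G) * pderiv k (P j) := by
  induction G using MvPolynomial.induction_on with
  | C a => simp
  | add p q hp hq => simp only [map_add, hp, hq, add_mul, Finset.sum_add_distrib]
  | mul_X p i hp =>
    rw [map_mul, aeval_X, pderiv_mul, hp]
    simp only [pderiv_mul, map_add, map_mul, aeval_X, pderiv_X, add_mul, Finset.sum_add_distrib]
    congr 1
    · rw [Finset.sum_mul]; exact Finset.sum_congr rfl fun j _ => by ring
    · rw [Finset.sum_eq_single i]
      · simp
      · intro b _ hb; simp [hb.symm]
      · simp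

lemma alg_indep (P : ι → MvPolynomial ι F) (hdet : (Matrix.of fun j k => eval 0 (pderiv k (P j))).det ≠ 0) :
    Function.Injective (aeval P : MvPolynomial ι F →ₐ[F] MvPolynomial ι F) := by
  rw [injective_iff_map_eq_zero]
  let M : Matrix ι ι (MvPolynomial ι F) := Matrix.of fun j k => pderiv k (P j)
  have hM : M.det ≠ 0 := by
    intro h
    apply hdet
    have := congrArg (eval (0 : ι → F)) h
    rw [RingHom.map_det, map_zero] at this
    rw [← this]; rfl
  have key : ∀ N : ℕ, ∀ G : MvPolynomial ι F, G.totalDegree ≤ N → aeval P G = 0 → G = 0 := by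
    intro N
    induction N with
    | zero =>
      intro G hG h
      rw [totalDegree_eq_zero_iff_eq_C.1 (Nat.le_zero.1 hG)] at h ⊢
      rw [aeval_C] at h
      have h' := (C_injective ι F) (h.trans (C_0).symm)
      rw [h', C_0]
    | succ N ih =>
      intro G hG h
      have h1 : (fun j => aeval P (pderiv j G)) = 0 := by
        apply Matrix.eq_zero_of_vecMul_eq_zero hM
        ext1 k
        have := pderiv_aeval P G k
        rw [h, map_zero] at this
        simpa [Matrix.vecMul, dotProduct, M] using this.symm
      have h2 : ∀ j, pderiv j G = 0 := by
        intro j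
        apply ih _ _ (congrFun h1 j)
        rw [totalDegree]
        apply Finset.sup_le
        intro m hm
        rw [mem_support_iff, coeff_pderiv] at hm
        have hm2 : coeff (m + Finsupp.single j 1) G ≠ 0 := fun h => hm (by rw [h, zero_mul])
        have := le_totalDegree (mem_support_iff.2 hm2)
        rw [Finsupp.sum_add_index' (by simp) (by simp)] at this
        simp at this
        simp; omega
      have h3 : G = C (coeff 0 G) := by
        ext m
        rw [coeff_C]
        split_ifs with hm
        · rw [← hm]
        · obtain ⟨j, hj⟩ : ∃ j, m j ≠ 0 := by
            by_contra hcon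
            push Not at hcon
            exact hm (by ext j; simp [hcon j])
          have := congrArg (coeff (m - Finsupp.single j 1)) (h2 j)
          rw [coeff_pderiv, coeff_zero] at this
          have e : m - Finsupp.single j 1 + Finsupp.single j 1 = m :=
            tsub_add_cancel_of_le (by rw [Finsupp.single_le_iff]; omega)
          rw [e] at this
          rcases mul_eq_zero.1 this with h | h
          · exact h
          · exfalso
            have : ((((m - Finsupp.single j 1 : ι →₀ ℕ) j) + 1 : ℕ) : F) = 0 := by push_cast; exact h
            rw [Nat.cast_eq_zero] at this; omega
      rw [h3, aeval_C] at h
      have h' := (C_injective ι F) (h.trans (C_0).symm)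
      rw [h3, h', C_0]
  exact fun G h => key _ G le_rfl h

variable [IsAlgClosed F]
lemma meet (P₁ P₂ : ι → MvPolynomial ι F)
    (h₁ : (Matrix.of fun j k => eval 0 (pderiv k (P₁ j))).det ≠ 0)
    (h₂ : (Matrix.of fun j k => eval 0 (pderiv k (P₂ j))).det ≠ 0)
    (r₁ r₂ : MvPolynomial ι F) (hr₁ : r₁ ≠ 0) (hr₂ : r₂ ≠ 0) :
    ∃ a₁ a₂ : ι → F, (∀ j, eval a₁ (P₁ j) = eval a₂ (P₂ j)) ∧ eval a₁ r₁ ≠ 0 ∧ eval a₂ r₂ ≠ 0 := by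
  have i₁ := alg_indep P₁ h₁
  have i₂ := alg_indep P₂ h₂
  let A := MvPolynomial ι F
  let K := FractionRing A
  let g₁ : A →ₐ[F] K := (IsScalarTower.toAlgHom F A K).comp (aeval P₁)
  let g₂ : A →ₐ[F] K := (IsScalarTower.toAlgHom F A K).comp (aeval P₂)
  have j₁ : Function.Injective g₁ := (IsFractionRing.injective A K).comp i₁
  have j₂ : Function.Injective g₂ := (IsFractionRing.injective A K).comp i₂
  let l₁ : K →ₐ[F] K := IsFractionRing.liftAlgHom (K := K) (g := g₁) j₁
  let l₂ : K →ₐ[F] K := IsFractionRing.liftAlgHom (K := K) (g := g₂) j₂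
  -- common extension of the two embeddings
  obtain ⟨Ω, _, m₁, m₂, hm⟩ := common_ext l₁.toRingHom l₂.toRingHom
  have hm : ∀ x, m₁ (l₁ x) = m₂ (l₂ x) := hm
  let : Algebra F Ω := (m₁.comp (algebraMap F K)).toAlgebra
  have hF : ∀ c, m₂ (algebraMap F K c) = m₁ (algebraMap F K c) := by
    intro c
    have := hm (algebraMap F K c)
    rw [l₁.commutes, l₂.commutes] at this
    exact this.symm
  let n₁ : A →ₐ[F] Ω := { m₁.comp (algebraMap A K) with commutes' := fun c => rfl }
  let n₂ : A →ₐ[F] Ω := { m₂.comp (algebraMap A K) with commutes' := fun c => hF c }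
  have n₁r : n₁ r₁ ≠ 0 := by
    change m₁ (algebraMap A K r₁) ≠ 0
    rw [Ne, map_eq_zero_iff _ m₁.injective, map_eq_zero_iff _ (IsFractionRing.injective A K)]
    exact hr₁
  have n₂r : n₂ r₂ ≠ 0 := by
    change m₂ (algebraMap A K r₂) ≠ 0
    rw [Ne, map_eq_zero_iff _ m₂.injective, map_eq_zero_iff _ (IsFractionRing.injective A K)]
    exact hr₂
  have hn : ∀ j, n₁ (P₁ j) = n₂ (P₂ j) := by
    intro j
    have := hm (algebraMap A K (X j))
    have e1 : l₁ (algebraMap A K (X j)) = algebraMap A K (P₁ j) := by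
      simp only [l₁, IsFractionRing.liftAlgHom_apply]
      rw [IsFractionRing.lift_algebraMap]
      exact congrArg (algebraMap A K) (aeval_X P₁ j)
    have e2 : l₂ (algebraMap A K (X j)) = algebraMap A K (P₂ j) := by
      simp only [l₂, IsFractionRing.liftAlgHom_apply]
      rw [IsFractionRing.lift_algebraMap]
      exact congrArg (algebraMap A K) (aeval_X P₂ j)
    rw [e1, e2] at this
    exact this
  let s : Set Ω := (Set.range fun j => n₁ (X j)) ∪ (Set.range fun j => n₂ (X j)) ∪ {(n₁ r₁)⁻¹, (n₂ r₂)⁻¹}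
  have hs : s.Finite := ((Set.finite_range _).union (Set.finite_range _)).union (by simp)
  let D := Algebra.adjoin F s
  have : Algebra.FiniteType F D := (Subalgebra.fg_iff_finiteType _).1 (Subalgebra.fg_def.2 ⟨s, hs, rfl⟩)
  obtain ⟨I, hI⟩ := Ideal.exists_maximal D
  let : Field (D ⧸ I) := Ideal.Quotient.field I
  have : Algebra.FiniteType F (D ⧸ I) := inferInstance
  have hfin := finite_of_finite_type_of_isJacobsonRing F (D ⧸ I)
  have hIntegral : Algebra.IsIntegral F (D ⧸ I) := Algebra.IsIntegral.of_finite F _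
  have hbij : Function.Bijective (algebraMap F (D ⧸ I)) := IsAlgClosed.algebraMap_bijective_of_isIntegral
  let e := (AlgEquiv.ofBijective (Algebra.ofId F (D ⧸ I)) hbij).symm
  let ev : D →ₐ[F] F := e.toAlgHom.comp (Ideal.Quotient.mkₐ F I)
  have mem₁ : ∀ p, n₁ p ∈ D := by
    intro p
    have : n₁ p = aeval (fun j => n₁ (X j)) p := by
      exact congrArg (fun f => f p) (MvPolynomial.aeval_unique n₁)
    rw [this]
    have h : (aeval (fun j => n₁ (X j)) p) ∈ Algebra.adjoin F (Set.range fun j => n₁ (X j)) := by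
      rw [Algebra.adjoin_range_eq_range_aeval]; exact ⟨p, rfl⟩
    exact Algebra.adjoin_mono (fun x hx => Or.inl (Or.inl hx)) h
  have mem₂ : ∀ p, n₂ p ∈ D := by
    intro p
    have : n₂ p = aeval (fun j => n₂ (X j)) p := by
      exact congrArg (fun f => f p) (MvPolynomial.aeval_unique n₂)
    rw [this]
    have h : (aeval (fun j => n₂ (X j)) p) ∈ Algebra.adjoin F (Set.range fun j => n₂ (X j)) := by
      rw [Algebra.adjoin_range_eq_range_aeval]; exact ⟨p, rfl⟩
    exact Algebra.adjoin_mono (fun x hx => Or.inl (Or.inr hx)) h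
  let k₁ : A →ₐ[F] D := n₁.codRestrict D mem₁
  let k₂ : A →ₐ[F] D := n₂.codRestrict D mem₂
  have hev₁ : ∀ p, ev (k₁ p) = eval (fun j => ev (k₁ (X j))) p := by
    intro p
    have := MvPolynomial.aeval_unique (ev.comp k₁)
    have h2 := congrArg (fun f => f p) this
    simp only [AlgHom.comp_apply] at h2
    rw [h2, ← MvPolynomial.coe_aeval_eq_eval]; rfl
  have hev₂ : ∀ p, ev (k₂ p) = eval (fun j => ev (k₂ (X j))) p := by
    intro p
    have := MvPolynomial.aeval_unique (ev.comp k₂)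
    have h2 := congrArg (fun f => f p) this
    simp only [AlgHom.comp_apply] at h2
    rw [h2, ← MvPolynomial.coe_aeval_eq_eval]; rfl
  refine ⟨fun j => ev (k₁ (X j)), fun j => ev (k₂ (X j)), ?_, ?_, ?_⟩
  · intro j
    rw [← hev₁, ← hev₂]
    congr 1
    exact Subtype.ext (hn j)
  · rw [← hev₁]
    have hinv : (n₁ r₁)⁻¹ ∈ D := Algebra.subset_adjoin (Or.inr (Or.inl rfl))
    have : k₁ r₁ * ⟨_, hinv⟩ = 1 := Subtype.ext (mul_inv_cancel₀ n₁r)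
    intro h0
    have h2 := congrArg ev this
    rw [map_mul, h0, zero_mul, map_one] at h2
    exact zero_ne_one h2
  · rw [← hev₂]
    have hinv : (n₂ r₂)⁻¹ ∈ D := Algebra.subset_adjoin (Or.inr (Or.inr rfl))
    have : k₂ r₂ * ⟨_, hinv⟩ = 1 := Subtype.ext (mul_inv_cancel₀ n₂r)
    intro h0
    have h2 := congrArg ev this
    rw [map_mul, h0, zero_mul, map_one] at h2
    exact zero_ne_one h2
end meet
end E8Proof

namespace E8Proof
set_option linter.unusedSectionVars false
open MvPolynomial

variable {F L : Type*} [Field F] [IsAlgClosed F] [CharZero F] [LieRing L] [LieAlgebra F L]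
  [FiniteDimensional F L] {ι : Type*} [Fintype ι] [DecidableEq ι]

/-- A weight basis adapted to a toral self-centralizing subalgebra. -/
structure TD (F L ι : Type*) [Field F] [LieRing L] [LieAlgebra F L] where
  β : Module.Basis ι F L
  I : Finset ι
  m : ι → ι → F
  hm : ∀ j ∈ I, ∀ i, ⁅β j, β i⁆ = m j i • β i
  h0 : ∀ j ∈ I, ∀ i ∈ I, m j i = 0
  reg : ∀ i, i ∉ I → ∃ j ∈ I, m j i ≠ 0
  nil : ∀ i, i ∉ I → IsNilpotent (LieAlgebra.ad F L (β i))

noncomputable def PV (B : Module.Basis ι F L) (φ : MvPolynomial ι F →ₗ[F] F) (P : ι → MvPolynomial ι F) : L :=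
  ∑ j, φ (P j) • B j

noncomputable def opP (B : Module.Basis ι F L) (T : Module.End F L) (P : ι → MvPolynomial ι F) :
    ι → MvPolynomial ι F := fun j => ∑ j', B.repr (T (B j')) j • P j'

lemma PV_op (B : Module.Basis ι F L) (φ : MvPolynomial ι F →ₗ[F] F) (T : Module.End F L)
    (P : ι → MvPolynomial ι F) : PV B φ (opP B T P) = T (PV B φ P) := by
  simp only [PV, opP, map_sum, map_smul, Finset.sum_smul]
  rw [Finset.sum_comm]
  refine Finset.sum_congr rfl fun j _ => ?_
  conv_rhs => rw [← B.sum_repr (T (B j)), Finset.smul_sum]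
  refine Finset.sum_congr rfl fun k _ => ?_
  rw [smul_smul, smul_eq_mul, mul_comm]

noncomputable def evL (a : ι → F) : MvPolynomial ι F →ₗ[F] F := (aeval a).toLinearMap
noncomputable def dL (k : ι) : MvPolynomial ι F →ₗ[F] F := (aeval (0 : ι → F)).toLinearMap ∘ₗ (pderiv k).toLinearMap

lemma evL_apply (a : ι → F) (p : MvPolynomial ι F) : evL a p = eval a p := by
  change aeval a p = _
  rw [← coe_aeval_eq_eval]; rfl
lemma dL_apply (k : ι) (p : MvPolynomial ι F) : dL k p = eval 0 (pderiv k p) := by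
  change aeval 0 (pderiv k p) = _
  rw [← coe_aeval_eq_eval]; rfl

namespace TD
variable (T : TD F L ι)

noncomputable def pt (c a : ι → F) : L := ∑ j ∈ T.I, (c j + a j) • T.β j

lemma poly (B : Module.Basis ι F L) (c : ι → F) (l : List ι) (hl : l.Nodup) (hI : ∀ i ∈ l, i ∉ T.I) :
    ∃ P : ι → MvPolynomial ι F, (∀ a, ∃ σ : lieAut F L, PV B (evL a) P = σ.1 (T.pt c a)) ∧
      PV B (evL 0) P = T.pt c 0 ∧ ∀ k, PV B (dL k) P = (if k ∈ T.I then T.β k else 0) +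
        (if k ∈ l then ⁅T.β k, T.pt c 0⁆ else 0) := by
  induction l with
  | nil =>
    let P : ι → MvPolynomial ι F := fun j => ∑ i ∈ T.I, B.repr (T.β i) j • (C (c i) + X i)
    have hP : ∀ φ : MvPolynomial ι F →ₗ[F] F, PV B φ P = ∑ i ∈ T.I, φ (C (c i) + X i) • T.β i := by
      intro φ
      simp only [PV, P, map_sum, map_smul, Finset.sum_smul]
      rw [Finset.sum_comm]
      refine Finset.sum_congr rfl fun i _ => ?_
      conv_rhs => rw [← B.sum_repr (T.β i), Finset.smul_sum]
      refine Finset.sum_congr rfl fun k _ => ?_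
      rw [smul_smul, smul_eq_mul, mul_comm]
    have hE : ∀ a, PV B (evL a) P = T.pt c a := by
      intro a
      rw [hP, pt]
      refine Finset.sum_congr rfl fun i _ => ?_
      rw [evL_apply]; simp
    refine ⟨P, fun a => ⟨1, hE a⟩, hE 0, fun k => ?_⟩
    rw [hP]
    simp only [dL_apply, map_add, pderiv_C, pderiv_X, zero_add, List.not_mem_nil, if_false, add_zero]
    rw [← Finset.sum_ite_eq T.I k]
    refine Finset.sum_congr rfl fun i _ => ?_
    by_cases h : k = i
    · subst h; simp
    · simp [h, Pi.single_apply]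
  | cons i l ih =>
    obtain ⟨P, h1, h2, h3⟩ := ih (List.nodup_cons.1 hl).2 (fun j hj => hI j (List.mem_cons_of_mem _ hj))
    obtain ⟨K, hK⟩ := T.nil i (hI i List.mem_cons_self)
    set A := LieAlgebra.ad F L (T.β i) with hA
    have hA2 : A ^ (K + 2) = 0 := by rw [pow_add, hK, zero_mul]
    let P' : ι → MvPolynomial ι F := fun j =>
      ∑ n ∈ Finset.range (K + 2), (n.factorial : F)⁻¹ • (X i ^ n * opP B (A ^ n) P j)
    have hev : ∀ a, PV B (evL a) P' = ∑ n ∈ Finset.range (K + 2), ((n.factorial : F)⁻¹ * a i ^ n) •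
        (A ^ n) (PV B (evL a) P) := by
      intro a
      simp only [← PV_op]
      simp only [PV, P', map_sum, map_smul, Finset.sum_smul]
      rw [Finset.sum_comm]
      refine Finset.sum_congr rfl fun n _ => ?_
      rw [Finset.smul_sum]
      refine Finset.sum_congr rfl fun j _ => ?_
      rw [smul_smul, smul_eq_mul, evL_apply, evL_apply, map_mul, map_pow, eval_X, mul_assoc]
    refine ⟨P', ?_, ?_, ?_⟩
    · intro a
      obtain ⟨σ, hσ⟩ := h1 a
      obtain ⟨τ, hτ⟩ := exp_exists (a i • A) (fun x y => by
        simp only [LinearMap.smul_apply, hA, LieAlgebra.ad_apply]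
        rw [leibniz_lie, smul_add, smul_lie, lie_smul]) (K + 2) (by rw [smul_pow, hA2, smul_zero])
      refine ⟨τ * σ, ?_⟩
      change _ = τ.1 (σ.1 _)
      rw [← hσ, hτ, hev]
      refine Finset.sum_congr rfl fun n _ => ?_
      rw [smul_pow, LinearMap.smul_apply, smul_smul]
    · rw [hev, ← h2, Finset.sum_range_succ', Finset.sum_eq_zero]
      · simp
      · intro n _; simp
    · intro k
      have hd : ∀ j, dL k (P' j) = dL k (opP B (A ^ 0) P j) + if k = i then evL 0 (opP B (A ^ 1) P j) else 0 := by
        intro j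
        simp only [P', map_sum, map_smul]
        rw [Finset.sum_range_succ', Finset.sum_range_succ', Finset.sum_eq_zero]
        · rw [zero_add, add_comm]
          congr 1
          · simp
          · simp only [dL_apply, evL_apply, zero_add, pow_one, pderiv_mul, pderiv_X, map_add, map_mul, eval_X]
            by_cases h : k = i
            · subst h; simp
            · simp [h, Pi.single_apply, Ne.symm h]
        · intro n _
          simp [dL_apply, pderiv_mul, pderiv_pow]
      have hd2 : PV B (dL k) P' = PV B (dL k) (opP B (A ^ 0) P) +
          if k = i then PV B (evL 0) (opP B (A ^ 1) P) else 0 := by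
        simp only [PV, hd, add_smul, Finset.sum_add_distrib]
        split_ifs <;> simp
      rw [hd2, PV_op, PV_op, pow_zero, pow_one, Module.End.one_apply, h3, h2]
      have hil := (List.nodup_cons.1 hl).1
      by_cases h : k = i
      · subst h
        simp [hil, hA]
      · simp [h]

lemma exists_reg : ∃ c : ι → F, ∀ i, i ∉ T.I → ∑ j ∈ T.I, c j * T.m j i ≠ 0 := by
  let f : {i // i ∉ T.I} → Module.Dual F (ι → F) := fun i => ∑ j ∈ T.I, T.m j i.1 • LinearMap.proj j
  obtain ⟨c, hc⟩ := Module.Dual.exists_forall_ne_zero_of_forall_exists f (fun i => by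
    obtain ⟨j, hj, hne⟩ := T.reg i.1 i.2
    refine ⟨Pi.single j 1, ?_⟩
    simp [f, LinearMap.sum_apply, Pi.single_apply, hj, hne])
  refine ⟨c, fun i hi => ?_⟩
  have := hc ⟨i, hi⟩
  simpa [f, LinearMap.sum_apply, mul_comm] using this

noncomputable def H : Submodule F L := Submodule.span F (T.β '' T.I)

lemma pt_lie (c a : ι → F) (i : ι) : ⁅T.pt c a, T.β i⁆ = (∑ j ∈ T.I, (c j + a j) * T.m j i) • T.β i := by
  rw [pt, sum_lie, Finset.sum_smul]
  refine Finset.sum_congr rfl fun j hj => ?_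
  rw [smul_lie, T.hm j hj, smul_smul]

lemma centralizer (h : L) (w : ι → F) (hw : ∀ i, ⁅h, T.β i⁆ = w i • T.β i) (h0 : ∀ i ∈ T.I, w i = 0)
    (h1 : ∀ i, i ∉ T.I → w i ≠ 0) (x : L) : x ∈ T.H ↔ ⁅h, x⁆ = 0 := by
  have hx : ⁅h, x⁆ = ∑ i, (T.β.repr x i * w i) • T.β i := by
    conv_lhs => rw [← T.β.sum_repr x, lie_sum]
    refine Finset.sum_congr rfl fun i _ => ?_
    rw [lie_smul, hw, smul_smul]
  rw [hx, H, Module.Basis.mem_span_image]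
  constructor
  · intro hs
    apply Finset.sum_eq_zero
    intro i _
    by_cases hi : i ∈ T.I
    · rw [h0 i hi, mul_zero, zero_smul]
    · have : T.β.repr x i = 0 := by
        by_contra hne
        exact hi (hs (Finset.mem_coe.2 (Finsupp.mem_support_iff.2 hne)))
      rw [this, zero_mul, zero_smul]
  · intro hs i hi
    by_contra hI
    have := Fintype.linearIndependent_iff.1 T.β.linearIndependent _ hs i
    rcases mul_eq_zero.1 this with h | h
    · exact Finsupp.mem_support_iff.1 (Finset.mem_coe.1 hi) h
    · exact h1 i (fun h => hI (Finset.mem_coe.2 h)) h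

lemma setup (B : Module.Basis ι F L) : ∃ (P : ι → MvPolynomial ι F) (r : MvPolynomial ι F), r ≠ 0 ∧
    (Matrix.of fun j k => eval 0 (pderiv k (P j))).det ≠ 0 ∧
    ∀ a, eval a r ≠ 0 → ∃ σ : lieAut F L, ∃ h : L, PV B (evL a) P = σ.1 h ∧ ∀ x, x ∈ T.H ↔ ⁅h, x⁆ = 0 := by
  obtain ⟨c, hc⟩ := T.exists_reg
  obtain ⟨P, h1, h2, h3⟩ := T.poly B c ((Finset.univ.filter (· ∉ T.I)).toList) (Finset.nodup_toList _) (by simp)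
  let r : MvPolynomial ι F := ∏ i ∈ Finset.univ.filter (· ∉ T.I), ∑ j ∈ T.I, (C (c j) + X j) * C (T.m j i)
  have hr : ∀ a, eval a r = ∏ i ∈ Finset.univ.filter (· ∉ T.I), ∑ j ∈ T.I, (c j + a j) * T.m j i := by
    intro a
    simp [r, map_prod, map_sum]
  refine ⟨P, r, ?_, ?_, ?_⟩
  · intro h
    have := hr 0
    rw [h, map_zero] at this
    have := (Finset.prod_eq_zero_iff).1 this.symm
    obtain ⟨i, hi, hi2⟩ := this
    simp only [Pi.zero_apply, add_zero] at hi2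
    exact hc i (by simpa using hi) hi2
  · let u : ι → Fˣ := fun k => if hk : k ∈ T.I then 1 else Units.mk0 (-(∑ j ∈ T.I, c j * T.m j k))
      (neg_ne_zero.2 (hc k hk))
    let v := T.β.unitsSMul u
    have hv : ∀ k, PV B (dL k) P = v k := by
      intro k
      rw [h3, Module.Basis.unitsSMul_apply]
      by_cases hk : k ∈ T.I
      · simp [hk, u]
      · have : ⁅T.β k, T.pt c 0⁆ = -⁅T.pt c 0, T.β k⁆ := (lie_skew _ _).symm
        rw [pt_lie] at this
        simp only [Pi.zero_apply, add_zero] at this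
        simp [hk, u, this, Units.smul_def]
    have hdet := B.isUnit_det v
    rw [Module.Basis.det_apply] at hdet
    have e : (Matrix.of fun j k => eval 0 (pderiv k (P j))) = B.toMatrix v := by
      ext j k
      rw [Module.Basis.toMatrix_apply, ← hv, PV, Module.Basis.repr_sum_self, dL_apply]; rfl
    rw [e]
    exact hdet.ne_zero
  · intro a ha
    obtain ⟨σ, hσ⟩ := h1 a
    refine ⟨σ, T.pt c a, hσ, ?_⟩
    apply T.centralizer _ _ (fun i => T.pt_lie c a i)
    · intro i hi
      exact Finset.sum_eq_zero fun j hj => by rw [T.h0 j hj i hi, mul_zero]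
    · intro i hi h
      apply ha
      rw [hr]
      exact Finset.prod_eq_zero (i := i) (by simpa using hi) h

theorem conj (T₁ T₂ : TD F L ι) : ∃ σ : lieAut F L, ∀ x, x ∈ T₁.H ↔ σ.1 x ∈ T₂.H := by
  obtain ⟨P₁, r₁, hr₁, hd₁, hP₁⟩ := T₁.setup T₁.β
  obtain ⟨P₂, r₂, hr₂, hd₂, hP₂⟩ := T₂.setup T₁.β
  obtain ⟨a₁, a₂, he, ha₁, ha₂⟩ := meet P₁ P₂ hd₁ hd₂ r₁ r₂ hr₁ hr₂
  obtain ⟨σ₁, x₁, e₁, c₁⟩ := hP₁ a₁ ha₁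
  obtain ⟨σ₂, x₂, e₂, c₂⟩ := hP₂ a₂ ha₂
  have h : σ₁.1 x₁ = σ₂.1 x₂ := by
    rw [← e₁, ← e₂, PV, PV]
    exact Finset.sum_congr rfl fun j _ => by rw [evL_apply, evL_apply, he]
  have h' : (σ₂⁻¹ * σ₁).1 x₁ = x₂ := by
    change σ₂.1.symm (σ₁.1 x₁) = x₂
    rw [h, LinearEquiv.symm_apply_apply]
  refine ⟨σ₂⁻¹ * σ₁, fun x => ?_⟩
  rw [c₁, c₂, ← h', ← (σ₂⁻¹ * σ₁).2, LinearEquiv.map_eq_zero_iff]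

end TD
end E8Proof

namespace E8Proof
set_option linter.unusedSectionVars false

variable {F L : Type*} [Field F] [IsAlgClosed F] [CharZero F] [LieRing L] [LieAlgebra F L]
  [FiniteDimensional F L]

lemma nil_of_eig {h x : L} {c : F} (hss : (LieAlgebra.ad F L h).IsSemisimple) (hx : ⁅h, x⁆ = c • x) (hc : c ≠ 0) :
    IsNilpotent (LieAlgebra.ad F L x) := by
  rw [Module.End.isNilpotent_iff_of_finite]
  intro y
  have hy := diag_span _ hss (show y ∈ ⊤ from trivial)
  induction hy using Submodule.span_induction with
  | mem y hy =>
    obtain ⟨d, hd⟩ := hy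
    by_contra hcon
    push Not at hcon
    have hw : ∀ k : ℕ, ⁅h, (LieAlgebra.ad F L x ^ k) y⁆ = (d + k * c) • (LieAlgebra.ad F L x ^ k) y := by
      intro k
      induction k with
      | zero => simpa using hd
      | succ k ih =>
        rw [pow_succ', Module.End.mul_apply, LieAlgebra.ad_apply, leibniz_lie, hx, ih, smul_lie, lie_smul, ← add_smul]
        congr 1; push_cast; ring
    have hev : ∀ k : ℕ, (LieAlgebra.ad F L h).HasEigenvalue (d + k * c) := fun k =>
      Module.End.hasEigenvalue_of_hasEigenvector ⟨Module.End.mem_eigenspace_iff.2 (hw k), hcon k⟩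
    have hinj : Function.Injective (fun k : ℕ => d + k * c) := by
      intro a b hab
      have : (a : F) * c = b * c := add_left_cancel hab
      exact_mod_cast mul_right_cancel₀ hc this
    have hfin : Set.Finite {d : F | (LieAlgebra.ad F L h).HasEigenvalue d} :=
      Module.End.finite_hasEigenvalue (LieAlgebra.ad F L h)
    exact Set.infinite_of_injective_forall_mem hinj hev hfin
  | zero => exact ⟨0, by simp⟩
  | add a b _ _ ha hb =>
    obtain ⟨n, hn⟩ := ha
    obtain ⟨m, hm⟩ := hb
    refine ⟨n + m, ?_⟩
    rw [map_add]
    conv_lhs => enter [1]; rw [add_comm n m]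
    rw [pow_add, pow_add, Module.End.mul_apply, Module.End.mul_apply, hn, hm]
    simp
  | smul a b _ hb =>
    obtain ⟨n, hn⟩ := hb
    exact ⟨n, by rw [map_smul, hn, smul_zero]⟩

lemma exists_TD (t : Submodule F L) (hab : ∀ x ∈ t, ∀ y ∈ t, ⁅x, y⁆ = 0)
    (hss : ∀ x ∈ t, (LieAlgebra.ad F L x).IsSemisimple) (hself : ∀ y, (∀ x ∈ t, ⁅x, y⁆ = 0) → y ∈ t) :
    ∃ T : TD F L (Fin (Module.finrank F L)), T.H = t := by
  classical
  let E : Set L := {x | ∃ c : t → F, ∀ h : t, ⁅h.1, x⁆ = c h • x}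
  have hE : ⊤ ≤ Submodule.span F E := by
    have := homog_span (fun h : t => LieAlgebra.ad F L h.1) (fun i j => by
      apply LinearMap.ext
      intro y
      simp only [Module.End.mul_apply, LieAlgebra.ad_apply]
      rw [leibniz_lie, hab _ i.2 _ j.2, zero_lie, zero_add]) (fun h => hss _ h.2) ⊤ (fun _ _ _ => trivial)
    refine this.trans (Submodule.span_mono ?_)
    rintro x ⟨-, c, hc⟩
    exact ⟨c, hc⟩
  have htE : (t : Set L) ⊆ E := fun x hx => ⟨0, fun h => by rw [hab _ h.2 _ hx]; simp⟩
  obtain ⟨s, hst, hts, hs⟩ := exists_linearIndependent F (t : Set L)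
  obtain ⟨b, hbE, hsb, hEb, hb⟩ := exists_linearIndepOn_id_extension (K := F) (s := s) (t := E) hs (hst.trans htE)
  have hspan : Submodule.span F s = t := by rw [hts, Submodule.span_eq]
  let B0 : Module.Basis b F L := Module.Basis.mk hb (by
    have hr : (Set.range fun x : b => id (x : L)) = b := Subtype.range_coe
    rw [hr]
    exact hE.trans (Submodule.span_le.2 hEb))
  have hB0 : ∀ i, B0 i = i.1 := fun i => by simp [B0]
  haveI : Finite b := Module.Finite.finite_basis B0
  haveI : Fintype b := Fintype.ofFinite b
  let e : b ≃ Fin (Module.finrank F L) := Fintype.equivFinOfCardEq (Module.finrank_eq_card_basis B0).symm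
  have hch : ∀ i : b, ∃ c : t → F, ∀ h : t, ⁅h.1, i.1⁆ = c h • i.1 := fun i => hbE i.2
  choose w hw using hch
  let β := B0.reindex e
  have hβ : ∀ k, β k = (e.symm k).1 := fun k => by rw [Module.Basis.reindex_apply, hB0]
  let I : Finset (Fin (Module.finrank F L)) := Finset.univ.filter fun k => (e.symm k).1 ∈ s
  have hI : ∀ k, k ∈ I ↔ β k ∈ s := fun k => by simp [I, hβ]
  have himg : β '' I = s := by
    ext x
    constructor
    · rintro ⟨k, hk, rfl⟩; exact (hI k).1 (Finset.mem_coe.1 hk)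
    · intro hx
      have : β (e ⟨x, hsb hx⟩) = x := by rw [hβ]; simp
      exact ⟨e ⟨x, hsb hx⟩, Finset.mem_coe.2 ((hI _).2 (by rw [this]; exact hx)), this⟩
  have hIt : ∀ k ∈ I, β k ∈ t := fun k hk => hst ((hI k).1 hk)
  let m : Fin (Module.finrank F L) → Fin (Module.finrank F L) → F := fun j i =>
    if h : β j ∈ t then w (e.symm i) ⟨β j, h⟩ else 0
  have hm : ∀ j ∈ I, ∀ i, ⁅β j, β i⁆ = m j i • β i := by
    intro j hj i
    simp only [m, dif_pos (hIt j hj)]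
    have := hw (e.symm i) ⟨β j, hIt j hj⟩
    rw [hβ i]; exact this
  have hreg : ∀ i, i ∉ I → ∃ j ∈ I, m j i ≠ 0 := by
    intro i hi
    by_contra hcon
    push Not at hcon
    have h1 : β i ∈ t := by
      apply hself
      intro x hx
      rw [← hspan, ← himg] at hx
      induction hx using Submodule.span_induction with
      | mem x hx =>
        obtain ⟨j, hj, rfl⟩ := hx
        rw [hm j hj, hcon j hj, zero_smul]
      | zero => simp
      | add a b _ _ ha hb => rw [add_lie, ha, hb, add_zero]
      | smul a b _ hb => rw [smul_lie, hb, smul_zero]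
    rw [← hspan, ← himg, Module.Basis.mem_span_image] at h1
    apply hi
    apply h1
    simp
  refine ⟨⟨β, I, m, hm, ?_, hreg, ?_⟩, ?_⟩
  · intro j hj i hi
    have := hm j hj i
    rw [hab _ (hIt j hj) _ (hIt i hi)] at this
    exact (smul_eq_zero.1 this.symm).resolve_right (β.ne_zero i)
  · intro i hi
    obtain ⟨j, hj, hne⟩ := hreg i hi
    exact nil_of_eig (hss _ (hIt j hj)) (hm j hj i) hne
  · change Submodule.span F (β '' I) = t
    rw [himg, hspan]

/-- conjugacy of toral self-centralizing subspaces -/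
theorem torus_conj (t₁ t₂ : Submodule F L) (hab : ∀ x ∈ t₁, ∀ y ∈ t₁, ⁅x, y⁆ = 0)
    (hss : ∀ x ∈ t₁, (LieAlgebra.ad F L x).IsSemisimple) (hself : ∀ y, (∀ x ∈ t₁, ⁅x, y⁆ = 0) → y ∈ t₁)
    (hab' : ∀ x ∈ t₂, ∀ y ∈ t₂, ⁅x, y⁆ = 0)
    (hss' : ∀ x ∈ t₂, (LieAlgebra.ad F L x).IsSemisimple) (hself' : ∀ y, (∀ x ∈ t₂, ⁅x, y⁆ = 0) → y ∈ t₂) :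
    ∃ σ : lieAut F L, ∀ x, x ∈ t₁ ↔ σ.1 x ∈ t₂ := by
  obtain ⟨T₁, rfl⟩ := exists_TD t₁ hab hss hself
  obtain ⟨T₂, rfl⟩ := exists_TD t₂ hab' hss' hself'
  exact TD.conj T₁ T₂

end E8Proof

namespace E8Proof
set_option linter.unusedSectionVars false

lemma num_lemma (n : ℕ) (hn : 0 < n) (j k : ℕ) : ∃ m m' : ℕ, n ∣ (k + m * j) * m' + j := by
  wlog hj : 0 < j generalizing j
  · have hj0 : j = 0 := by omega
    exact ⟨0, 0, by simp [hj0]⟩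
  have : NeZero n := ⟨hn.ne'⟩
  obtain ⟨g, j', k', hg, hco, e1, e2⟩ := Nat.exists_coprime' (m := j) (n := k) (Nat.gcd_pos_of_pos_left k hj)
  have hj' : 0 < j' := by
    rcases Nat.eq_zero_or_pos j' with h | h
    · subst h; omega
    · exact h
  have : NeZero (j' * n) := ⟨(Nat.mul_pos hj' hn).ne'⟩
  obtain ⟨u, hu⟩ := ZMod.unitsMap_surjective (n := j') (m := j' * n) (Dvd.intro _ rfl) (ZMod.unitOfCoprime k' hco.symm)
  have hU : Nat.Coprime (u : ZMod (j' * n)).val (j' * n) := ZMod.val_coe_unit_coprime u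
  set U := (u : ZMod (j' * n)).val with hUdef
  have hmod : ((U : ℕ) : ZMod j') = (k' : ZMod j') := by
    have h1 := congrArg Units.val hu
    rw [ZMod.coe_unitOfCoprime, ZMod.unitsMap_def, Units.coe_map] at h1
    rw [← h1, hUdef]
    change _ = ZMod.castHom (Dvd.intro _ rfl : j' ∣ j' * n) (ZMod j') (u : ZMod (j' * n))
    conv_rhs => rw [← ZMod.natCast_zmod_val (u : ZMod (j' * n))]
    simp
  have hmod2 : k' ≡ U + j' * n * k' [MOD j'] := by
    rw [← ZMod.natCast_eq_natCast_iff]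
    push_cast
    rw [hmod]; simp
  have hle : k' ≤ U + j' * n * k' := by
    have : 1 * k' ≤ j' * n * k' := Nat.mul_le_mul_right _ (Nat.mul_pos hj' hn)
    omega
  obtain ⟨m, hm⟩ := (Nat.modEq_iff_dvd' hle).1 hmod2
  have hcop : Nat.Coprime (k' + m * j') n := by
    have e : k' + m * j' = U + n * (j' * k') := by
      have : U + j' * n * k' = k' + j' * m := by omega
      rw [show U + n * (j' * k') = U + j' * n * k' by ring, this]; ring
    rw [e, Nat.coprime_add_mul_left_left]
    exact Nat.Coprime.coprime_mul_left_right hU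
  let v := ZMod.unitOfCoprime _ hcop
  refine ⟨m, (-(j' : ZMod n) * (v⁻¹ : (ZMod n)ˣ)).val, ?_⟩
  rw [← ZMod.natCast_eq_zero_iff]
  push_cast
  rw [ZMod.natCast_zmod_val, e1, e2]
  have hv : ((k' : ZMod n) + m * j') * (v⁻¹ : (ZMod n)ˣ) = 1 := by
    have := Units.mul_inv v
    rw [ZMod.coe_unitOfCoprime] at this
    push_cast at this
    exact this
  push_cast
  linear_combination (-(j' : ZMod n) * g) * hv

variable {F L : Type*} [Field F] [IsAlgClosed F] [CharZero F] [LieRing L] [LieAlgebra F L]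
  [FiniteDimensional F L]

lemma ss_ker {T : Module.End F L} (hT : T.IsSemisimple) (k : ℕ) (v : L) (h : (T ^ k) v = 0) : T v = 0 := by
  have h1 : v ∈ T.maxGenEigenspace 0 := by
    rw [Module.End.mem_maxGenEigenspace]
    exact ⟨k, by simpa using h⟩
  rw [hT.isFinitelySemisimple.maxGenEigenspace_eq_eigenspace, Module.End.mem_eigenspace_iff] at h1
  simpa using h1

lemma lie_comm_zero {x y : L} (h : ⁅x, y⁆ = 0) : ⁅y, x⁆ = 0 := by rw [← lie_skew, h, neg_zero]

lemma ad_commute {x y : L} (h : ⁅x, y⁆ = 0) : Commute (LieAlgebra.ad F L x) (LieAlgebra.ad F L y) := by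
  apply LinearMap.ext
  intro z
  simp only [Module.End.mul_apply, LieAlgebra.ad_apply]
  rw [leibniz_lie, h, zero_lie, zero_add]

lemma ss_add {x y : L} (h : ⁅x, y⁆ = 0) (hx : (LieAlgebra.ad F L x).IsSemisimple)
    (hy : (LieAlgebra.ad F L y).IsSemisimple) : (LieAlgebra.ad F L (x + y)).IsSemisimple := by
  rw [map_add]
  exact Module.End.IsSemisimple.add_of_commute (ad_commute h) hx hy

lemma ss_smul {x : L} (c : F) (hx : (LieAlgebra.ad F L x).IsSemisimple) :
    (LieAlgebra.ad F L (c • x)).IsSemisimple := by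
  rw [map_smul]
  exact Module.End.IsSemisimple_smul c hx

variable {Q : Subgroup (lieAut F L)}

structure Good (Q : Subgroup (lieAut F L)) (θ : lieAut F L) (t : Submodule F L) : Prop where
  st : ∀ q ∈ Q, ∀ x ∈ t, q.1 x ∈ t
  ab : ∀ x ∈ t, ∀ y ∈ t, ⁅x, y⁆ = 0
  ss : ∀ x ∈ t, (LieAlgebra.ad F L x).IsSemisimple
  fx : ∀ x ∈ t, θ.1 x = x

theorem torus_exists [LieAlgebra.IsKilling F L] (hQ : IsMaximalFiniteAbelian Q) {θ : lieAut F L} (hθ : θ ∈ Q) :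
    ∃ t : Submodule F L, (∀ q ∈ Q, ∀ x ∈ t, q.1 x ∈ t) ∧ (∀ x ∈ t, ∀ y ∈ t, ⁅x, y⁆ = 0) ∧
      (∀ x ∈ t, (LieAlgebra.ad F L x).IsSemisimple) ∧
      (∀ y, (∀ x ∈ t, θ.1 x = x → ⁅x, y⁆ = 0) → y ∈ t) := by
  have hbot : Good Q θ (⊥ : Submodule F L) := by
    refine ⟨?_, ?_, ?_, ?_⟩
    · intro q _ x hx; rw [Submodule.mem_bot] at hx ⊢; rw [hx, map_zero]
    · intro x hx y _; rw [Submodule.mem_bot] at hx; rw [hx, zero_lie]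
    · intro x hx; rw [Submodule.mem_bot] at hx; rw [hx, map_zero]; exact Module.End.isSemisimple_zero
    · intro x hx; rw [Submodule.mem_bot] at hx; rw [hx, map_zero]
  obtain ⟨t0, ht0, hmax⟩ := (wellFounded_gt (α := Submodule F L)).has_min {t | Good Q θ t} ⟨⊥, hbot⟩
  have ht0 : Good Q θ t0 := ht0
  let C : Submodule F L :=
    { carrier := {y | ∀ x ∈ t0, ⁅x, y⁆ = 0}
      add_mem' := fun {a b} ha hb x hx => by rw [lie_add, ha x hx, hb x hx, add_zero]
      zero_mem' := fun x _ => lie_zero x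
      smul_mem' := fun c a ha x hx => by rw [lie_smul, ha x hx, smul_zero] }
  have hC : ∀ y, y ∈ C ↔ ∀ x ∈ t0, ⁅x, y⁆ = 0 := fun y => Iff.rfl
  have ht0C : t0 ≤ C := fun y hy x hx => ht0.ab x hx y hy
  have hCst : ∀ q ∈ Q, ∀ x ∈ C, q.1 x ∈ C := by
    intro q hq x hx y hy
    have h1 : q.1.symm y ∈ t0 := ht0.st q⁻¹ (Q.inv_mem hq) y hy
    have h2 := hx _ h1
    have h3 := q.2 (q.1.symm y) x
    rw [h2, map_zero, LinearEquiv.apply_symm_apply] at h3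
    exact h3.symm
  have hClie : ∀ x ∈ C, ∀ y ∈ C, ⁅x, y⁆ ∈ C := by
    intro x hx y hy z hz
    rw [leibniz_lie, hx z hz, hy z hz, zero_lie, lie_zero, add_zero]
  have claimA : ∀ y ∈ C, θ.1 y = y → y ∈ t0 := by
    let p : Submodule F L :=
      { carrier := {y | y ∈ C ∧ θ.1 y = y}
        add_mem' := fun {a b} ha hb => ⟨C.add_mem ha.1 hb.1, by rw [map_add, ha.2, hb.2]⟩
        zero_mem' := ⟨C.zero_mem, map_zero _⟩
        smul_mem' := fun c a ha => ⟨C.smul_mem c ha.1, by rw [map_smul, ha.2]⟩ }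
    have hp : ∀ q ∈ Q, ∀ x ∈ p, q.1 x ∈ p := by
      intro q hq x hx
      refine ⟨hCst q hq x hx.1, ?_⟩
      have := hQ.2.1 θ q hθ hq
      have h2 : θ.1 (q.1 x) = q.1 (θ.1 x) := LinearEquiv.congr_fun (congrArg Subtype.val this) x
      rw [h2, hx.2]
    have hle : p ≤ t0 := by
      refine (Hg_span hQ p hp).trans (Submodule.span_le.2 ?_)
      rintro y ⟨⟨hyC, hyθ⟩, hyH⟩
      have hg : Good Q θ (t0 ⊔ Submodule.span F {y}) := by
        have hyy : ∀ x ∈ t0 ⊔ Submodule.span F {y}, ∃ a ∈ t0, ∃ c : F, x = a + c • y := by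
          intro x hx
          obtain ⟨a, ha, b, hb, rfl⟩ := Submodule.mem_sup.1 hx
          obtain ⟨c, rfl⟩ := Submodule.mem_span_singleton.1 hb
          exact ⟨a, ha, c, rfl⟩
        refine ⟨?_, ?_, ?_, ?_⟩
        · intro q hq x hx
          obtain ⟨a, ha, c, rfl⟩ := hyy x hx
          obtain ⟨d, hd⟩ := hyH q hq
          rw [map_add, map_smul, hd, smul_smul]
          exact Submodule.add_mem_sup (ht0.st q hq a ha) (Submodule.smul_mem _ _ (Submodule.mem_span_singleton_self y))
        · intro x hx z hz
          obtain ⟨a, ha, c, rfl⟩ := hyy x hx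
          obtain ⟨b, hb, d, rfl⟩ := hyy z hz
          simp only [add_lie, lie_add, smul_lie, lie_smul, lie_self, ht0.ab a ha b hb, hyC a ha, lie_comm_zero (hyC b hb)]
          simp
        · intro x hx
          obtain ⟨a, ha, c, rfl⟩ := hyy x hx
          exact ss_add (by rw [lie_smul, hyC a ha, smul_zero]) (ht0.ss a ha) (ss_smul c (hyH.ss hQ))
        · intro x hx
          obtain ⟨a, ha, c, rfl⟩ := hyy x hx
          rw [map_add, map_smul, ht0.fx a ha, hyθ]
      have := hmax _ hg
      by_contra hy
      apply this
      refine lt_of_le_of_ne le_sup_left fun heq => hy ?_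
      change y ∈ t0
      rw [heq]
      exact Submodule.mem_sup_right (Submodule.mem_span_singleton_self y)
    exact fun y h1 h2 => hle ⟨h1, h2⟩
  obtain ⟨n, hn, hn2⟩ := exists_pow hQ hθ
  have : NeZero n := ⟨hn.ne'⟩
  have : NeZero (n : F) := ⟨by exact_mod_cast hn.ne'⟩
  obtain ⟨ζ, hζ⟩ := HasEnoughRootsOfUnity.exists_primitiveRoot F n
  have heig : ∀ x, x ≠ 0 → ∀ c : F, θ.1 x = c • x → ∃ j : ℕ, c = ζ ^ j := by
    intro x hx c hc
    have h1 : ∀ k : ℕ, (fun z => θ.1 z)^[k] x = c ^ k • x := by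
      intro k
      induction k with
      | zero => simp
      | succ k ih => rw [Function.iterate_succ_apply', ih, map_smul, hc, smul_smul, pow_succ]
    have h2 := hn2 x
    rw [h1] at h2
    have h3 : c ^ n = 1 := by
      have : (c ^ n - 1) • x = 0 := by rw [sub_smul, h2, one_smul, sub_self]
      exact sub_eq_zero.1 ((smul_eq_zero.1 this).resolve_right hx)
    obtain ⟨i, -, hi⟩ := hζ.eq_pow_of_pow_eq_one h3
    exact ⟨i, hi.symm⟩
  have hadC : ∀ x ∈ C, ∀ y ∈ C, ∀ m : ℕ, (LieAlgebra.ad F L x ^ m) y ∈ C := by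
    intro x hx y hy m
    induction m with
    | zero => simpa using hy
    | succ m ih => rw [pow_succ', Module.End.mul_apply, LieAlgebra.ad_apply]; exact hClie _ hx _ ih
  have hadθ : ∀ x y (a b : F), θ.1 x = a • x → θ.1 y = b • y → ∀ m : ℕ,
      θ.1 ((LieAlgebra.ad F L x ^ m) y) = (b * a ^ m) • (LieAlgebra.ad F L x ^ m) y := by
    intro x y a b ha hb m
    induction m with
    | zero => simpa using hb
    | succ m ih =>
      rw [pow_succ', Module.End.mul_apply, LieAlgebra.ad_apply, θ.2, ha, ih, smul_lie, lie_smul, smul_smul]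
      congr 1; ring
  have claimB : ∀ x ∈ C, Hg Q x → ∀ y ∈ C, Hg Q y → ⁅x, y⁆ = 0 := by
    intro x hx hxH y hy hyH
    by_cases hx0 : x = 0
    · rw [hx0, zero_lie]
    by_cases hy0 : y = 0
    · rw [hy0, lie_zero]
    obtain ⟨a, ha⟩ := hxH θ hθ
    obtain ⟨b, hb⟩ := hyH θ hθ
    obtain ⟨j, rfl⟩ := heig x hx0 a ha
    obtain ⟨k, rfl⟩ := heig y hy0 b hb
    obtain ⟨m, m', hmm⟩ := num_lemma n hn j k
    set z := (LieAlgebra.ad F L x ^ m) y with hz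
    have hzC : z ∈ C := hadC x hx y hy m
    have hzH : Hg Q z := hxH.ad_pow hyH m
    have hzθ := hadθ x y _ _ ha hb m
    rw [← hz] at hzθ
    have hw := hadθ z x _ _ hzθ ha m'
    have h1 : ζ ^ j * (ζ ^ k * (ζ ^ j) ^ m) ^ m' = 1 := by
      rw [← pow_mul, ← pow_add, ← pow_mul, ← pow_add, hζ.pow_eq_one_iff_dvd]
      convert hmm using 1
      ring
    rw [h1, one_smul] at hw
    have hwt := claimA _ (hadC z hzC x hx m') hw
    have h2 : (LieAlgebra.ad F L z ^ (m' + 1)) x = 0 := by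
      rw [pow_succ', Module.End.mul_apply, LieAlgebra.ad_apply]
      exact lie_comm_zero (hzC _ hwt)
    have h3 := ss_ker (hzH.ss hQ) _ _ h2
    rw [LieAlgebra.ad_apply] at h3
    have h4 : (LieAlgebra.ad F L x ^ (m + 1)) y = 0 := by
      rw [pow_succ', Module.End.mul_apply, LieAlgebra.ad_apply]
      exact lie_comm_zero h3
    exact ss_ker (hxH.ss hQ) _ _ h4
  have hsp := Hg_span hQ C hCst
  have hCab : ∀ x ∈ C, ∀ y ∈ C, ⁅x, y⁆ = 0 := by
    intro x hx y hy
    have hx' := hsp hx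
    have hy' := hsp hy
    clear hx hy
    induction hx' using Submodule.span_induction with
    | mem x hx =>
      induction hy' using Submodule.span_induction with
      | mem y hy => exact claimB x hx.1 hx.2 y hy.1 hy.2
      | zero => simp
      | add a b _ _ ha hb => rw [lie_add, ha, hb, add_zero]
      | smul a b _ hb => rw [lie_smul, hb, smul_zero]
    | zero => simp
    | add a b _ _ ha hb => rw [add_lie, ha, hb, add_zero]
    | smul a b _ hb => rw [smul_lie, hb, smul_zero]
  have hspC : Submodule.span F {x | x ∈ C ∧ Hg Q x} ≤ C := Submodule.span_le.2 fun x hx => hx.1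
  refine ⟨C, hCst, hCab, ?_, ?_⟩
  · intro x hx
    have hx' := hsp hx
    clear hx
    induction hx' using Submodule.span_induction with
    | mem x hx => exact hx.2.ss hQ
    | zero => rw [map_zero]; exact Module.End.isSemisimple_zero
    | add a b ha hb ha' hb' => exact ss_add (hCab _ (hspC ha) _ (hspC hb)) ha' hb'
    | smul a b _ hb => exact ss_smul a hb
  · intro y hy x hx
    exact hy x (ht0C hx) (ht0.fx x hx)

end E8Proof

namespace E8Proof
set_option linter.unusedSectionVars false

lemma generic_vec (s : Finset Lam) (f : Lam → (Lam →ₗ[ℤ] ℤ)) (h : ∀ a ∈ s, ∃ u, f a u ≠ 0) :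
    ∃ u, ∀ a ∈ s, f a u ≠ 0 := by
  classical
  induction s using Finset.induction_on with
  | empty => exact ⟨0, by simp⟩
  | insert a s ha ih =>
    obtain ⟨u, hu⟩ := ih (fun b hb => h b (Finset.mem_insert_of_mem hb))
    by_cases hau : f a u = 0
    · obtain ⟨u', hu'⟩ := h a (Finset.mem_insert_self _ _)
      refine ⟨(1 + ∑ b ∈ s, |f b u'|) • u + u', ?_⟩
      intro b hb
      rw [map_add, map_smul, smul_eq_mul]
      rcases Finset.mem_insert.1 hb with rfl | hb
      · rw [hau, mul_zero, zero_add]; exact hu'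
      · intro hc
        have h1 : |f b u'| ≤ ∑ b ∈ s, |f b u'| :=
          Finset.single_le_sum (f := fun b => |f b u'|) (fun _ _ => abs_nonneg _) hb
        have h2 : 1 ≤ |f b u| := Int.one_le_abs (hu b hb)
        have h3 : |f b u'| = (1 + ∑ b ∈ s, |f b u'|) * |f b u| := by
          rw [← abs_of_nonneg (show 0 ≤ 1 + ∑ b ∈ s, |f b u'| by
            have := Finset.sum_nonneg (s := s) (f := fun b => |f b u'|) (fun _ _ => abs_nonneg _)
            omega), ← abs_mul, eq_neg_of_add_eq_zero_left hc, abs_neg]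
        nlinarith [abs_nonneg (f b u')]
    · exact ⟨u, fun b hb => by
        rcases Finset.mem_insert.1 hb with rfl | hb
        · exact hau
        · exact hu b hb⟩

variable {F L : Type*} [Field F] [IsAlgClosed F] [CharZero F] [LieRing L] [LieAlgebra F L]
  [FiniteDimensional F L]

namespace SData

/-- transport of generators along an automorphism -/
noncomputable def mapA (S : SData F L) (σ : lieAut F L) : SData F L where
  h i := σ.1 (S.h i)
  e i := σ.1 (S.e i)
  f i := σ.1 (S.f i)
  hh i j := by rw [← σ.2, S.hh, map_zero]
  ef i j := by rw [← σ.2, S.ef]; split_ifs <;> simp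
  he i j := by rw [← σ.2, S.he, map_smul]
  hf i j := by rw [← σ.2, S.hf, map_neg, map_smul]
  se i j := by rw [← σ.2, ← σ.2, S.se, map_zero]
  sf i j := by rw [← σ.2, ← σ.2, S.sf, map_zero]
  gen T h1 h2 := by
    let T' : LieSubalgebra F L :=
      { T.toSubmodule.comap σ.1.toLinearMap with
        lie_mem' := fun {x y} hx hy => by
          have hx' : σ.1 x ∈ T := hx
          have hy' : σ.1 y ∈ T := hy
          change σ.1 ⁅x, y⁆ ∈ T
          rw [σ.2]; exact T.lie_mem hx' hy' }
    intro x
    have h : σ.1.symm x ∈ T' := S.gen T' h1 h2 _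
    have h' : σ.1 (σ.1.symm x) ∈ T := h
    rwa [σ.1.apply_symm_apply] at h'

lemma mapA_W (S : SData F L) (σ : lieAut F L) (x : L) : σ.1 x ∈ (S.mapA σ).W 0 ↔ x ∈ S.W 0 := by
  simp only [mem_W, mapA, pr_zero, Int.cast_zero, zero_smul]
  refine forall_congr' fun i => ?_
  rw [← σ.2]; exact σ.1.map_eq_zero_iff

variable {S : SData F L} [Nontrivial L]

lemma root_ne (u : Lam) (hu : u ∈ Phi) : ∃ x ∈ S.W u, x ≠ 0 := by
  have h := dim_root (S := S) u hu
  have : S.W u ≠ ⊥ := by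
    intro h0
    rw [h0] at h; simp at h
  exact Submodule.exists_mem_ne_zero_of_ne_bot this

lemma W_disj {u v : Lam} {x : L} (hu : x ∈ S.W u) (hv : x ∈ S.W v) (hx : x ≠ 0) : u = v := by
  apply pr_injective
  intro i
  have h : ((pr i u : ℤ) : F) • x = ((pr i v : ℤ) : F) • x := by rw [← hu i, ← hv i]
  have := smul_left_injective F hx h
  exact_mod_cast this

lemma W_line {u : Lam} (hu : u ∈ Phi) {x y : L} (hx : x ∈ S.W u) (h0 : x ≠ 0) (hy : y ∈ S.W u) :
    ∃ c : F, y = c • x := by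
  have h := dim_root (S := S) u hu
  have := (finrank_eq_one_iff_of_nonzero' (⟨x, hx⟩ : S.W u) (by
    intro h; exact h0 (congrArg Subtype.val h))).1 h ⟨y, hy⟩
  obtain ⟨c, hc⟩ := this
  exact ⟨c, (congrArg Subtype.val hc).symm⟩

lemma t_mem (u : Lam) : S.t u ∈ S.W 0 := by
  rw [← tc_range]; exact ⟨_, rfl⟩

lemma t_sr (i : Fin 8) : S.t (sr i) = S.h i := by
  rw [t, tc_apply]
  simp [sr, Pi.single_apply]

lemma t_add (u v : Lam) : S.t (u + v) = S.t u + S.t v := by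
  rw [t, t, t, ← map_add]; congr 1; funext i; simp

lemma t_zero : S.t 0 = 0 := by
  rw [t, ← map_zero S.tc]; congr 1; funext i; simp

lemma t_smul (c : ℤ) (u : Lam) : S.t (c • u) = (c : F) • S.t u := by
  rw [t, t, ← map_smul]; congr 1; funext i; simp

lemma t_sum {ι : Type*} (s : Finset ι) (f : ι → Lam) : S.t (∑ i ∈ s, f i) = ∑ i ∈ s, S.t (f i) :=
  map_sum ({ toFun := S.t, map_zero' := t_zero, map_add' := t_add } : Lam →+ L) f s

lemma t_inj {u v : Lam} (h : S.t u = S.t v) : u = v := by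
  have := tc_inj h
  funext i
  have := congrFun this i
  exact_mod_cast this

lemma t_eq_sum (u : Lam) : S.t u = ∑ i, (u i : F) • S.t (sr i) := by
  simp only [t_sr]; rw [t, tc_apply]

lemma killing_th (u : Lam) (j : Fin 8) : killingForm F L (S.t u) (S.h j) = 60 * ((pr j u : ℤ) : F) := by
  rw [t, killing_t]
  congr 1
  rw [show pr j u = ip u (sr j) from ip_comm _ _, ip_eq_sum]
  push_cast; rfl

lemma killing_ttc (u : Lam) (d : Fin 8 → F) :
    killingForm F L (S.t u) (S.tc d) = 60 * ∑ j, d j * ((pr j u : ℤ) : F) := by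
  rw [tc_apply, map_sum, Finset.mul_sum]
  apply Finset.sum_congr rfl
  intro j _
  rw [map_smul, killing_th, smul_eq_mul]; ring

lemma killing_tt (u v : Lam) : killingForm F L (S.t u) (S.t v) = 60 * ((ip u v : ℤ) : F) := by
  conv_lhs => rw [t.eq_1 S v]
  rw [killing_ttc, ip_comm, ip_eq_sum]
  push_cast; rfl

lemma exists_img (q : lieAut F L) (h1 : ∀ x ∈ S.W 0, q.1 x ∈ S.W 0)
    (h2 : ∀ x ∈ S.W 0, q.1.symm x ∈ S.W 0) (a : Lam) (ha : a ∈ Phi) :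
    ∃ b, q.1 (S.t a) = S.t b := by
  obtain ⟨x, hx, hx0⟩ := root_ne (S := S) a ha
  have hd : ∀ j, ∃ d, S.tc d = q.1.symm (S.h j) := fun j => by
    have : q.1.symm (S.h j) ∈ S.W 0 := h2 _ (h_mem j)
    rw [← tc_range] at this; exact this
  choose d hd using hd
  have hb1 : ∀ j, ⁅S.h j, q.1 x⁆ = (∑ i, d j i * ((pr i a : ℤ) : F)) • q.1 x := by
    intro j
    rw [← map_smul, ← tc_lie hx, q.2, hd, q.1.apply_symm_apply]
  have hqx : q.1 x ≠ 0 := fun h => hx0 (q.1.map_eq_zero_iff.1 h)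
  obtain ⟨b, hb⟩ := mem_some_W hqx _ hb1
  refine ⟨b, ?_⟩
  have hs : ∀ j, ∑ i, d j i * ((pr i a : ℤ) : F) = ((pr j b : ℤ) : F) := by
    intro j
    apply smul_left_injective F hqx
    change _ • _ = _ • _
    rw [← hb1, hb j]
  have hm : q.1 (S.t a) ∈ S.W 0 := h1 _ (t_mem a)
  rw [← tc_range] at hm
  obtain ⟨c, hc⟩ := hm
  rw [← hc, t]
  congr 1
  rw [← sub_eq_zero]
  apply pr_cast_inj
  intro j
  have e1 : killingForm F L (S.tc c) (S.h j) = killingForm F L (S.t b) (S.h j) := by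
    rw [hc, killing_th, ← hs, ← killing_ttc (S := S), hd, ← killing_aut q (S.t a) (q.1.symm (S.h j)), q.1.apply_symm_apply]
  rw [t, killing_t, killing_t] at e1
  have e2 := mul_left_cancel₀ (by norm_num : (60:F) ≠ 0) e1
  simp only [Pi.sub_apply, sub_mul, Finset.sum_sub_distrib]
  rw [e2, sub_self]

lemma exists_lin (q : lieAut F L) (h1 : ∀ x ∈ S.W 0, q.1 x ∈ S.W 0)
    (h2 : ∀ x ∈ S.W 0, q.1.symm x ∈ S.W 0) :
    ∃ M : Lam →ₗ[ℤ] Lam, ∀ u, q.1 (S.t u) = S.t (M u) := by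
  choose b hb using fun i : Fin 8 => exists_img q h1 h2 (sr i) (sr_mem_Phi i)
  refine ⟨Fintype.linearCombination ℤ b, fun u => ?_⟩
  rw [Fintype.linearCombination_apply, t_sum, t_eq_sum, map_sum]
  exact Finset.sum_congr rfl fun i _ => by rw [map_smul, hb, t_smul]

lemma exists_iso (q : lieAut F L) (h1 : ∀ x ∈ S.W 0, q.1 x ∈ S.W 0)
    (h2 : ∀ x ∈ S.W 0, q.1.symm x ∈ S.W 0) :
    ∃ M : Lam ≃ₗ[ℤ] Lam, IsI M ∧ ∀ u, q.1 (S.t u) = S.t (M u) := by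
  obtain ⟨M, hM⟩ := exists_lin q h1 h2
  obtain ⟨N, hN⟩ := exists_lin q⁻¹ h2 h1
  have hN' : ∀ u, q.1.symm (S.t u) = S.t (N u) := hN
  refine ⟨LinearEquiv.ofLinearMap M N ?_ ?_, ?_, hM⟩
  · ext1 u
    apply LinearMap.ext_ring
    apply t_inj (S := S)
    simp only [LinearMap.comp_apply, LinearMap.id_apply]
    rw [← hM, ← hN', q.1.apply_symm_apply]
  · ext1 u
    apply LinearMap.ext_ring
    apply t_inj (S := S)
    simp only [LinearMap.comp_apply, LinearMap.id_apply]
    rw [← hN', ← hM, q.1.symm_apply_apply]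
  · intro u v
    have := killing_aut q (S.t u) (S.t v)
    rw [hM, hM, killing_tt, killing_tt] at this
    have := mul_left_cancel₀ (by norm_num : (60:F) ≠ 0) this
    exact_mod_cast this

lemma iso_W {q : lieAut F L} {M : Lam ≃ₗ[ℤ] Lam} (hI : IsI M) (hM : ∀ u, q.1 (S.t u) = S.t (M u))
    {u : Lam} {x : L} (hx : x ∈ S.W u) : q.1 x ∈ S.W (M u) := by
  intro i
  have : S.h i = q.1 (S.t (M.symm (sr i))) := by rw [hM, M.apply_symm_apply, t_sr]
  rw [this, ← q.2, t_lie hx, map_smul]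
  congr 2
  rw [← hI, M.apply_symm_apply]; rfl

end SData
end E8Proof

namespace E8Proof
set_option linter.unusedSectionVars false

variable {F L : Type*} [Field F] [IsAlgClosed F] [CharZero F] [LieRing L] [LieAlgebra F L]
  [FiniteDimensional F L]

namespace SData

lemma Mono.char {S : SData F L} {θ : lieAut F L} {z : F} (hz : z ≠ 0) {v : Lam}
    (he : ∀ i, θ.1 (S.e i) = z ^ (pr i v) • S.e i) {u : Lam} {x : L} (h : S.Mono u x) :
    θ.1 x = z ^ (ip v u) • x := by
  induction h with
  | base i => rw [he, ip_comm]; rfl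
  | step i u x _ ih =>
    rw [θ.2, he, ih, smul_lie, lie_smul, smul_smul, ← zpow_add₀ hz, ip_add_right, ip_comm v (sr i)]; rfl

lemma char_W {S : SData F L} {θ : lieAut F L} {z : F} (hz : z ≠ 0) {v : Lam}
    (he : ∀ i, θ.1 (S.e i) = z ^ (pr i v) • S.e i) (hf : ∀ i, θ.1 (S.f i) = z ^ (-pr i v) • S.f i)
    (hh : ∀ i, θ.1 (S.h i) = S.h i) {u : Lam} {x : L} (h : x ∈ S.W u) : θ.1 x = z ^ (ip v u) • x := by
  rw [W_eq] at h
  induction h using Submodule.span_induction with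
  | mem x hx =>
    rcases hx with ⟨rfl, i, rfl⟩ | h | h
    · rw [hh, ip_zero_right, zpow_zero, one_smul]
    · exact h.char hz he
    · have := Mono.char (S := S.swap) (v := -v) hz (fun i => by rw [pr_neg]; exact hf i) h
      rwa [ip_neg_left, ip_neg_right, neg_neg] at this
  | zero => simp
  | add x y _ _ hx hy => rw [map_add, hx, hy, smul_add]
  | smul c x _ hx => rw [map_smul, hx, smul_comm]

variable {S : SData F L} [Nontrivial L]

lemma iso_pow {q : lieAut F L} {M : Lam ≃ₗ[ℤ] Lam} (hM : ∀ u, q.1 (S.t u) = S.t (M u)) (k : ℕ) (u : Lam) :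
    (q ^ k).1 (S.t u) = S.t ((M ^ k) u) := by
  induction k generalizing u with
  | zero => rfl
  | succ k ih =>
    rw [pow_succ, pow_succ]
    change (q ^ k).1 (q.1 (S.t u)) = _
    rw [hM, ih]; rfl

lemma iso_trivial {θ : lieAut F L} {n : ℕ} (hn : 0 < n) (hθn : θ ^ n = 1) {M : Lam ≃ₗ[ℤ] Lam} (hI : IsI M)
    (hM : ∀ u, θ.1 (S.t u) = S.t (M u))
    (hcent : ∀ y, (∀ x ∈ S.W 0, θ.1 x = x → ⁅x, y⁆ = 0) → y ∈ S.W 0) (u : Lam) : M u = u := by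
  let P : Lam →ₗ[ℤ] Lam := ∑ k ∈ Finset.range n, (M ^ k).toLinearMap
  have hP : ∀ u, P u = ∑ k ∈ Finset.range n, (M ^ k) u := fun u => by
    simp [P, LinearMap.sum_apply]
  obtain ⟨u0, hu0⟩ := generic_vec Phi (fun a => ipL a ∘ₗ P) (by
    intro a ha
    by_contra hcon
    push Not at hcon
    obtain ⟨y, hy, hy0⟩ := root_ne (S := S) a ha
    have : y ∈ S.W 0 := by
      apply hcent
      intro x hx hfx
      rw [← tc_range] at hx
      obtain ⟨c, rfl⟩ := hx
      have hfk : ∀ k : ℕ, (θ ^ k).1 (S.tc c) = S.tc c := by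
        intro k
        induction k with
        | zero => rfl
        | succ k ih =>
          rw [pow_succ]
          change (θ ^ k).1 (θ.1 _) = _
          rw [hfx, ih]
      have e1 : (n : F) • S.tc c = ∑ i, c i • S.t (P (sr i)) := by
        have : ∀ k, S.tc c = ∑ i, c i • S.t ((M ^ k) (sr i)) := by
          intro k
          conv_lhs => rw [← hfk k, tc_apply]
          rw [map_sum]
          exact Finset.sum_congr rfl fun i _ => by rw [map_smul, ← t_sr, iso_pow hM]
        calc (n : F) • S.tc c = ∑ k ∈ Finset.range n, S.tc c := by
              rw [Finset.sum_const, Finset.card_range, Nat.cast_smul_eq_nsmul]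
          _ = ∑ k ∈ Finset.range n, ∑ i, c i • S.t ((M ^ k) (sr i)) :=
              Finset.sum_congr rfl fun k _ => this k
          _ = _ := by
              rw [Finset.sum_comm]
              exact Finset.sum_congr rfl fun i _ => by rw [hP, t_sum, Finset.smul_sum]
      have e2 : ⁅(n : F) • S.tc c, y⁆ = 0 := by
        rw [e1, sum_lie]
        apply Finset.sum_eq_zero
        intro i _
        have : ip (P (sr i)) a = 0 := by rw [ip_comm]; exact hcon (sr i)
        rw [smul_lie, t_lie hy, this]; simp
      rw [smul_lie, smul_eq_zero] at e2
      exact e2.resolve_left (by exact_mod_cast hn.ne')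
    have := W_disj hy this hy0
    exact zero_not_mem_Phi (this ▸ ha))
  have hMn : M ^ n = 1 := by
    apply LinearEquiv.ext
    intro u
    apply t_inj (S := S)
    rw [← iso_pow hM, hθn]; rfl
  refine chamber M hI (P u0) (fun a ha => by rw [ip_comm]; exact hu0 a ha) ?_ u
  rw [hP, map_sum]
  have e : ∀ k, M ((M ^ k) u0) = (M ^ (k + 1)) u0 := fun k => by rw [pow_succ']; rfl
  simp only [e]
  have h1 := Finset.sum_range_succ' (fun k => (M ^ k) u0) n
  rw [Finset.sum_range_succ, hMn] at h1
  exact (add_right_cancel h1).symm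

variable {Q : Subgroup (lieAut F L)}

lemma exists_char {θ : lieAut F L} {n : ℕ} (hn : 0 < n) (hθn : θ ^ n = 1)
    (ht : ∀ u, θ.1 (S.t u) = S.t u) {z : F} (hz : IsPrimitiveRoot z n) :
    ∃ v : Lam, ∀ u, ∀ x ∈ S.W u, θ.1 x = z ^ (ip v u) • x := by
  have hh : ∀ i, θ.1 (S.h i) = S.h i := fun i => by rw [← t_sr, ht]
  have hz0 : z ≠ 0 := hz.ne_zero hn.ne'
  have hW : ∀ {u x}, x ∈ S.W u → θ.1 x ∈ S.W u := fun {u x} hx => by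
    intro i
    rw [← hh i, ← θ.2, hx i, map_smul]
  have hk : ∀ i, ∃ k : ℕ, θ.1 (S.e i) = z ^ k • S.e i := by
    intro i
    obtain ⟨c, hc⟩ := W_line (sr_mem_Phi i) (e_mem (S := S) i) (e_ne_zero i) (hW (e_mem i))
    have hp : ∀ m : ℕ, (θ ^ m).1 (S.e i) = c ^ m • S.e i := by
      intro m
      induction m with
      | zero => simp
      | succ m ih =>
        rw [pow_succ]
        change (θ ^ m).1 (θ.1 _) = _
        rw [hc, map_smul, ih, smul_smul, pow_succ']
    have hcn : c ^ n = 1 := by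
      apply smul_left_injective F (e_ne_zero (S := S) i)
      change c ^ n • _ = (1:F) • _
      rw [← hp, hθn, one_smul]; rfl
    have : NeZero n := ⟨hn.ne'⟩
    obtain ⟨k, -, hk⟩ := hz.eq_pow_of_pow_eq_one hcn
    exact ⟨k, by rw [hc, hk]⟩
  choose k hk using hk
  have he : ∀ i, θ.1 (S.e i) = z ^ (pr i (ofPr fun i => (k i : ℤ))) • S.e i := fun i => by
    rw [pr_ofPr, zpow_natCast, hk]
  refine ⟨ofPr (fun i => (k i : ℤ)), fun u x hx => char_W hz0 he ?_ hh hx⟩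
  intro i
  have f0 : S.f i ≠ 0 := e_ne_zero (S := S.swap) i
  obtain ⟨c, hc⟩ := W_line (neg_mem_Phi (sr_mem_Phi i)) (f_mem (S := S) i) f0 (hW (f_mem i))
  have h0 : S.h i ≠ 0 := by
    intro h0
    have := t_sr (S := S) i
    rw [h0, ← t_zero (S := S)] at this
    exact sr_ne_zero i (t_inj this)
  have hef : ⁅S.e i, S.f i⁆ = S.h i := by rw [S.ef, if_pos rfl]
  have := hh i
  rw [← hef, θ.2, he, hc, smul_lie, lie_smul, smul_smul, hef] at this
  have h1 : z ^ (pr i (ofPr fun i => (k i : ℤ))) * c = 1 := by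
    apply smul_left_injective F h0
    change _ • _ = (1:F) • _
    rw [this, one_smul]
  rw [hc, zpow_neg, eq_inv_of_mul_eq_one_right h1]

theorem main_lattice [LieAlgebra.IsKilling F L] (hQ : IsMaximalFiniteAbelian Q) {θ : lieAut F L} (hθ : θ ∈ Q)
    (hstab : ∀ q ∈ Q, ∀ x ∈ S.W 0, q.1 x ∈ S.W 0)
    (hcent : ∀ y, (∀ x ∈ S.W 0, θ.1 x = x → ⁅x, y⁆ = 0) → y ∈ S.W 0) (h6 : 6 ∣ orderOf θ) :
    orderOf θ = 6 ∧ ∃ (z : F) (v : Lam), IsPrimitiveRoot z 6 ∧ (∀ u, ∀ x ∈ S.W u, θ.1 x = z ^ (ip v u) • x) ∧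
      ∃ g, IsI g ∧ ∃ w, g v = om4 + (6:ℤ) • w := by
  have hstab' : ∀ q ∈ Q, ∀ x ∈ S.W 0, q.1.symm x ∈ S.W 0 := fun q hq x hx => hstab q⁻¹ (Q.inv_mem hq) x hx
  obtain ⟨m, hm, hm2⟩ := exists_pow hQ hθ
  have hn : 0 < orderOf θ := orderOf_pos_iff.2 (isOfFinOrder_iff_pow_eq_one.2 ⟨m, hm,
    Subtype.ext (LinearEquiv.ext fun y => by rw [pow_act]; exact hm2 y)⟩)
  have hθn := pow_orderOf_eq_one θ
  obtain ⟨M0, hI0, hM0⟩ := exists_iso θ (hstab θ hθ) (hstab' θ hθ)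
  have ht : ∀ u, θ.1 (S.t u) = S.t u := fun u => by
    rw [hM0, iso_trivial hn hθn hI0 hM0 hcent]
  have : NeZero (orderOf θ) := ⟨hn.ne'⟩
  have : NeZero ((orderOf θ : ℕ) : F) := ⟨by exact_mod_cast hn.ne'⟩
  obtain ⟨z, hz⟩ := HasEnoughRootsOfUnity.exists_primitiveRoot F (orderOf θ)
  have hz0 : z ≠ 0 := hz.ne_zero hn.ne'
  obtain ⟨v, hv⟩ := exists_char (S := S) hn hθn ht hz
  have key := lattice_main (orderOf θ : ℤ) (by exact_mod_cast hn) (by exact_mod_cast h6) v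
    {M | IsI M ∧ ∃ q ∈ Q, ∀ u, q.1 (S.t u) = S.t (M u)} (fun a ha => ha.1) ?_ ?_ ?_
  · have h6 : orderOf θ = 6 := by exact_mod_cast key.1
    exact ⟨h6, z, v, h6 ▸ hz, hv, key.2⟩
  · intro u hu
    apply t_inj (S := S)
    rw [t_zero]
    apply fixed_zero hQ
    intro q hq
    obtain ⟨M, hI, hM⟩ := exists_iso q (hstab q hq) (hstab' q hq)
    rw [hM, hu M ⟨hI, q, hq, hM⟩]
  · rintro M ⟨hI, q, hq, hM⟩
    have hd : ∀ i, ∃ k, pr i (M v - v) = (orderOf θ : ℤ) * k := by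
      intro i
      change (orderOf θ : ℤ) ∣ _
      have hroot := hI.symm.mem (sr_mem_Phi i)
      obtain ⟨x, hx, hx0⟩ := root_ne (S := S) _ hroot
      have hqx := iso_W hI hM hx
      rw [M.apply_symm_apply] at hqx
      have e1 : θ.1 (q.1 x) = q.1 (θ.1 x) :=
        congrArg (fun a : lieAut F L => a.1 x) (hQ.2.1 θ q hθ hq)
      rw [hv _ _ hqx, hv _ _ hx, map_smul] at e1
      have hqx0 : q.1 x ≠ 0 := fun h => hx0 (q.1.map_eq_zero_iff.1 h)
      have e2 := smul_left_injective F hqx0 e1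
      have e3 : z ^ (pr i (M v - v)) = 1 := by
        have a1 : pr i (M v) = ip v (M.symm (sr i)) := by
          rw [← hI v, M.apply_symm_apply, ip_comm]; rfl
        have a2 : pr i v = ip v (sr i) := ip_comm _ _
        rw [pr_sub, a1, a2, zpow_sub₀ hz0, e2, div_self (zpow_ne_zero _ hz0)]
      exact hz.zpow_eq_one_iff_dvd _ |>.1 e3
    choose k hk using hd
    refine ⟨ofPr k, ?_⟩
    apply pr_injective
    intro i
    have := hk i
    rw [pr_sub] at this
    rw [pr_add, pr_smul, pr_ofPr]; linarith
  · rintro k ⟨w, hw⟩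
    have hpow : ∀ m : ℕ, ∀ u, ∀ x ∈ S.W u, (θ ^ m).1 x = (z ^ (ip v u)) ^ m • x := by
      intro m u x hx
      induction m with
      | zero => simp
      | succ m ih =>
        rw [pow_succ]
        change (θ ^ m).1 (θ.1 _) = _
        rw [hv u x hx, map_smul, ih, smul_smul, pow_succ']
    have h1 : θ ^ k.natAbs = 1 := by
      apply Subtype.ext
      apply LinearEquiv.ext
      intro x
      have hx : x ∈ ⨆ u, S.W u := by rw [W_top]; trivial
      induction hx using Submodule.iSup_induction' with
      | mem u x hx =>
        rw [hpow _ u x hx]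
        have : (z ^ (ip v u)) ^ k.natAbs = 1 := by
          rw [← zpow_natCast, ← zpow_mul, hz.zpow_eq_one_iff_dvd]
          have : k * ip v u = orderOf θ * ip w u := by
            rw [← ip_smul_left, hw, ip_smul_left]
          rcases Int.natAbs_eq k with h | h
          · rw [← h, mul_comm, this]; exact dvd_mul_right _ _
          · rw [show ((k.natAbs : ℕ) : ℤ) = -k by omega, mul_comm, neg_mul, this]
            exact (dvd_mul_right _ _).neg_right
        rw [this, one_smul]; rfl
      | zero => simp
      | add x y _ _ hx hy => rw [map_add, map_add, hx, hy]
    have := orderOf_dvd_of_pow_eq_one h1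
    exact Int.natCast_dvd.2 this

end SData
end E8Proof

namespace E8Proof
set_option linter.unusedSectionVars false

variable {F L : Type*} [Field F] [IsAlgClosed F] [CharZero F] [LieRing L] [LieAlgebra F L]
  [FiniteDimensional F L]

/-- trace of an automorphism -/
noncomputable def tr (q : lieAut F L) : F := LinearMap.trace F L q.1.toLinearMap

lemma sum_char (y : F) (hy : y ^ 6 = 1) : ∑ u ∈ Phi, y ^ (u 3) =
    38 + 36 * y + 45 * y ^ 2 + 40 * y ^ 3 + 45 * y ^ 4 + 36 * y ^ 5 := by
  have hy0 : y ≠ 0 := by rintro rfl; norm_num at hy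
  have h1 : ∀ m : ℤ, y ^ m = y ^ (m % 6) := by
    intro m
    conv_lhs => rw [← Int.emod_add_mul_ediv m 6, zpow_add₀ hy0, zpow_mul]
    have : y ^ (6 : ℤ) = 1 := by exact_mod_cast hy
    rw [this, one_zpow, mul_one]
  have h2 : ∀ u ∈ Phi, y ^ (u 3) = ∑ k : Fin 6, if u 3 % 6 = (k.val : ℤ) then y ^ k.val else 0 := by
    intro u _
    rw [h1]
    obtain ⟨k, hk⟩ : ∃ k : Fin 6, u 3 % 6 = (k.val : ℤ) :=
      ⟨⟨(u 3 % 6).toNat, by omega⟩, by simp only []; omega⟩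
    rw [hk, Finset.sum_eq_single k]
    · simp
    · intro b _ hb
      rw [if_neg]
      intro h
      apply hb
      apply Fin.ext
      exact_mod_cast h.symm
    · simp
  rw [Finset.sum_congr rfl h2, Finset.sum_comm]
  have h3 : ∀ k : Fin 6, (∑ u ∈ Phi, if u 3 % 6 = (k.val : ℤ) then y ^ k.val else 0) =
      (((![38,36,45,40,45,36] : Fin 6 → ℕ) k : ℕ) : F) * y ^ k.val := by
    intro k
    rw [← Finset.sum_filter, Finset.sum_const, count_Phi, nsmul_eq_mul]
  rw [Finset.sum_congr rfl fun k _ => h3 k, Fin.sum_univ_six]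
  simp

namespace SData
variable [Nontrivial L] {Q : Subgroup (lieAut F L)}

lemma W0_ss (S : SData F L) (x : L) (hx : x ∈ S.W 0) : (LieAlgebra.ad F L x).IsSemisimple := by
  have hab : ∀ i : Fin 8, ∀ y ∈ S.W 0, ⁅S.h i, y⁆ = 0 := fun i y hy => by
    rw [hy i, pr_zero]; simp
  rw [W_zero, Hspan] at hx
  induction hx using Submodule.span_induction with
  | mem x hx => obtain ⟨i, rfl⟩ := hx; exact h_ss i
  | zero => rw [map_zero]; exact Module.End.isSemisimple_zero
  | add x y hx hy h1 h2 =>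
    refine ss_add ?_ h1 h2
    rw [← Hspan, ← W_zero, ← tc_range] at hx
    rw [← Hspan, ← W_zero] at hy
    obtain ⟨c, rfl⟩ := hx
    rw [tc_lie hy]; simp [pr_zero]
  | smul c x _ h => exact ss_smul c h

theorem traces (S0 : SData F L) (hQ : IsMaximalFiniteAbelian Q) {θ : lieAut F L} (hθ : θ ∈ Q)
    (h6 : 6 ∣ orderOf θ) : orderOf θ = 6 ∧ tr θ = -3 ∧ tr (θ ^ 2) = 5 ∧ tr (θ ^ 3) = 24 := by
  have := S0.isKilling
  obtain ⟨t, h1, h2, h3, h4⟩ := torus_exists hQ hθ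
  obtain ⟨σ, hσ⟩ := torus_conj (F := F) t (S0.W 0) h2 h3 (fun y hy => h4 y fun x hx _ => hy x hx)
    (fun x hx y hy => by
      rw [← tc_range] at hx
      obtain ⟨c, rfl⟩ := hx
      rw [tc_lie hy]; simp [pr_zero])
    S0.W0_ss (fun y hy i => by rw [hy _ (h_mem i), pr_zero]; simp)
  let S := S0.mapA σ⁻¹
  have hS : ∀ x, x ∈ S.W 0 ↔ x ∈ t := by
    intro x
    rw [hσ, ← S0.mapA_W σ⁻¹]
    change _ ↔ σ.1.symm (σ.1 x) ∈ _
    rw [σ.1.symm_apply_apply]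
  obtain ⟨hord, z, v, hz, hv, g, hg, w, hw⟩ := main_lattice (S := S) hQ hθ
    (fun q hq x hx => (hS _).2 (h1 q hq x ((hS x).1 hx)))
    (fun y hy => (hS y).2 (h4 y fun x hx => hy x ((hS x).2 hx))) h6
  have hz0 : z ≠ 0 := hz.ne_zero (by norm_num)
  have z6 : z ^ 6 = 1 := hz.pow_eq_one
  have hpow : ∀ m : ℕ, ∀ u, ∀ x ∈ S.W u, (θ ^ m).1 x = (z ^ (ip v u)) ^ m • x := by
    intro m u x hx
    induction m with
    | zero => simp
    | succ m ih =>
      rw [pow_succ]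
      change (θ ^ m).1 (θ.1 _) = _
      rw [hv u x hx, map_smul, ih, smul_smul, pow_succ']
  have htr : ∀ m : ℕ, tr (θ ^ m) = 8 + (38 + 36 * z ^ m + 45 * (z ^ m) ^ 2 + 40 * (z ^ m) ^ 3
      + 45 * (z ^ m) ^ 4 + 36 * (z ^ m) ^ 5) := by
    intro m
    have hy6 : (z ^ m) ^ 6 = 1 := by rw [← pow_mul, mul_comm, pow_mul, z6, one_pow]
    have e := trace_eq (S := S) (θ ^ m).1.toLinearMap (fun u => (z ^ (ip v u)) ^ m)
      (fun u _ x hx => hpow m u x hx)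
    rw [tr, e, ip_zero_right, zpow_zero, one_pow, mul_one, ← sum_char _ hy6]
    refine congrArg (fun s : F => 8 + s) ?_
    refine Finset.sum_bij (fun u _ => g u) (fun u hu => hg.mem hu)
      (fun a _ b _ h => g.injective h)
      (fun b hb => ⟨g.symm b, hg.symm.mem hb, g.apply_symm_apply b⟩) ?_
    intro u _
    rw [← hg v u, hw, ip_add_left, ip_smul_left, ip_om4, zpow_add₀ hz0, zpow_mul]
    have : z ^ (6 : ℤ) = 1 := by exact_mod_cast z6
    rw [this, one_zpow, mul_one, ← zpow_natCast, ← zpow_natCast, ← zpow_mul, ← zpow_mul, mul_comm]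
  have z3 : z ^ 3 = -1 := by
    have h : (z ^ 3 - 1) * (z ^ 3 + 1) = 0 := by linear_combination z6
    rcases mul_eq_zero.1 h with h | h
    · exact absurd (sub_eq_zero.1 h) (hz.pow_ne_one_of_pos_of_lt (by norm_num) (by norm_num))
    · linear_combination h
  have z2 : z ^ 2 = z - 1 := by
    have h : (z + 1) * (z ^ 2 - z + 1) = 0 := by linear_combination z3
    rcases mul_eq_zero.1 h with h | h
    · have : z ^ 2 = 1 := by linear_combination (z - 1) * h
      exact absurd this (hz.pow_ne_one_of_pos_of_lt (by norm_num) (by norm_num))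
    · linear_combination h
  refine ⟨hord, ?_, ?_, ?_⟩
  · have := htr 1
    rw [pow_one, pow_one] at this
    rw [this]
    linear_combination 40 * z3 + 45 * z * z3 + 36 * z ^ 2 * z3 + 9 * z2
  · rw [htr]
    have e4 : z ^ 4 = - z := by linear_combination z * z3
    have : (z ^ 2) ^ 3 = 1 := by linear_combination z6
    rw [show (z ^ 2) ^ 5 = (z ^ 2) ^ 3 * z ^ 4 by ring, show (z ^ 2) ^ 4 = (z ^ 2) ^ 3 * z ^ 2 by ring, this,
      show (z ^ 2) ^ 2 = z ^ 4 by ring, e4, z2]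
    ring
  · rw [htr, z3]; norm_num

end SData
end E8Proof

namespace E8Proof
set_option linter.unusedSectionVars false

lemma elem_ab (p : ℕ) [Fact p.Prime] (A : Type*) [CommGroup A] [Finite A] (h : ∀ a : A, a ^ p = 1) :
    ∃ n : ℕ, Nat.card A = p ^ n ∧ Nonempty (A ≃* Multiplicative (Fin n → ZMod p)) := by
  let : Module (ZMod p) (Additive A) := AddCommGroup.zmodModule (n := p) (fun x => h x.toMul)
  let b := Module.finBasis (ZMod p) (Additive A)
  let e : Additive A ≃+ (Fin (Module.finrank (ZMod p) (Additive A)) → ZMod p) := b.equivFun.toAddEquiv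
  refine ⟨Module.finrank (ZMod p) (Additive A), ?_, ⟨(MulEquiv.toAdditive.symm : _ → _) e⟩⟩
  have := Nat.card_congr e.toEquiv
  rw [Nat.card_fun, Nat.card_zmod, Nat.card_eq_fintype_card (α := Fin _), Fintype.card_fin] at this
  exact this

lemma zmod_six : Nonempty (Multiplicative (Fin 3 → ZMod 2) × Multiplicative (Fin 3 → ZMod 3) ≃*
    Multiplicative (Fin 3 → ZMod 6)) := by
  let c : ZMod 6 ≃+* ZMod 2 × ZMod 3 := ZMod.chineseRemainder (m := 2) (n := 3) (by norm_num)
  refine ⟨{ toFun := fun x => Multiplicative.ofAdd fun i => c.symm (x.1.toAdd i, x.2.toAdd i)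
            invFun := fun x => (Multiplicative.ofAdd fun i => (c (x.toAdd i)).1,
              Multiplicative.ofAdd fun i => (c (x.toAdd i)).2)
            left_inv := fun x => by simp
            right_inv := fun x => by simp
            map_mul' := fun x y => ?_ }⟩
  change (fun i => c.symm (x.1.toAdd i + y.1.toAdd i, x.2.toAdd i + y.2.toAdd i)) =
    (fun i => c.symm (x.1.toAdd i, x.2.toAdd i) + c.symm (y.1.toAdd i, y.2.toAdd i))
  funext i
  rw [← map_add]; rfl

lemma arith (a b : ℕ) (ha : 1 ≤ a) (hb : 1 ≤ b)
    (h : (248 : ℤ) + 24 * (2 ^ a - 1) + 5 * (3 ^ b - 1) - 3 * (2 ^ a - 1) * (3 ^ b - 1) = 0) :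
    (a = 3 ∧ b = 3) ∨ (a = 2 ∧ b = 4) := by
  have h1 : (3 * (2:ℤ) ^ a - 8) * (3 ^ b - 9) = 288 := by linear_combination -h
  have ha2 : a ≠ 1 := by
    rintro rfl
    have : (0:ℤ) < 3 ^ b := by positivity
    omega
  have h4 : (4:ℤ) ≤ 2 ^ a := by
    calc (4:ℤ) = 2 ^ 2 := by norm_num
      _ ≤ 2 ^ a := pow_le_pow_right₀ (by norm_num) (by omega)
  have hb2 : (0:ℤ) < 3 ^ b - 9 := by
    by_contra hc
    nlinarith
  have hb3 : 3 ≤ b := by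
    by_contra hc
    have : b = 1 ∨ b = 2 := by omega
    rcases this with rfl | rfl <;> norm_num at hb2
  have hb4 : b ≤ 4 := by
    by_contra hc
    have : (3:ℤ) ^ 5 ≤ 3 ^ b := pow_le_pow_right₀ (by norm_num) (by omega)
    nlinarith
  have hb' : b = 3 ∨ b = 4 := by omega
  rcases hb' with rfl | rfl
  · left
    have : (2:ℤ) ^ a = 2 ^ 3 := by norm_num at h1 ⊢; linarith
    exact ⟨Nat.pow_right_injective (le_refl 2) (by exact_mod_cast this), rfl⟩
  · right
    have : (2:ℤ) ^ a = 2 ^ 2 := by norm_num at h1 ⊢; linarith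
    exact ⟨Nat.pow_right_injective (le_refl 2) (by exact_mod_cast this), rfl⟩

lemma sum_prod {F : Type*} [Field F] {K T : Type*} [Group K] [Group T] [Fintype K] [Fintype T]
    (f : K × T → F) (h11 : f (1, 1) = 248) (h1 : ∀ x, x ≠ 1 → f (x, 1) = 24) (h2 : ∀ y, y ≠ 1 → f (1, y) = 5)
    (h3 : ∀ x y, x ≠ 1 → y ≠ 1 → f (x, y) = -3) :
    ∑ x, f x = 248 + 24 * ((Nat.card K : F) - 1) + 5 * ((Nat.card T : F) - 1)
      - 3 * ((Nat.card K : F) - 1) * ((Nat.card T : F) - 1) := by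
  classical
  have hK : ((Finset.univ.erase (1 : K)).card : F) = (Nat.card K : F) - 1 := by
    rw [Finset.card_erase_of_mem (Finset.mem_univ _), Finset.card_univ, Nat.card_eq_fintype_card,
      Nat.cast_sub Fintype.card_pos, Nat.cast_one]
  have hT : ((Finset.univ.erase (1 : T)).card : F) = (Nat.card T : F) - 1 := by
    rw [Finset.card_erase_of_mem (Finset.mem_univ _), Finset.card_univ, Nat.card_eq_fintype_card,
      Nat.cast_sub Fintype.card_pos, Nat.cast_one]
  have inner1 : ∑ y, f (1, y) = 248 + 5 * ((Nat.card T : F) - 1) := by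
    rw [← Finset.add_sum_erase _ _ (Finset.mem_univ (1 : T)), h11,
      Finset.sum_congr rfl (fun y hy => h2 y (Finset.ne_of_mem_erase hy)), Finset.sum_const, nsmul_eq_mul, hT]
    ring
  have inner2 : ∀ x, x ≠ 1 → ∑ y, f (x, y) = 24 - 3 * ((Nat.card T : F) - 1) := by
    intro x hx
    rw [← Finset.add_sum_erase _ _ (Finset.mem_univ (1 : T)), h1 x hx,
      Finset.sum_congr rfl (fun y hy => h3 x y hx (Finset.ne_of_mem_erase hy)), Finset.sum_const, nsmul_eq_mul, hT]
    ring
  rw [Fintype.sum_prod_type, ← Finset.add_sum_erase _ _ (Finset.mem_univ (1 : K)), inner1,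
    Finset.sum_congr rfl (fun x hx => inner2 x (Finset.ne_of_mem_erase hx)), Finset.sum_const, nsmul_eq_mul, hK]
  ring

theorem group_final {F : Type*} [Field F] [CharZero F] {A : Type} [CommGroup A] [Finite A] (χ : A → F)
    (h6 : ∃ θ : A, orderOf θ = 6)
    (hθ : ∀ θ : A, 6 ∣ orderOf θ → orderOf θ = 6 ∧ χ θ = -3 ∧ χ (θ ^ 2) = 5 ∧ χ (θ ^ 3) = 24)
    (h1 : χ 1 = 248)
    (hsum : ∀ (H : Type) [CommGroup H] [Fintype H] (φ : H →* A),
      ∃ d : ℕ, ∑ h, χ (φ h) = (Nat.card H : F) * d ∧ (Function.Surjective φ → d = 0)) :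
    Nonempty (A ≃* Multiplicative (Fin 3 → ZMod 6)) := by
  classical
  have := Fintype.ofFinite A
  obtain ⟨θ, hθ6⟩ := h6
  have hexp : ∀ q : A, q ^ 6 = 1 := by
    obtain ⟨g, hg⟩ := Monoid.exists_orderOf_eq_exponent (Monoid.ExponentExists.of_finite (G := A))
    have : 6 ∣ orderOf g := by rw [hg, ← hθ6]; exact Monoid.order_dvd_exponent θ
    have h := (hθ g this).1
    intro q
    rw [← h, hg]; exact Monoid.pow_exponent_eq_one q
  let Q2 : Subgroup A := (powMonoidHom 2 : A →* A).ker
  let Q3 : Subgroup A := (powMonoidHom 3 : A →* A).ker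
  have m2 : ∀ q, q ∈ Q2 ↔ q ^ 2 = 1 := fun q => Iff.rfl
  have m3 : ∀ q, q ∈ Q3 ↔ q ^ 3 = 1 := fun q => Iff.rfl
  have o2 : ∀ q, q ∈ Q2 → q ≠ 1 → orderOf q = 2 := fun q hq h => orderOf_eq_prime ((m2 q).1 hq) h
  have o3 : ∀ q, q ∈ Q3 → q ≠ 1 → orderOf q = 3 := fun q hq h => orderOf_eq_prime ((m3 q).1 hq) h
  have o6 : ∀ x y, x ∈ Q2 → y ∈ Q3 → x ≠ 1 → y ≠ 1 → 6 ∣ orderOf (x * y) := by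
    intro x y hx hy hx1 hy1
    rw [(Commute.all x y).orderOf_mul_eq_mul_orderOf_of_coprime (by rw [o2 x hx hx1, o3 y hy hy1]; norm_num),
      o2 x hx hx1, o3 y hy hy1]
  have ha : θ ^ 3 ∈ Q2 := by rw [m2, ← pow_mul]; exact hexp θ
  have hb : θ ^ 2 ∈ Q3 := by rw [m3, ← pow_mul]; exact hexp θ
  have ha1 : θ ^ 3 ≠ 1 := pow_ne_one_of_lt_orderOf (by norm_num) (by rw [hθ6]; norm_num)
  have hb1 : θ ^ 2 ≠ 1 := pow_ne_one_of_lt_orderOf (by norm_num) (by rw [hθ6]; norm_num)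
  have c2 : ∀ x ∈ Q2, x ≠ 1 → χ x = 24 := by
    intro x hx hx1
    have h := (hθ _ (o6 x _ hx hb hx1 hb1)).2.2.2
    rwa [mul_pow, (m3 _).1 hb, mul_one, pow_succ, (m2 x).1 hx, one_mul] at h
  have c3 : ∀ y ∈ Q3, y ≠ 1 → χ y = 5 := by
    intro y hy hy1
    have hy' : y ^ 2 ∈ Q3 := Q3.pow_mem hy 2
    have hy4 : (y ^ 2) ^ 2 = y := by rw [← pow_mul, pow_succ, (m3 y).1 hy, one_mul]
    have h := (hθ _ (o6 _ _ ha hy' ha1 (by intro h; rw [h, one_pow] at hy4; exact hy1 hy4.symm))).2.2.1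
    rwa [mul_pow, (m2 _).1 ha, one_mul, hy4] at h
  have c6 : ∀ x y, x ∈ Q2 → y ∈ Q3 → x ≠ 1 → y ≠ 1 → χ (x * y) = -3 := fun x y hx hy hx1 hy1 =>
    (hθ _ (o6 x y hx hy hx1 hy1)).2.1
  have key : ∀ (K : Subgroup A) (_ : K ≤ Q2) (i : Fintype (K × Q3)), ∑ x : K × Q3, χ (K.subtype.coprod Q3.subtype x) =
      248 + 24 * ((Nat.card K : F) - 1) + 5 * ((Nat.card Q3 : F) - 1)
      - 3 * ((Nat.card K : F) - 1) * ((Nat.card Q3 : F) - 1) := by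
    intro K hK i
    obtain rfl : i = instFintypeProd _ _ := Subsingleton.elim _ _
    refine sum_prod (fun x : K × Q3 => χ (K.subtype.coprod Q3.subtype x)) ?_ ?_ ?_ ?_
    · simp [h1]
    · intro x hx
      have := c2 x.1 (hK x.2) (fun h => hx (Subtype.ext h))
      simpa using this
    · intro y hy
      have := c3 y.1 y.2 (fun h => hy (Subtype.ext h))
      simpa using this
    · intro x y hx hy
      have := c6 x.1 y.1 (hK x.2) y.2 (fun h => hx (Subtype.ext h)) (fun h => hy (Subtype.ext h))
      simpa using this
  have hdec : ∀ q : A, q ^ 3 ∈ Q2 ∧ q ^ 4 ∈ Q3 ∧ q ^ 3 * q ^ 4 = q := by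
    intro q
    refine ⟨by rw [m2, ← pow_mul]; exact hexp q, by
      rw [m3, ← pow_mul, show 4 * 3 = 6 * 2 by norm_num, pow_mul, hexp, one_pow], ?_⟩
    rw [← pow_add, pow_succ, hexp, one_mul]
  have hbij : Function.Bijective (Q2.subtype.coprod Q3.subtype) := by
    constructor
    · rw [injective_iff_map_eq_one]
      rintro ⟨x, y⟩ hxy
      have hxy' : x.1 * y.1 = 1 := by simpa using hxy
      have e1 := congrArg (· ^ 3) hxy'
      have e2 := congrArg (· ^ 4) hxy'
      simp only [mul_pow, one_pow] at e1 e2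
      have x2 := (m2 _).1 x.2
      have y3 := (m3 _).1 y.2
      rw [y3, mul_one, pow_succ, x2, one_mul] at e1
      rw [e1, one_pow, one_mul, pow_succ, y3, one_mul] at e2
      exact Prod.ext (Subtype.ext e1) (Subtype.ext e2)
    · intro q
      exact ⟨(⟨_, (hdec q).1⟩, ⟨_, (hdec q).2.1⟩), by simpa using (hdec q).2.2⟩
  have : Fact (Nat.Prime 2) := ⟨Nat.prime_two⟩
  have : Fact (Nat.Prime 3) := ⟨Nat.prime_three⟩
  obtain ⟨a, hca, ⟨ea⟩⟩ := elem_ab 2 Q2 (fun x => Subtype.ext ((m2 _).1 x.2))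
  obtain ⟨b, hcb, ⟨eb⟩⟩ := elem_ab 3 Q3 (fun x => Subtype.ext ((m3 _).1 x.2))
  have ha0 : 1 ≤ a := by
    rcases Nat.eq_zero_or_pos a with rfl | h
    · rw [pow_zero, Nat.card_eq_one_iff_unique] at hca
      have := hca.1
      exact absurd (congrArg Subtype.val (Subsingleton.elim (⟨_, ha⟩ : Q2) 1)) ha1
    · exact h
  have hb0 : 1 ≤ b := by
    rcases Nat.eq_zero_or_pos b with rfl | h
    · rw [pow_zero, Nat.card_eq_one_iff_unique] at hcb
      have := hcb.1
      exact absurd (congrArg Subtype.val (Subsingleton.elim (⟨_, hb⟩ : Q3) 1)) hb1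
    · exact h
  have hz : (248 : ℤ) + 24 * (2 ^ a - 1) + 5 * (3 ^ b - 1) - 3 * (2 ^ a - 1) * (3 ^ b - 1) = 0 := by
    obtain ⟨d, hd, hd0⟩ := hsum (Q2 × Q3) (Q2.subtype.coprod Q3.subtype)
    rw [key Q2 le_rfl _, hd0 hbij.2, hca, hcb] at hd
    push_cast at hd
    rw [mul_zero] at hd
    exact_mod_cast hd
  rcases arith a b ha0 hb0 hz with ⟨rfl, rfl⟩ | ⟨rfl, rfl⟩
  · obtain ⟨e⟩ := zmod_six
    exact ⟨((MulEquiv.ofBijective _ hbij).symm.trans (ea.prodCongr eb)).trans e⟩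
  · exfalso
    have hK : Subgroup.zpowers (θ ^ 3) ≤ Q2 := by rw [Subgroup.zpowers_le]; exact ha
    obtain ⟨d, hd, -⟩ := hsum (Subgroup.zpowers (θ ^ 3) × Q3) ((Subgroup.zpowers (θ ^ 3)).subtype.coprod Q3.subtype)
    rw [key _ hK _, Nat.card_prod, Nat.card_zpowers, o2 _ ha ha1, hcb] at hd
    norm_num at hd
    have : (432 : ℕ) = 162 * d := by exact_mod_cast hd
    omega

variable {F L : Type} [Field F] [IsAlgClosed F] [CharZero F] [LieRing L] [LieAlgebra F L]
  [FiniteDimensional F L]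

lemma sum_tr {Q : Subgroup (lieAut F L)} [LieAlgebra.IsKilling F L] (hQ : IsMaximalFiniteAbelian Q)
    (H : Type) [Group H] [Fintype H] (φ : H →* Q) :
    ∃ d : ℕ, ∑ h, tr (φ h).1 = (Nat.card H : F) * d ∧ (Function.Surjective φ → d = 0) := by
  let ρ : Representation F H L :=
    { toFun := fun h => (φ h).1.1.toLinearMap
      map_one' := by rw [map_one]; rfl
      map_mul' := fun x y => by rw [map_mul]; rfl }
  have hne : (Nat.card H : F) ≠ 0 := by exact_mod_cast Nat.card_pos.ne'
  have : Invertible (Nat.card H : F) := invertibleOfNonzero hne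
  refine ⟨Module.finrank F ρ.invariants, ?_, ?_⟩
  · rw [← ρ.card_inv_mul_sum_char_eq_finrank, mul_inv_cancel_left₀ hne]; rfl
  · intro hs
    have : ρ.invariants = ⊥ := by
      rw [eq_bot_iff]
      intro x hx
      rw [Submodule.mem_bot]
      apply fixed_zero hQ
      intro q hq
      obtain ⟨h, hh⟩ := hs ⟨q, hq⟩
      have h1 : (φ h).1.1 x = x := hx h
      rwa [hh] at h1
    rw [this, finrank_bot]

theorem final (S : SData F L) [Nontrivial L] (Q : Subgroup (lieAut F L)) (hQ : IsMaximalFiniteAbelian Q)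
    (h6 : ∃ θ ∈ Q, orderOf θ = 6) : Nonempty (Q ≃* Multiplicative (Fin 3 → ZMod 6)) := by
  have := S.isKilling
  have hfin : Finite Q := hQ.1
  let inst : CommGroup Q :=
    { (inferInstance : Group Q) with mul_comm := fun a b => Subtype.ext (hQ.2.1 a b a.2 b.2) }
  obtain ⟨θ, hθ, ho⟩ := h6
  refine group_final (F := F) (A := Q) (fun q => tr q.1) ⟨⟨θ, hθ⟩, by rw [← ho, Subgroup.orderOf_mk]⟩ ?_ ?_ ?_
  · intro q hq
    rw [← Subgroup.orderOf_coe] at hq ⊢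
    exact S.traces hQ q.2 hq
  · have e := SData.trace_eq (S := S) (LinearMap.id : L →ₗ[F] L) (fun _ => 1) (fun u _ x _ => by simp)
    have e2 := sum_char (1 : F) (one_pow 6)
    simp only [one_zpow] at e2
    rw [e2] at e
    change LinearMap.trace F L LinearMap.id = 248
    rw [e]; norm_num
  · intro H _ _ φ
    exact sum_tr hQ H φ

end E8Proof

theorem stmt5 (F : Type) [Field F] [IsAlgClosed F] [CharZero F]
    (Q : Subgroup ↥(lieAut F (LieAlgebra.e₈ F))) (hQ : IsMaximalFiniteAbelian Q)
    (h6 : ∃ θ ∈ Q, orderOf θ = 6) :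
    Nonempty (Q ≃* Multiplicative (Fin 3 → ZMod 6)) := by
  have hnt : Nontrivial (LieAlgebra.e₈ F) := by
    by_contra hc
    rw [not_nontrivial_iff_subsingleton] at hc
    obtain ⟨θ, -, ho⟩ := h6
    have : θ = 1 := Subtype.ext (LinearEquiv.ext fun x => Subsingleton.elim _ _)
    rw [this, orderOf_one] at ho
    omega
  have := (E8Proof.stdData F).fin_L
  exact E8Proof.final (E8Proof.stdData F) Q hQ h6
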